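/- If G is a connected unichord-free graph, then G is a complete graph, or a sparse graph, or a 2-extension of the Petersen graph or of the Heawood graph, or G has a 1-cutset, a proper 2-cutset, or a proper 1-join. -/

import Mathlib

open SimpleGraph

/-- An edge `e` of `G` is a chord of the cycle `c` if it joins two vertices of `c`
but is not an edge of `c`. -/
def IsChord {V : Type} (G : SimpleGraph V) {v : V} (c : G.Walk v v) (e : Sym2 V) : Prop :=
  e ∈ G.edgeSet ∧ e ∉ c.edges ∧ ∀ x ∈ e, x ∈ c.support

/-- A graph is unichord-free if no cycle has a unique chord. -/
def UnichordFree {V : Type} (G : SimpleGraph V) : Prop :=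
  ∀ (v : V) (c : G.Walk v v), c.IsCycle → ¬ ∃! e : Sym2 V, IsChord G c e

/-- `G` contains a square, i.e. an induced cycle on four vertices. -/
def HasSquare {V : Type} (G : SimpleGraph V) : Prop :=
  ∃ a b c d : V, G.Adj a b ∧ G.Adj b c ∧ G.Adj c d ∧ G.Adj d a ∧
    ¬ G.Adj a c ∧ ¬ G.Adj b d ∧ a ≠ c ∧ b ≠ d

/-- A total colouring: adjacent vertices, adjacent edges, and incident
vertex-edge pairs get different colours. -/
def IsTotalColouring {V α : Type} (G : SimpleGraph V) (fv : V → α) (fe : Sym2 V → α) : Prop :=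
  (∀ u v, G.Adj u v → fv u ≠ fv v) ∧
  (∀ e₁ e₂, e₁ ∈ G.edgeSet → e₂ ∈ G.edgeSet → e₁ ≠ e₂ → (∃ x, x ∈ e₁ ∧ x ∈ e₂) →
    fe e₁ ≠ fe e₂) ∧
  (∀ x e, e ∈ G.edgeSet → x ∈ e → fv x ≠ fe e)

/-- `G` admits a total colouring with `k` colours. -/
def TotalColourable {V : Type} (G : SimpleGraph V) (k : ℕ) : Prop :=
  ∃ (fv : V → Fin k) (fe : Sym2 V → Fin k), IsTotalColouring G fv fe

/-- A proper edge colouring with `k` colours. -/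
def EdgeColourable {V : Type} (G : SimpleGraph V) (k : ℕ) : Prop :=
  ∃ fe : Sym2 V → ℕ, (∀ e ∈ G.edgeSet, fe e < k) ∧
    ∀ e₁ e₂, e₁ ∈ G.edgeSet → e₂ ∈ G.edgeSet → e₁ ≠ e₂ → (∃ x, x ∈ e₁ ∧ x ∈ e₂) →
      fe e₁ ≠ fe e₂

/-- Two-connectivity: at least three vertices and deleting any single vertex
leaves a connected graph. -/
def TwoConnected {V : Type} (G : SimpleGraph V) : Prop :=
  3 ≤ (Set.univ : Set V).ncard ∧ ∀ v : V, (G.induce ({v}ᶜ : Set V)).Connected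

/-- A graph is sparse if its vertices of degree at least 3 form an independent set. -/
def Sparse {V : Type} (G : SimpleGraph V) : Prop :=
  ∀ u v, G.Adj u v → ¬ (3 ≤ (G.neighborSet u).ncard ∧ 3 ≤ (G.neighborSet v).ncard)

/-- `G` is a cycle graph. -/
def IsCycleGraph {V : Type} (G : SimpleGraph V) : Prop :=
  G.Connected ∧ ∀ v : V, (G.neighborSet v).ncard = 2

/-- The Petersen graph: outer 5-cycle `a`, inner pentagram `b`, spokes `aᵢbᵢ`. -/
def petersen : SimpleGraph (Fin 5 ⊕ Fin 5) :=
  SimpleGraph.fromRel (fun x y => match x, y with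
    | Sum.inl i, Sum.inl j => j = i + 1
    | Sum.inr i, Sum.inr j => j = i + 2
    | Sum.inl i, Sum.inr j => i = j
    | Sum.inr _, Sum.inl _ => False)

/-- The Heawood graph: a 14-cycle together with the seven standard chords. -/
def heawood : SimpleGraph (Fin 14) :=
  SimpleGraph.fromRel (fun i j => j = i + 1 ∨
    (i, j) ∈ ([((0 : Fin 14), (9 : Fin 14)), (1, 6), (2, 11), (3, 8), (4, 13), (5, 10),
      (7, 12)] : List (Fin 14 × Fin 14)))

/-- Subdivide the edge `uv` of `G`: the new vertex is `Sum.inr ()`. -/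
def SubdivideEdge {V : Type} (G : SimpleGraph V) (u v : V) : SimpleGraph (V ⊕ Unit) :=
  SimpleGraph.fromRel (fun x y => match x, y with
    | Sum.inl a, Sum.inl b => G.Adj a b ∧ ¬ (s(a, b) = s(u, v))
    | Sum.inl a, Sum.inr _ => a = u ∨ a = v
    | Sum.inr _, Sum.inl _ => False
    | Sum.inr _, Sum.inr _ => False)

/-- `G` is obtained from `H` (up to isomorphism) by repeatedly subdividing edges
incident to at least one vertex of degree 2. -/
inductive IsSubdivisionOf : {W : Type} → SimpleGraph W → {U : Type} → SimpleGraph U → Prop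
  | refl : ∀ {W : Type} (H : SimpleGraph W) {U : Type} (G : SimpleGraph U),
      (G ≃g H) → IsSubdivisionOf H G
  | step : ∀ {W : Type} (H : SimpleGraph W) {U : Type} (G : SimpleGraph U) (u v : U),
      G.Adj u v → ((G.neighborSet u).ncard = 2 ∨ (G.neighborSet v).ncard = 2) →
      IsSubdivisionOf H G → ∀ {U' : Type} (G' : SimpleGraph U'),
      (G' ≃g SubdivideEdge G u v) → IsSubdivisionOf H G'

/-- A 2-extension of `H`: first delete a set `S` of vertices of `H`, then
subdivide edges incident to at least one vertex of degree 2. -/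
def IsTwoExtensionOf {W U : Type} (H : SimpleGraph W) (G : SimpleGraph U) : Prop :=
  ∃ S : Set W, IsSubdivisionOf (H.induce Sᶜ) G

/-- `G'` is the reduced graph of `G`: every branch of `G'` has length at most 2
(no degree-2 vertex has a neighbour of degree 2) and `G` is obtained from `G'`
by subdividing edges incident to degree-2 vertices. -/
def IsReducedGraphOf {W U : Type} (G' : SimpleGraph W) (G : SimpleGraph U) : Prop :=
  (∀ v : W, (G'.neighborSet v).ncard = 2 →
    ∀ w ∈ G'.neighborSet v, 3 ≤ (G'.neighborSet w).ncard) ∧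
  IsSubdivisionOf G' G

/-- There is an `ab`-path of `G` all of whose vertices lie in `S`. -/
def ContainsPathBetween {V : Type} (G : SimpleGraph V) (S : Set V) (a b : V) : Prop :=
  ∃ p : G.Walk a b, p.IsPath ∧ ∀ v ∈ p.support, v ∈ S

/-- The subgraph of `G` induced by `S` is precisely an `ab`-path. -/
def InducedIsPathGraph {V : Type} (G : SimpleGraph V) (S : Set V) (a b : V) : Prop :=
  ∃ p : G.Walk a b, p.IsPath ∧ (∀ v, v ∈ S ↔ v ∈ p.support) ∧
    ∀ u v, u ∈ S → v ∈ S → G.Adj u v → s(u, v) ∈ p.edges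

/-- `(X, Y, a, b)` is a split of a proper 2-cutset of `G`. -/
structure IsProper2CutsetSplit {V : Type} (G : SimpleGraph V) (X Y : Set V) (a b : V) :
    Prop where
  hne : a ≠ b
  hnadj : ¬ G.Adj a b
  hcover : ∀ v, v ∈ X ∨ v ∈ Y ∨ v = a ∨ v = b
  hdisj : Disjoint X Y
  haX : a ∉ X
  haY : a ∉ Y
  hbX : b ∉ X
  hbY : b ∉ Y
  hX2 : 2 ≤ X.ncard
  hY2 : 2 ≤ Y.ncard
  hsep : ∀ x ∈ X, ∀ y ∈ Y, ¬ G.Adj x y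
  hXpath : ContainsPathBetween G (X ∪ {a, b}) a b
  hXnotpath : ¬ InducedIsPathGraph G (X ∪ {a, b}) a b
  hYpath : ContainsPathBetween G (Y ∪ {a, b}) a b
  hYnotpath : ¬ InducedIsPathGraph G (Y ∪ {a, b}) a b

/-- `G` has a proper 2-cutset. -/
def HasProper2Cutset {V : Type} (G : SimpleGraph V) : Prop :=
  ∃ (a b : V) (X Y : Set V), IsProper2CutsetSplit G X Y a b

/-- `G` has a 1-cutset (a cutvertex) with split `(X, Y, v)`. -/
def Has1Cutset {V : Type} (G : SimpleGraph V) : Prop :=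
  ∃ (v : V) (X Y : Set V), X.Nonempty ∧ Y.Nonempty ∧ Disjoint X Y ∧ v ∉ X ∧ v ∉ Y ∧
    (∀ w, w ∈ X ∨ w ∈ Y ∨ w = v) ∧ ∀ x ∈ X, ∀ y ∈ Y, ¬ G.Adj x y

/-- `(X, Y, A, B)` is a split of a proper 1-join of `G`. -/
structure IsProper1JoinSplit {V : Type} (G : SimpleGraph V) (X Y A B : Set V) : Prop where
  hcover : ∀ v, v ∈ X ∨ v ∈ Y
  hdisj : Disjoint X Y
  hAX : A ⊆ X
  hBY : B ⊆ Y
  hA2 : 2 ≤ A.ncard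
  hB2 : 2 ≤ B.ncard
  hAstable : ∀ u ∈ A, ∀ v ∈ A, ¬ G.Adj u v
  hBstable : ∀ u ∈ B, ∀ v ∈ B, ¬ G.Adj u v
  hcomplete : ∀ u ∈ A, ∀ v ∈ B, G.Adj u v
  hother : ∀ u ∈ X, ∀ v ∈ Y, G.Adj u v → u ∈ A ∧ v ∈ B

/-- `G` has a proper 1-join. -/
def HasProper1Join {V : Type} (G : SimpleGraph V) : Prop :=
  ∃ X Y A B : Set V, IsProper1JoinSplit G X Y A B

namespace UF

variable {V : Type} {G : SimpleGraph V}

/-- Some vertex of `A` is adjacent to some vertex of `B`. -/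
def Touch (G : SimpleGraph V) (A B : Set V) : Prop := ∃ a ∈ A, ∃ b ∈ B, G.Adj a b

lemma Touch.symm {A B : Set V} (h : Touch G A B) : Touch G B A := by
  obtain ⟨a, ha, b, hb, hab⟩ := h
  exact ⟨b, hb, a, ha, hab.symm⟩

lemma touch_comm {A B : Set V} : Touch G A B ↔ Touch G B A := ⟨Touch.symm, Touch.symm⟩

lemma Touch.mono {A B A' B' : Set V} (h : Touch G A B) (hA : A ⊆ A') (hB : B ⊆ B') :
    Touch G A' B' := by
  obtain ⟨a, ha, b, hb, hab⟩ := h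
  exact ⟨a, hA ha, b, hB hb, hab⟩

lemma touch_union_left {A B C : Set V} : Touch G (A ∪ B) C ↔ Touch G A C ∨ Touch G B C := by
  constructor
  · rintro ⟨a, ha | ha, b, hb, hab⟩
    · exact .inl ⟨a, ha, b, hb, hab⟩
    · exact .inr ⟨a, ha, b, hb, hab⟩
  · rintro (h | h)
    · exact h.mono Set.subset_union_left subset_rfl
    · exact h.mono Set.subset_union_right subset_rfl

lemma touch_union_right {A B C : Set V} : Touch G A (B ∪ C) ↔ Touch G A B ∨ Touch G A C := by
  rw [touch_comm, touch_union_left, touch_comm, touch_comm (A := C)]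

@[simp] lemma touch_singleton {a b : V} : Touch G {a} {b} ↔ G.Adj a b := by simp [Touch]

@[simp] lemma not_touch_empty_left {A : Set V} : ¬ Touch G ∅ A := by simp [Touch]

@[simp] lemma not_touch_empty_right {A : Set V} : ¬ Touch G A ∅ := by simp [Touch]

/-- `S` is nonempty and induces a connected subgraph. -/
def Conn (G : SimpleGraph V) (S : Set V) : Prop :=
  S.Nonempty ∧ ∀ A ⊆ S, A.Nonempty → A ≠ S → Touch G A (S \ A)

lemma conn_singleton (a : V) : Conn G {a} := by
  refine ⟨Set.singleton_nonempty a, fun A hA hne hA' => ?_⟩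
  exact absurd (hne.subset_singleton_iff.1 hA) hA'

lemma touch_diff_of_left {S T A : Set V} (hS : Conn G S)
    (h1 : (S ∩ A).Nonempty) (h2 : ¬ S ⊆ A) : Touch G A ((S ∪ T) \ A) := by
  have := hS.2 (S ∩ A) Set.inter_subset_left h1 (fun h => h2 (Set.inter_eq_left.1 h))
  refine this.mono Set.inter_subset_right ?_
  rintro x ⟨hx, hx'⟩
  exact ⟨.inl hx, fun h => hx' ⟨hx, h⟩⟩

/-- The union of two connected sets that touch each other is connected. -/
lemma Conn.union_touch {S T : Set V} (hS : Conn G S) (hT : Conn G T) (h : Touch G S T) :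
    Conn G (S ∪ T) := by
  refine ⟨hS.1.mono Set.subset_union_left, fun A hA hne hA' => ?_⟩
  by_cases hSA : (S ∩ A).Nonempty
  · by_cases hS' : S ⊆ A
    · by_cases hTA : (T ∩ A).Nonempty
      · have hT' : ¬ T ⊆ A := fun h' => hA' (subset_antisymm hA (Set.union_subset hS' h'))
        rw [Set.union_comm S T] at *
        exact touch_diff_of_left hT hTA hT'
      · obtain ⟨s, hs, t, ht, hst⟩ := h
        exact ⟨s, hS' hs, t, ⟨.inr ht, fun h' => hTA ⟨t, ht, h'⟩⟩, hst⟩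
    · exact touch_diff_of_left hS hSA hS'
  · obtain ⟨a, ha⟩ := hne
    have hTA : (T ∩ A).Nonempty := by
      rcases hA ha with h' | h'
      · exact absurd ⟨a, h', ha⟩ hSA
      · exact ⟨a, h', ha⟩
    by_cases hT' : T ⊆ A
    · obtain ⟨s, hs, t, ht, hst⟩ := h
      exact ⟨t, hT' ht, s, ⟨.inl hs, fun h' => hSA ⟨s, hs, h'⟩⟩, hst.symm⟩
    · rw [Set.union_comm S T] at *
      exact touch_diff_of_left hT hTA hT'

lemma Conn.insert_adj {S : Set V} (hS : Conn G S) {x y : V} (hy : y ∈ S) (h : G.Adj x y) :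
    Conn G (insert x S) := by
  rw [Set.insert_eq]
  exact (conn_singleton x).union_touch hS ⟨x, rfl, y, hy, h⟩

/-- Every vertex of `R` lies in a component of the subgraph induced by `R`. -/
lemma exists_component [Finite V] {R : Set V} {x : V} (hx : x ∈ R) :
    ∃ S, x ∈ S ∧ S ⊆ R ∧ Conn G S ∧ ∀ y ∈ R, y ∉ S → ∀ s ∈ S, ¬ G.Adj s y := by
  have hfin : {S : Set V | x ∈ S ∧ S ⊆ R ∧ Conn G S}.Finite := Set.toFinite _
  obtain ⟨S, ⟨h1, h2, h3⟩, hmax⟩ := hfin.exists_maximal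
    ⟨{x}, rfl, by simpa using hx, conn_singleton x⟩
  refine ⟨S, h1, h2, h3, fun y hy hyS s hs hadj => hyS ?_⟩
  exact hmax (y := insert y S) ⟨.inr h1, Set.insert_subset hy h2, h3.insert_adj hs hadj.symm⟩
    (Set.subset_insert y S) (Set.mem_insert y S)

/-- A connected set with at least two vertices has a vertex other than `p` whose removal
leaves it connected. -/
lemma Conn.exists_diff_singleton [Finite V] {D : Set V} (hD : Conn G D) {p : V} (hp : p ∈ D)
    (hne : D ≠ {p}) : ∃ d ∈ D, d ≠ p ∧ Conn G (D \ {d}) := by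
  have hfin : {S : Set V | p ∈ S ∧ S ⊂ D ∧ Conn G S}.Finite := Set.toFinite _
  obtain ⟨S, ⟨h1, h2, h3⟩, hmax⟩ := hfin.exists_maximal
    ⟨{p}, rfl, by simpa [Set.ssubset_iff_subset_ne, hp] using hne.symm, conn_singleton p⟩
  obtain ⟨s, hs, d, hd, hadj⟩ := hD.2 S h2.subset h3.1 h2.ne
  have : D \ {d} = S := by
    by_contra hcon
    by_cases hfull : insert d S = D
    · apply hcon
      rw [← hfull]
      ext z
      simp only [Set.mem_sdiff, Set.mem_insert_iff, Set.mem_singleton_iff]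
      constructor
      · rintro ⟨h | h, h'⟩
        · exact absurd h h'
        · exact h
      · exact fun h => ⟨.inr h, fun h' => hd.2 (h' ▸ h)⟩
    · have hle := hmax (y := insert d S)
        ⟨.inr h1, (Set.insert_subset hd.1 h2.subset).ssubset_of_ne hfull,
          h3.insert_adj hs hadj.symm⟩
        (Set.subset_insert d S)
      exact hd.2 (hle (Set.mem_insert d S))
  exact ⟨d, hd.1, fun h => hd.2 (h ▸ h1), this ▸ h3⟩

/-- The walk visiting `c 0, c 1, …, c n`. -/
def walkOf (c : ℕ → V) : (n : ℕ) → (∀ i < n, G.Adj (c i) (c (i + 1))) → G.Walk (c 0) (c n)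
  | 0, _ => .nil
  | n + 1, h => (walkOf c n fun i hi => h i (by omega)).concat (h n (by omega))

lemma mem_support_walkOf (c : ℕ → V) (n : ℕ) (h : ∀ i < n, G.Adj (c i) (c (i + 1))) (x : V) :
    x ∈ (walkOf c n h).support ↔ ∃ i ≤ n, x = c i := by
  induction n with
  | zero => simp [walkOf]
  | succ n ih =>
    rw [walkOf, Walk.support_concat, List.mem_append, ih]
    constructor
    · rintro (⟨i, hi, rfl⟩ | hx)
      · exact ⟨i, by omega, rfl⟩
      · exact ⟨n + 1, le_rfl, by simpa using hx⟩
    · rintro ⟨i, hi, rfl⟩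
      rcases hi.lt_or_eq with hi | rfl
      · exact .inl ⟨i, by omega, rfl⟩
      · simp

lemma mem_edges_walkOf (c : ℕ → V) (n : ℕ) (h : ∀ i < n, G.Adj (c i) (c (i + 1))) (e : Sym2 V) :
    e ∈ (walkOf c n h).edges ↔ ∃ i < n, e = s(c i, c (i + 1)) := by
  induction n with
  | zero => simp [walkOf]
  | succ n ih =>
    rw [walkOf, Walk.edges_concat, List.concat_eq_append, List.mem_append, ih]
    constructor
    · rintro (⟨i, hi, rfl⟩ | hx)
      · exact ⟨i, by omega, rfl⟩
      · exact ⟨n, by omega, by simpa using hx⟩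
    · rintro ⟨i, hi, rfl⟩
      rcases (Nat.lt_succ_iff.1 hi).lt_or_eq with hi | rfl
      · exact .inl ⟨i, by omega, rfl⟩
      · simp

lemma isPath_walkOf (c : ℕ → V) (n : ℕ) (h : ∀ i < n, G.Adj (c i) (c (i + 1)))
    (hinj : ∀ i ≤ n, ∀ j ≤ n, c i = c j → i = j) : (walkOf c n h).IsPath := by
  induction n with
  | zero => simp [walkOf]
  | succ n ih =>
    rw [walkOf]
    refine (ih _ fun i hi j hj => hinj i (by omega) j (by omega)).concat ?_ _
    rw [mem_support_walkOf]
    rintro ⟨i, hi, hc⟩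
    have := hinj _ le_rfl i (by omega) hc
    omega

/-- The cyclic sequence `c 0, …, c m` of distinct vertices cannot have exactly one chord. -/
lemma no_unique_chord (huf : UnichordFree G) (m : ℕ) (c : ℕ → V)
    (hinj : ∀ i ≤ m, ∀ j ≤ m, c i = c j → i = j)
    (hadj : ∀ i < m, G.Adj (c i) (c (i + 1))) (hlast : G.Adj (c m) (c 0)) (b : ℕ)
    (hb : 2 ≤ b) (hbm : b < m) (hchord : G.Adj (c 0) (c b))
    (honly : ∀ i j, i < j → j ≤ m → G.Adj (c i) (c j) →
      j = i + 1 ∨ (i = 0 ∧ j = m) ∨ (i = 0 ∧ j = b)) : False := by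
  have hinj2 : ∀ i ≤ m, ∀ j ≤ m, ∀ k ≤ m, ∀ l ≤ m, s(c i, c j) = s(c k, c l) →
      (i = k ∧ j = l) ∨ (i = l ∧ j = k) := by
    intro i hi j hj k hk l hl h
    rcases Sym2.eq_iff.1 h with ⟨h1, h2⟩ | ⟨h1, h2⟩
    · exact .inl ⟨hinj _ hi _ hk h1, hinj _ hj _ hl h2⟩
    · exact .inr ⟨hinj _ hi _ hl h1, hinj _ hj _ hk h2⟩
  have hcyc : (Walk.cons hlast (walkOf c m hadj)).IsCycle := by
    rw [Walk.cons_isCycle_iff]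
    refine ⟨isPath_walkOf c m hadj hinj, ?_⟩
    rw [mem_edges_walkOf]
    rintro ⟨i, hi, h⟩
    have := hinj2 _ le_rfl _ (by omega) _ hi.le _ hi h
    omega
  have hedge : ∀ i j, i < j → j ≤ m →
      (s(c i, c j) ∈ (Walk.cons hlast (walkOf c m hadj)).edges ↔
        j = i + 1 ∨ (i = 0 ∧ j = m)) := by
    intro i j hij hj
    rw [Walk.edges_cons, List.mem_cons, mem_edges_walkOf]
    constructor
    · rintro (h | ⟨k, hk, h⟩)
      · have := hinj2 i (by omega) j hj m le_rfl 0 (by omega) h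
        omega
      · have := hinj2 i (by omega) j hj k (by omega) (k + 1) (by omega) h
        omega
    · rintro (rfl | ⟨rfl, rfl⟩)
      · exact .inr ⟨i, by omega, rfl⟩
      · exact .inl Sym2.eq_swap
  have hsupp : ∀ x, x ∈ (Walk.cons hlast (walkOf c m hadj)).support ↔ ∃ i ≤ m, x = c i := by
    intro x
    rw [Walk.support_cons, List.mem_cons, mem_support_walkOf]
    exact ⟨fun h => h.elim (fun h => ⟨m, le_rfl, h⟩) id, .inr⟩
  refine huf _ _ hcyc ⟨s(c 0, c b), ⟨hchord, ?_, ?_⟩, ?_⟩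
  · rw [hedge 0 b (by omega) hbm.le]
    omega
  · intro x hx
    rw [hsupp]
    rcases Sym2.mem_iff.1 hx with rfl | rfl
    · exact ⟨0, by omega, rfl⟩
    · exact ⟨b, hbm.le, rfl⟩
  · intro e
    induction e using Sym2.ind with
    | _ x y =>
      rintro ⟨he, hne, hs⟩
      obtain ⟨i, hi, rfl⟩ := (hsupp x).1 (hs x (Sym2.mem_mk_left _ _))
      obtain ⟨j, hj, rfl⟩ := (hsupp y).1 (hs y (Sym2.mem_mk_right _ _))
      have hij : i ≠ j := by
        rintro rfl
        exact G.loopless.irrefl _ he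
      have key : ∀ i j, i < j → j ≤ m → G.Adj (c i) (c j) →
          s(c i, c j) ∉ (Walk.cons hlast (walkOf c m hadj)).edges → s(c i, c j) = s(c 0, c b) := by
        intro i j hij hj ha hne
        rw [hedge i j hij hj] at hne
        rcases honly i j hij hj ha with h | h | ⟨rfl, rfl⟩
        · exact absurd (.inl h) hne
        · exact absurd (.inr h) hne
        · rfl
      rcases hij.lt_or_gt with h | h
      · exact key i j h hj he hne
      · rw [Sym2.eq_swap]
        exact key j i h hi he.symm (Sym2.eq_swap ▸ hne)

/-- `f 0, …, f (k - 1)` is an induced path in `S` whose first vertex is its only vertex touching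
`P` and whose last vertex is its only vertex touching `Q`. -/
structure IndPath (G : SimpleGraph V) (S P Q : Set V) (k : ℕ) (f : ℕ → V) : Prop where
  pos : 0 < k
  mem : ∀ i < k, f i ∈ S
  left : ∀ i < k, Touch G P {f i} ↔ i = 0
  right : ∀ i < k, Touch G Q {f i} ↔ i + 1 = k
  adj : ∀ i < k, ∀ j < k, G.Adj (f i) (f j) ↔ j = i + 1 ∨ i = j + 1

lemma IndPath.inj {S P Q : Set V} {k : ℕ} {f : ℕ → V} (h : IndPath G S P Q k f) :
    ∀ i < k, ∀ j < k, f i = f j → i = j := by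
  have key : ∀ i < k, ∀ j < k, i < j → f i ≠ f j := by
    intro i hi j hj hij he
    rcases Nat.eq_zero_or_pos i with rfl | hpos
    · have h0 := (h.left 0 hi).2 rfl
      rw [he] at h0
      have := (h.left j hj).1 h0
      omega
    · have h1 := (h.adj (i - 1) (by omega) i hi).2 (by omega)
      rw [he] at h1
      have := (h.adj (i - 1) (by omega) j hj).1 h1
      omega
  intro i hi j hj he
  by_contra hne
  rcases Nat.lt_or_gt_of_ne hne with hlt | hlt
  · exact key i hi j hj hlt he
  · exact key j hj i hi hlt he.symm

lemma Conn.exists_chain {S P Q : Set V} (hS : Conn G S) (hP : Touch G P S) (hQ : Touch G Q S) :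
    ∃ k, ∃ f : ℕ → V, 0 < k ∧ (∀ i < k, f i ∈ S) ∧ Touch G P {f 0} ∧ Touch G Q {f (k - 1)} ∧
      ∀ i, i + 1 < k → G.Adj (f i) (f (i + 1)) := by
  let R : Set V := {x | ∃ k, ∃ f : ℕ → V, 0 < k ∧ (∀ i < k, f i ∈ S) ∧ Touch G P {f 0} ∧
    f (k - 1) = x ∧ ∀ i, i + 1 < k → G.Adj (f i) (f (i + 1))}
  have hRS : R = S := by
    by_contra hne
    obtain ⟨p, hp, s, hs, hps⟩ := hP
    have hsub : R ⊆ S := by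
      rintro x ⟨k, f, hk, hf, -, rfl, -⟩
      exact hf _ (by omega)
    obtain ⟨x, ⟨k, f, hk, hf, h0, rfl, hadj⟩, y, ⟨hy, hyR⟩, hxy⟩ := hS.2 R hsub
      ⟨s, 1, fun _ => s, by omega, fun _ _ => hs, ⟨p, hp, s, rfl, hps⟩, rfl,
        fun i hi => by omega⟩ hne
    refine hyR ⟨k + 1, fun i => if i < k then f i else y, by omega, ?_, ?_, ?_, ?_⟩
    · intro i hi
      by_cases h : i < k
      · simpa [h] using hf i h
      · simpa [h] using hy
    · simpa [hk] using h0
    · simp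
    · intro i hi
      by_cases h : i + 1 < k
      · have h' : i < k := by omega
        simpa [h, h'] using hadj i h
      · have h' : i = k - 1 := by omega
        have h'' : i < k := by omega
        show G.Adj (if i < k then f i else y) (if i + 1 < k then f (i + 1) else y)
        rw [if_pos h'', if_neg h, h']
        exact hxy
  obtain ⟨q, hq, s, hs, hqs⟩ := hQ
  rw [← hRS] at hs
  obtain ⟨k, f, hk, hf, h0, rfl, hadj⟩ := hs
  exact ⟨k, f, hk, hf, h0, ⟨q, hq, _, rfl, hqs⟩, hadj⟩

lemma Conn.exists_indPath {S P Q : Set V} (hS : Conn G S) (hP : Touch G P S) (hQ : Touch G Q S) :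
    ∃ k f, IndPath G S P Q k f := by
  classical
  have hex := hS.exists_chain hP hQ
  obtain ⟨f, hk, hf, h0, h1, hadj⟩ := Nat.find_spec hex
  set k := Nat.find hex with hkdef
  have hmin : ∀ m, m < k → ∀ g : ℕ → V, 0 < m → (∀ i < m, g i ∈ S) → Touch G P {g 0} →
      Touch G Q {g (m - 1)} → (∀ i, i + 1 < m → G.Adj (g i) (g (i + 1))) → False :=
    fun m hm g a b c d e => Nat.find_min hex hm ⟨g, a, b, c, d, e⟩
  have hshort : ∀ i j, i < j → j < k → G.Adj (f i) (f j) → j = i + 1 := by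
    intro i j hij hj ha
    by_contra hne
    refine hmin (k - (j - i - 1)) (by omega) (fun n => if n ≤ i then f n else f (n + (j - i - 1)))
      (by omega) ?_ (by simpa using h0) ?_ ?_
    · intro n hn
      by_cases h : n ≤ i
      · simpa [h] using hf n (by omega)
      · simpa [h] using hf (n + (j - i - 1)) (by omega)
    · have h : ¬ (k - (j - i - 1) - 1 ≤ i) := by omega
      have h' : k - (j - i - 1) - 1 + (j - i - 1) = k - 1 := by omega
      simpa only [h, if_false, h'] using h1
    · intro n hn
      rcases lt_trichotomy n i with h | h | h
      · have h' : n + 1 ≤ i := h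
        simpa [h.le, h'] using hadj n (by omega)
      · subst h
        have h' : n + 1 + (j - n - 1) = j := by omega
        simpa [h'] using ha
      · have h2 : ¬ (n ≤ i) := by omega
        have h3 : ¬ (n + 1 ≤ i) := by omega
        have h4 : n + 1 + (j - i - 1) = n + (j - i - 1) + 1 := by omega
        simpa only [h2, h3, if_false, h4] using hadj (n + (j - i - 1)) (by omega)
  refine ⟨k, f, hk, hf, ?_, ?_, ?_⟩
  · intro i hi
    refine ⟨fun h => ?_, fun h => h ▸ h0⟩
    by_contra hne
    refine hmin (k - i) (by omega) (fun n => f (n + i)) (by omega) (fun n hn => hf _ (by omega))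
      (by simpa using h) ?_ ?_
    · have h' : k - i - 1 + i = k - 1 := by omega
      simpa only [h'] using h1
    · intro n hn
      have h' : n + 1 + i = n + i + 1 := by omega
      simpa only [h'] using hadj (n + i) (by omega)
  · intro i hi
    refine ⟨fun h => ?_, fun h => ?_⟩
    · by_contra hne
      refine hmin (i + 1) (by omega) f (by omega) (fun n hn => hf _ (by omega)) h0
        (by simpa using h) (fun n hn => hadj n (by omega))
    · have : i = k - 1 := by omega
      exact this ▸ h1
  · intro i hi j hj
    constructor
    · intro ha
      rcases lt_trichotomy i j with h | h | h
      · exact .inl (hshort i j h hj ha)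
      · exact absurd (h ▸ ha) (G.loopless.irrefl _)
      · exact .inr (hshort j i h hi ha.symm)
    · rintro (rfl | rfl)
      · exact hadj i hj
      · exact (hadj j hi).symm

/-- An edge `u v` cannot be bypassed through two disjoint anticomplete connected sets. -/
lemma no_double_bypass (huf : UnichordFree G) {u v : V} (huv : G.Adj u v) {I J : Set V}
    (hI : Conn G I) (hJ : Conn G J) (hdisj : Disjoint I J) (hIJ : ¬ Touch G I J)
    (huI : u ∉ I) (hvI : v ∉ I) (huJ : u ∉ J) (hvJ : v ∉ J)
    (h1 : Touch G {u} I) (h2 : Touch G {v} I) (h3 : Touch G {u} J) (h4 : Touch G {v} J) :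
    False := by
  obtain ⟨k, f, hf⟩ := hI.exists_indPath h1 h2
  obtain ⟨l, g, hg⟩ := hJ.exists_indPath h3 h4
  have hfl := hf.left
  have hfr := hf.right
  have hgl := hg.left
  have hgr := hg.right
  simp only [touch_singleton] at hfl hfr hgl hgr
  have hk := hf.pos
  have hl := hg.pos
  have hfg : ∀ i < k, ∀ j < l, ¬ G.Adj (f i) (g j) := fun i hi j hj ha =>
    hIJ ⟨_, hf.mem i hi, _, hg.mem j hj, ha⟩
  have hfgne : ∀ i < k, ∀ j < l, f i ≠ g j := fun i hi j hj he =>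
    Set.disjoint_left.1 hdisj (hf.mem i hi) (he ▸ hg.mem j hj)
  have huf' : ∀ i < k, f i ≠ u := fun i hi he => huI (he ▸ hf.mem i hi)
  have hvf' : ∀ i < k, f i ≠ v := fun i hi he => hvI (he ▸ hf.mem i hi)
  have hug' : ∀ i < l, g i ≠ u := fun i hi he => huJ (he ▸ hg.mem i hi)
  have hvg' : ∀ i < l, g i ≠ v := fun i hi he => hvJ (he ▸ hg.mem i hi)
  let c : ℕ → V := fun i => if i = 0 then u else if i ≤ k then f (i - 1) else
    if i = k + 1 then v else g (k + l + 1 - i)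
  have c0 : c 0 = u := by simp [c]
  have c1 : ∀ i, 1 ≤ i → i ≤ k → c i = f (i - 1) := by
    intro i h h'
    simp only [c, show ¬ i = 0 by omega, h', if_true, if_false]
  have c2 : c (k + 1) = v := by simp [c]
  have c3 : ∀ i, k + 2 ≤ i → c i = g (k + l + 1 - i) := by
    intro i h
    simp only [c, show ¬ i = 0 by omega, show ¬ i ≤ k by omega, show ¬ i = k + 1 by omega,
      if_false]
  have hcase : ∀ i ≤ k + l + 1, i = 0 ∨ (1 ≤ i ∧ i ≤ k) ∨ i = k + 1 ∨ k + 2 ≤ i := by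
    intro i hi
    omega
  have hpair : ∀ i j, i < j → j ≤ k + l + 1 → c i ≠ c j ∧ (G.Adj (c i) (c j) ↔
      j = i + 1 ∨ (i = 0 ∧ j = k + l + 1) ∨ (i = 0 ∧ j = k + 1)) := by
    intro i j hij hj
    rcases hcase i (by omega) with rfl | ⟨hi1, hi2⟩ | rfl | hi
    · rw [c0]
      rcases hcase j hj with h | ⟨hj1, hj2⟩ | rfl | hj'
      · omega
      · rw [c1 j hj1 hj2, hfl _ (by omega)]
        exact ⟨(huf' _ (by omega)).symm, by omega⟩
      · rw [c2]
        exact ⟨huv.ne, iff_of_true huv (by omega)⟩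
      · rw [c3 j hj', hgl _ (by omega)]
        exact ⟨(hug' _ (by omega)).symm, by omega⟩
    · rw [c1 i hi1 hi2]
      rcases hcase j hj with h | ⟨hj1, hj2⟩ | rfl | hj'
      · omega
      · rw [c1 j hj1 hj2, hf.adj _ (by omega) _ (by omega)]
        refine ⟨fun h => ?_, by omega⟩
        have := hf.inj _ (by omega) _ (by omega) h
        omega
      · rw [c2, G.adj_comm, hfr _ (by omega)]
        exact ⟨hvf' _ (by omega), by omega⟩
      · rw [c3 j hj']
        exact ⟨hfgne _ (by omega) _ (by omega),
          iff_of_false (hfg _ (by omega) _ (by omega)) (by omega)⟩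
    · rw [c2]
      rcases hcase j hj with h | ⟨hj1, hj2⟩ | h | hj'
      · omega
      · omega
      · omega
      · rw [c3 j hj', hgr _ (by omega)]
        exact ⟨(hvg' _ (by omega)).symm, by omega⟩
    · rw [c3 i hi, c3 j (by omega), hg.adj _ (by omega) _ (by omega)]
      refine ⟨fun h => ?_, by omega⟩
      have := hg.inj _ (by omega) _ (by omega) h
      omega
  refine no_unique_chord huf (k + l + 1) c ?_ ?_ ?_ (k + 1) (by omega) (by omega) ?_ ?_
  · intro i hi j hj he
    by_contra hne
    rcases Nat.lt_or_gt_of_ne hne with h | h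
    · exact (hpair i j h hj).1 he
    · exact (hpair j i h hi).1 he.symm
  · exact fun i hi => (hpair i (i + 1) (by omega) (by omega)).2.2 (by omega)
  · exact ((hpair 0 (k + l + 1) (by omega) le_rfl).2.2 (by omega)).symm
  · exact (hpair 0 (k + 1) (by omega) (by omega)).2.2 (by omega)
  · exact fun i j hij hj ha => (hpair i j hij hj).2.1 ha

lemma conn_pair {a b : V} (h : G.Adj a b) : Conn G {a, b} :=
  (conn_singleton b).insert_adj rfl h

/-- A chain of consecutively adjacent vertices is connected. -/
lemma conn_image_Iio {f : ℕ → V} {k : ℕ} (hk : 0 < k)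
    (hf : ∀ i, i + 1 < k → G.Adj (f i) (f (i + 1))) : Conn G (f '' Set.Iio k) := by
  induction k with
  | zero => omega
  | succ k ih =>
    rcases Nat.eq_zero_or_pos k with rfl | hk'
    · have : f '' Set.Iio (0 + 1) = {f 0} := by
        ext x
        simp
      rw [this]
      exact conn_singleton _
    · have : f '' Set.Iio (k + 1) = insert (f k) (f '' Set.Iio k) := by
        rw [← Set.image_insert_eq]
        congr 1
        ext i
        simp only [Set.mem_Iio, Set.mem_insert_iff]
        omega
      rw [this]
      refine (ih hk' fun i hi => hf i (by omega)).insert_adj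
        (Set.mem_image_of_mem f (Set.mem_Iio.2 (show k - 1 < k by omega))) ?_
      have := hf (k - 1) (by omega)
      rw [show k - 1 + 1 = k by omega] at this
      exact this.symm

lemma IndPath.conn {S P Q : Set V} {k : ℕ} {f : ℕ → V} (h : IndPath G S P Q k f) :
    Conn G (f '' Set.Iio k) :=
  conn_image_Iio h.pos fun i hi => (h.adj i (by omega) _ hi).2 (.inl rfl)

/-- A 2-connected unichord-free graph containing a triangle is complete. -/
theorem eq_top_of_triangle [Finite V] (huf : UnichordFree G) (h1 : ¬ Has1Cutset G) {a b c : V}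
    (hab : G.Adj a b) (hac : G.Adj a c) (hbc : G.Adj b c) : G = ⊤ := by
  have hfin : {K : Set V | {a, b, c} ⊆ K ∧ G.IsClique K}.Finite := Set.toFinite _
  obtain ⟨K, ⟨hK, hclique⟩, hmax⟩ := hfin.exists_maximal ⟨{a, b, c}, subset_rfl, by
    rw [SimpleGraph.isClique_iff, Set.Pairwise]
    simp only [Set.mem_insert_iff, Set.mem_singleton_iff]
    rintro x (rfl | rfl | rfl) y (rfl | rfl | rfl) hne <;>
      first | exact absurd rfl hne | assumption | (apply SimpleGraph.Adj.symm; assumption)⟩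
  have ha : a ∈ K := hK (by simp)
  have hb : b ∈ K := hK (by simp)
  have hc : c ∈ K := hK (by simp)
  have hmax' : ∀ x ∉ K, ∃ w ∈ K, ¬ G.Adj x w := by
    intro x hx
    by_contra! hcon
    refine hx (hmax (y := insert x K) ⟨hK.trans (Set.subset_insert _ _), ?_⟩
      (Set.subset_insert _ _) (Set.mem_insert _ _))
    exact hclique.insert fun y hy _ => hcon y hy
  by_cases huniv : K = Set.univ
  · ext x y
    simp only [SimpleGraph.top_adj]
    exact ⟨fun h => h.ne, fun h => hclique (huniv ▸ trivial) (huniv ▸ trivial) h⟩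
  exfalso
  obtain ⟨x, hx⟩ := (Set.ne_univ_iff_exists_notMem K).1 huniv
  by_cases hex : ∃ C, Conn G C ∧ C ⊆ Kᶜ ∧ ∃ u ∈ K, ∃ v ∈ K, u ≠ v ∧ Touch G {u} C ∧ Touch G {v} C
  · have hfin : {C | Conn G C ∧ C ⊆ Kᶜ ∧ ∃ u ∈ K, ∃ v ∈ K, u ≠ v ∧ Touch G {u} C ∧
        Touch G {v} C}.Finite := Set.toFinite _
    obtain ⟨C, ⟨hC, hCK, u, hu, v, hv, huv, htu, htv⟩, hmin⟩ := hfin.exists_minimal hex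
    have hsmall : ∀ D ⊂ C, Conn G D → ∀ u ∈ K, ∀ v ∈ K, u ≠ v → Touch G {u} D →
        ¬ Touch G {v} D := fun D hD hDc u hu v hv hne h1 h2 =>
      hD.2 (hmin ⟨hDc, hD.1.trans hCK, u, hu, v, hv, hne, h1, h2⟩ hD.1)
    have hw : ∃ w ∈ K, w ≠ u ∧ w ≠ v ∧ ¬ Touch G {w} C := by
      obtain ⟨p, hp⟩ := hC.1
      by_cases hCp : C = {p}
      · obtain ⟨w, hw, hpw⟩ := hmax' p (hCK hp)
        have hno : ¬ Touch G {w} C := by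
          rw [hCp, touch_singleton]
          exact fun h => hpw h.symm
        refine ⟨w, hw, ?_, ?_, hno⟩ <;> rintro rfl <;> contradiction
      · have : ∃ w ∈ K, w ≠ u ∧ w ≠ v := by
          have := hab.ne
          have := hac.ne
          have := hbc.ne
          grind
        obtain ⟨w, hw, hwu, hwv⟩ := this
        refine ⟨w, hw, hwu, hwv, fun htw => ?_⟩
        obtain ⟨d, hd, -, hdc⟩ := hC.exists_diff_singleton hp hCp
        have hss : C \ {d} ⊂ C := ⟨Set.sdiff_subset, fun h => (h hd).2 rfl⟩
        have hd1 : ({d} : Set V) ⊂ C := by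
          refine ⟨by simpa using hd, fun h => ?_⟩
          obtain ⟨e, he⟩ := hdc.1
          exact he.2 (h he.1)
        have hsplit : ∀ z, Touch G {z} C → Touch G {z} (C \ {d}) ∨ Touch G {z} {d} := by
          intro z hz
          rwa [← touch_union_right, Set.sdiff_union_of_subset (by simpa using hd)]
        have k1 := hsmall _ hss hdc
        have k2 := hsmall _ hd1 (conn_singleton d)
        rcases hsplit u htu with h1 | h1 <;> rcases hsplit v htv with h2 | h2 <;>
          rcases hsplit w htw with h3 | h3
        · exact k1 u hu v hv huv h1 h2
        · exact k1 u hu v hv huv h1 h2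
        · exact k1 w hw u hu hwu h3 h1
        · exact k2 w hw v hv hwv h3 h2
        · exact k1 w hw v hv hwv h3 h2
        · exact k2 w hw u hu hwu h3 h1
        · exact k2 u hu v hv huv h1 h2
        · exact k2 u hu v hv huv h1 h2
    obtain ⟨w, hw, hwu, hwv, hnt⟩ := hw
    refine no_double_bypass huf (hclique hu hv huv) hC (conn_singleton w) ?_ ?_ ?_ ?_ ?_ ?_ htu htv
      ?_ ?_
    · rw [Set.disjoint_singleton_right]
      exact fun h => hCK h hw
    · rwa [touch_comm]
    · exact fun h => hCK h hu
    · exact fun h => hCK h hv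
    · exact hwu.symm
    · exact hwv.symm
    · simpa using hclique hu hw hwu.symm
    · simpa using hclique hv hw hwv.symm
  · obtain ⟨C, hxC, hCK, hC, hcomp⟩ := exists_component (G := G) (R := Kᶜ) hx
    have honly : ∃ v ∈ K, ∀ w ∈ K, w ≠ v → ¬ Touch G {w} C := by
      by_cases h : ∃ v ∈ K, Touch G {v} C
      · obtain ⟨v, hv, htv⟩ := h
        exact ⟨v, hv, fun w hw hne htw => hex ⟨C, hC, hCK, w, hw, v, hv, hne, htw, htv⟩⟩
      · exact ⟨a, ha, fun w hw _ hwt => h ⟨w, hw, hwt⟩⟩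
    obtain ⟨v, hv, hov⟩ := honly
    refine h1 ⟨v, C, (insert v C)ᶜ, ⟨x, hxC⟩, ?_, ?_, fun h => hCK h hv, by simp, ?_, ?_⟩
    · have : ∃ w ∈ K, w ≠ v := by
        by_cases h : a = v
        · exact ⟨b, hb, h ▸ hab.ne'⟩
        · exact ⟨a, ha, h⟩
      obtain ⟨w, hw, hwv⟩ := this
      exact ⟨w, fun h => h.elim hwv fun h => hCK h hw⟩
    · exact disjoint_compl_right.mono_left (Set.subset_insert _ _)
    · intro w
      by_cases h1 : w ∈ C <;> by_cases h2 : w = v <;> simp [h1, h2]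
    · intro x hx y hy hadj
      have hyv : y ≠ v := fun h => hy (.inl h)
      have hyC : y ∉ C := fun h => hy (.inr h)
      by_cases hyK : y ∈ K
      · exact hov y hyK hyv ⟨y, rfl, x, hx, hadj.symm⟩
      · exact hcomp y hyK hyC x hx hadj

/-- A triangle-free unichord-free graph containing a square has a proper 1-join. -/
theorem hasProper1Join_of_square [Finite V] (huf : UnichordFree G)
    (htri : ∀ a b c, G.Adj a b → G.Adj a c → ¬ G.Adj b c) {a b c d : V}
    (hab : G.Adj a b) (hbc : G.Adj b c) (hcd : G.Adj c d) (hda : G.Adj d a)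
    (hac : a ≠ c) (hbd : b ≠ d) : HasProper1Join G := by
  have hfin : {p : Set V × Set V | {a, c} ⊆ p.1 ∧ {b, d} ⊆ p.2 ∧
    ∀ x ∈ p.1, ∀ y ∈ p.2, G.Adj x y}.Finite := Set.toFinite _
  obtain ⟨⟨A, B⟩, ⟨hA, hB, hAB⟩, hmax⟩ := hfin.exists_maximal ⟨({a, c}, {b, d}),
    subset_rfl, subset_rfl, by
      simp only [Set.mem_insert_iff, Set.mem_singleton_iff]
      rintro x (rfl | rfl) y (rfl | rfl)
      exacts [hab, hda.symm, hbc.symm, hcd]⟩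
  simp only at hA hB hAB
  have haA : a ∈ A := hA (by simp)
  have hbB : b ∈ B := hB (by simp)
  have hmaxA : ∀ x, x ∉ A → ∃ y ∈ B, ¬ G.Adj x y := by
    intro x hx
    by_contra! hcon
    have := hmax (y := (insert x A, B)) ⟨hA.trans (Set.subset_insert _ _), hB, by
      rintro z (rfl | hz) y hy
      · exact hcon y hy
      · exact hAB z hz y hy⟩ ⟨Set.subset_insert _ _, subset_rfl⟩
    exact hx (this.1 (Set.mem_insert _ _))
  have hmaxB : ∀ x, x ∉ B → ∃ y ∈ A, ¬ G.Adj x y := by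
    intro x hx
    by_contra! hcon
    have := hmax (y := (A, insert x B)) ⟨hA, hB.trans (Set.subset_insert _ _), by
      rintro z hz y (rfl | hy)
      · exact (hcon z hz).symm
      · exact hAB z hz y hy⟩ ⟨subset_rfl, Set.subset_insert _ _⟩
    exact hx (this.2 (Set.mem_insert _ _))
  have hAst : ∀ u ∈ A, ∀ v ∈ A, ¬ G.Adj u v := fun u hu v hv h =>
    htri u v b h (hAB u hu b hbB) (hAB v hv b hbB)
  have hBst : ∀ u ∈ B, ∀ v ∈ B, ¬ G.Adj u v := fun u hu v hv h =>
    htri u v a h (hAB a haA u hu).symm (hAB a haA v hv).symm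
  have hdisj : ∀ x ∈ A, x ∉ B := fun x hx hx' => hAst a haA x hx (hAB a haA x hx')
  have hkey : ∀ S, Conn G S → S ⊆ (A ∪ B)ᶜ → Touch G A S → ¬ Touch G B S := by
    intro S hS hSR htA htB
    obtain ⟨k, f, hf⟩ := hS.exists_indPath htA htB
    have hfR : ∀ i < k, f i ∉ A ∧ f i ∉ B := fun i hi =>
      ⟨fun h => hSR (hf.mem i hi) (.inl h), fun h => hSR (hf.mem i hi) (.inr h)⟩
    have hpos := hf.pos
    obtain ⟨a', ha', _, rfl, ha0⟩ := (hf.left 0 hpos).2 rfl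
    obtain ⟨b', hb', _, rfl, hbk⟩ := (hf.right (k - 1) (by omega)).2 (by omega)
    have hk2 : k ≠ 1 := by
      rintro rfl
      exact htri (f 0) a' b' ha0.symm hbk.symm (hAB a' ha' b' hb')
    obtain ⟨b'', hb'', hb0⟩ := hmaxA (f (k - 1)) (hfR _ (by omega)).1
    obtain ⟨a'', ha'', ha1⟩ := hmaxB (f 0) (hfR _ (by omega)).2
    refine no_double_bypass huf (hAB a' ha' b' hb') hf.conn (conn_pair (hAB a'' ha'' b'' hb''))
      ?_ ?_ ?_ ?_ ?_ ?_ ?_ ?_ ?_ ?_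
    · rw [Set.disjoint_left]
      rintro _ ⟨i, hi, rfl⟩ (h | h)
      · exact (hfR i hi).1 (h ▸ ha'')
      · exact (hfR i hi).2 (h.symm ▸ hb'')
    · rintro ⟨_, ⟨i, hi, rfl⟩, _, rfl | rfl, h⟩
      · have := (hf.left i hi).1 ⟨_, ha'', _, rfl, h.symm⟩
        subst this
        exact ha1 h
      · have := (hf.right i hi).1 ⟨_, hb'', _, rfl, h.symm⟩
        obtain rfl : i = k - 1 := by omega
        exact hb0 h
    · rintro ⟨i, hi, h⟩
      exact (hfR i hi).1 (h ▸ ha')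
    · rintro ⟨i, hi, h⟩
      exact (hfR i hi).2 (h ▸ hb')
    · rintro (rfl | rfl)
      · exact ha1 ha0.symm
      · exact hdisj _ ha' hb''
    · rintro (rfl | rfl)
      · exact hdisj _ ha'' hb'
      · exact hb0 hbk.symm
    · exact ⟨a', rfl, f 0, Set.mem_image_of_mem f hpos, ha0⟩
    · exact ⟨b', rfl, f (k - 1), Set.mem_image_of_mem f (show k - 1 < k by omega), hbk⟩
    · exact ⟨a', rfl, b'', by simp, hAB a' ha' b'' hb''⟩
    · exact ⟨b', rfl, a'', by simp, (hAB a'' ha'' b' hb').symm⟩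
  let X : Set V := A ∪ {x | ∃ S, Conn G S ∧ S ⊆ (A ∪ B)ᶜ ∧ x ∈ S ∧ Touch G A S}
  have hBX : B ⊆ Xᶜ := by
    rintro y hy (h | ⟨S, -, hS, hyS, -⟩)
    · exact hdisj y h hy
    · exact hS hyS (.inr hy)
  refine ⟨X, Xᶜ, A, B, fun v => em _, disjoint_compl_right, Set.subset_union_left, hBX, ?_, ?_,
    hAst, hBst, hAB, ?_⟩
  · rw [← Set.ncard_pair hac]
    exact Set.ncard_le_ncard hA
  · rw [← Set.ncard_pair hbd]
    exact Set.ncard_le_ncard hB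
  · rintro u hu v hv hadj
    have hvA : v ∉ A := fun h => hv (.inl h)
    have hext : ∀ T, Conn G T → T ⊆ (A ∪ B)ᶜ → v ∈ T → ¬ Touch G A T :=
      fun T h1 h2 h3 h4 => hv (.inr ⟨T, h1, h2, h3, h4⟩)
    rcases hu with hu | ⟨S, hS, hSR, huS, htS⟩
    · refine ⟨hu, ?_⟩
      by_contra hvB
      exact hext {v} (conn_singleton v) (by simp [hvA, hvB]) rfl ⟨u, hu, v, rfl, hadj⟩
    · exfalso
      by_cases hvB : v ∈ B
      · exact hkey S hS hSR htS ⟨v, hvB, u, huS, hadj.symm⟩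
      · refine hext (insert v S) (hS.insert_adj huS hadj.symm) ?_ (Set.mem_insert _ _)
          (htS.mono subset_rfl (Set.subset_insert _ _))
        exact Set.insert_subset (by simp [hvA, hvB]) hSR

lemma Conn.union_inter {S T : Set V} (hS : Conn G S) (hT : Conn G T) {x : V} (hx : x ∈ S)
    (hx' : x ∈ T) : Conn G (S ∪ T) := by
  by_cases h : T ⊆ S
  · rwa [Set.union_eq_left.2 h]
  · refine ⟨hS.1.mono Set.subset_union_left, fun A hA hne hA' => ?_⟩
    by_cases hSA : (S ∩ A).Nonempty
    · by_cases hS' : S ⊆ A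
      · rw [Set.union_comm S T] at *
        exact touch_diff_of_left hT ⟨x, hx', hS' hx⟩
          fun h' => hA' (subset_antisymm hA (Set.union_subset h' hS'))
      · exact touch_diff_of_left hS hSA hS'
    · rw [Set.union_comm S T] at *
      obtain ⟨a, ha⟩ := hne
      have haT : a ∈ T := (hA ha).elim id fun h => absurd ⟨a, h, ha⟩ hSA
      exact touch_diff_of_left hT ⟨a, haT, ha⟩ fun h => hSA ⟨x, hx, h hx'⟩

/-- `L` is the interior of a connection between `u` and `z`. -/
def Link (G : SimpleGraph V) (u z : V) (L : Set V) : Prop :=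
  (L = ∅ ∧ G.Adj u z) ∨ (Conn G L ∧ Touch G {u} L ∧ Touch G {z} L)

lemma Link.symm {u z : V} {L : Set V} (h : Link G u z L) : Link G z u L :=
  h.imp (fun h => ⟨h.1, h.2.symm⟩) fun h => ⟨h.1, h.2.2, h.2.1⟩

lemma Link.conn_insert {u z : V} {L : Set V} (h : Link G u z L) : Conn G (insert z L) := by
  rcases h with ⟨rfl, h⟩ | ⟨h1, -, h3⟩
  · simpa using conn_singleton z
  · obtain ⟨_, rfl, y, hy, h⟩ := h3
    exact h1.insert_adj hy h

lemma Link.touch_insert {u z : V} {L : Set V} (h : Link G u z L) : Touch G {u} (insert z L) := by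
  rcases h with ⟨rfl, h⟩ | ⟨h1, h2, h3⟩
  · simpa using h
  · exact h2.mono subset_rfl (Set.subset_insert _ _)

lemma Conn.exists_link [Finite V] {D : Set V} (hD : Conn G D) {u z : V} (hz : z ∈ D)
    (hu : Touch G {u} D) : ∃ L ⊆ D \ {z}, Link G u z L := by
  by_cases h : G.Adj u z
  · exact ⟨∅, Set.empty_subset _, .inl ⟨rfl, h⟩⟩
  · obtain ⟨_, rfl, t, ht, hut⟩ := hu
    have htz : t ≠ z := fun h' => h (h' ▸ hut)
    obtain ⟨S, htS, hSD, hS, hcomp⟩ := exists_component (G := G) (R := D \ {z}) ⟨ht, htz⟩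
    refine ⟨S, hSD, .inr ⟨hS, ⟨_, rfl, t, htS, hut⟩, ?_⟩⟩
    obtain ⟨s, hs, y, ⟨hy, hyS⟩, hsy⟩ := hD.2 S (hSD.trans Set.sdiff_subset) hS.1
      fun h => (hSD (h ▸ hz)).2 rfl
    have : y = z := by
      by_contra hyz
      exact hcomp y ⟨hy, hyz⟩ hyS s hs hsy
    exact ⟨_, rfl, s, hs, this ▸ hsy.symm⟩

/-- Two disjoint connections between `u` and `z`. -/
def TwoLinks (G : SimpleGraph V) (u z : V) : Prop :=
  ∃ L L' : Set V, Disjoint L L' ∧ u ∉ L ∧ u ∉ L' ∧ z ∉ L ∧ z ∉ L' ∧ Link G u z L ∧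
    Link G u z L'

lemma TwoLinks.of_conn [Finite V] {D L : Set V} (hD : Conn G D) {u z z' : V} (hz' : z' ∈ D)
    (hu : Touch G {u} D) (huD : u ∉ D) (hzD : z ∉ D) (hL : Link G u z L) (hDL : Disjoint D L)
    (huL : u ∉ L) (hzz' : G.Adj z z') (huz : z ≠ u) : TwoLinks G u z' := by
  obtain ⟨M, hM, hlink⟩ := hD.exists_link hz' hu
  refine ⟨M, insert z L, ?_, fun h => huD (hM h).1, ?_, fun h => (hM h).2 rfl, ?_, hlink,
    .inr ⟨hL.conn_insert, hL.touch_insert, ⟨_, rfl, z, Set.mem_insert _ _, hzz'.symm⟩⟩⟩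
  · rw [Set.disjoint_left] at *
    rintro a ha (rfl | h)
    · exact hzD (hM ha).1
    · exact hDL (hM ha).1 h
  · rintro (h | h)
    · exact huz h.symm
    · exact huL h
  · rintro (h | h)
    · exact hzz'.ne h.symm
    · exact Set.disjoint_left.1 hDL hz' h

lemma has1Cutset_of_component {z y : V} {C R : Set V} (hne : C.Nonempty) (hy : y ∉ C)
    (hyz : y ≠ z) (hz : z ∉ C) (hR : ∀ y ∈ R, y ∉ C → ∀ s ∈ C, ¬ G.Adj s y)
    (hRc : ∀ y ∉ R, y ≠ z → ¬ Touch G {y} C) : Has1Cutset G := by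
  refine ⟨z, C, (insert z C)ᶜ, hne, ⟨y, fun h => h.elim hyz hy⟩,
    disjoint_compl_right.mono_left (Set.subset_insert _ _), hz, by simp, ?_, ?_⟩
  · intro w
    by_cases h1 : w ∈ C <;> by_cases h2 : w = z <;> simp [h1, h2]
  · intro x hx y hy hadj
    have hyz : y ≠ z := fun h => hy (.inl h)
    have hyC : y ∉ C := fun h => hy (.inr h)
    by_cases hyR : y ∈ R
    · exact hR y hyR hyC x hx hadj
    · exact hRc y hyR hyz ⟨y, rfl, x, hx, hadj.symm⟩

/-- Whitney's theorem: in a graph without cutvertices, there are two disjoint connections between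
any two vertices. -/
theorem twoLinks [Finite V] (h1 : ¬ Has1Cutset G) {u t t' : V} (ht : G.Adj u t) (ht' : G.Adj u t')
    (htt' : t ≠ t') {z : V} (hz : z ≠ u) : TwoLinks G u z := by
  have hbase : ∀ z t, G.Adj u z → G.Adj u t → t ≠ z → TwoLinks G u z := by
    intro z t hz ht hne
    obtain ⟨S, htS, hSR, hS, hcomp⟩ := exists_component (G := G) (R := ({u, z} : Set V)ᶜ) (x := t)
      (by simp [hne, ht.ne'])
    have huS : u ∉ S := fun h => hSR h (by simp)
    have hzS : z ∉ S := fun h => hSR h (by simp)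
    refine ⟨∅, S, Set.empty_disjoint _, by simp, huS, by simp, hzS, .inl ⟨rfl, hz⟩,
      .inr ⟨hS, ⟨u, rfl, t, htS, ht⟩, ?_⟩⟩
    by_contra hzt
    refine h1 (has1Cutset_of_component hS.1 hzS hz.ne' huS hcomp ?_)
    intro y hy hyu
    have : y = z := by simpa [hyu] using hy
    rwa [this]
  have hstep : ∀ z z', z ≠ u → z' ≠ u → G.Adj z z' → TwoLinks G u z → TwoLinks G u z' := by
    rintro z z' hz hz' hadj ⟨L, L', hd, huL, huL', hzL, hzL', hl, hl'⟩
    have hcase : ∀ L L' : Set V, Disjoint L L' → u ∉ L → u ∉ L' → z ∉ L → z ∉ L' →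
        Link G u z L → Link G u z L' → z' ∈ L → TwoLinks G u z' := by
      intro L L' hd huL huL' hzL hzL' hl hl' hmem
      rcases hl with ⟨rfl, -⟩ | ⟨hc, htu, -⟩
      · exact absurd hmem (by simp)
      · exact TwoLinks.of_conn hc hmem htu huL hzL hl' hd huL' hadj hz
    by_cases hzin : z' ∈ L
    · exact hcase L L' hd huL huL' hzL hzL' hl hl' hzin
    by_cases hzin' : z' ∈ L'
    · exact hcase L' L hd.symm huL' huL hzL' hzL hl' hl hzin'
    obtain ⟨C, hzC, hCR, hC, hcomp⟩ := exists_component (G := G)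
      (R := (({u, z} ∪ L ∪ L' : Set V))ᶜ) (x := z') (by simp [hz', hadj.ne', hzin, hzin'])
    have huC : u ∉ C := fun h => hCR h (by simp)
    have hzC' : z ∉ C := fun h => hCR h (by simp)
    have hCL : Disjoint C L := Set.disjoint_left.2 fun a ha ha' => hCR ha (by simp [ha'])
    have hCL' : Disjoint C L' := Set.disjoint_left.2 fun a ha ha' => hCR ha (by simp [ha'])
    by_cases htu : Touch G {u} C
    · exact TwoLinks.of_conn hC hzC htu huC hzC' hl' hCL' huL' hadj hz
    have hcase2 : ∀ L L' : Set V, Disjoint L L' → u ∉ L → u ∉ L' → z ∉ L → z ∉ L' →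
        Link G u z L → Link G u z L' → Disjoint C L' → Touch G L C → TwoLinks G u z' := by
      intro L L' hd huL huL' hzL hzL' hl hl' hCL' ht
      rcases hl with ⟨rfl, -⟩ | ⟨hc, htu, -⟩
      · exact absurd ht (by simp)
      · refine TwoLinks.of_conn (hc.union_touch hC ht) (.inr hzC)
          (htu.mono subset_rfl Set.subset_union_left) ?_ ?_ hl' ?_ huL' hadj hz
        · exact fun h => h.elim huL huC
        · exact fun h => h.elim hzL hzC'
        · exact Set.disjoint_union_left.2 ⟨hd, hCL'⟩
    by_cases hL : Touch G L C
    · exact hcase2 L L' hd huL huL' hzL hzL' hl hl' hCL' hL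
    by_cases hL' : Touch G L' C
    · exact hcase2 L' L hd.symm huL' huL hzL' hzL hl' hl hCL hL'
    exfalso
    refine h1 (has1Cutset_of_component hC.1 huC hz.symm hzC' hcomp ?_)
    intro y hy hyz
    have : y = u ∨ y ∈ L ∨ y ∈ L' := by
      have := Set.notMem_compl_iff.1 hy
      simp only [Set.mem_union, Set.mem_insert_iff, Set.mem_singleton_iff, hyz] at this
      tauto
    rcases this with rfl | h | h
    · exact htu
    · exact fun h' => hL (h'.mono (by simpa using h) subset_rfl)
    · exact fun h' => hL' (h'.mono (by simpa using h) subset_rfl)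
  by_contra hcon
  refine h1 ⟨u, {z | z ≠ u ∧ TwoLinks G u z}, {z | z ≠ u ∧ ¬ TwoLinks G u z},
    ⟨t, ht.ne', hbase t t' ht ht' htt'.symm⟩, ⟨z, hz, hcon⟩, ?_, by simp, by simp, ?_, ?_⟩
  · rw [Set.disjoint_left]
    exact fun a h h' => h'.2 h.2
  · intro w
    by_cases w = u <;> by_cases TwoLinks G u w <;> simp_all
  · rintro x ⟨hx, hx'⟩ y ⟨hy, hy'⟩ hadj
    exact hy' (hstep x y hx hy hadj hx')

/-- An edge `uv` with two disjoint connected sets touching both ends. -/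
structure Bypass (G : SimpleGraph V) (u v : V) (I J : Set V) : Prop where
  adj : G.Adj u v
  connI : Conn G I
  connJ : Conn G J
  disj : Disjoint I J
  uI : u ∉ I
  vI : v ∉ I
  uJ : u ∉ J
  vJ : v ∉ J
  tuI : Touch G {u} I
  tvI : Touch G {v} I
  tuJ : Touch G {u} J
  tvJ : Touch G {v} J

/-- The two sides of a bypass always touch. -/
def BypassTouch (G : SimpleGraph V) : Prop := ∀ u v I J, Bypass G u v I J → Touch G I J

lemma _root_.UnichordFree.bypassTouch (h : UnichordFree G) : BypassTouch G := fun u v I J hb => by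
  by_contra ht
  exact no_double_bypass h hb.adj hb.connI hb.connJ hb.disj ht hb.uI hb.vI hb.uJ hb.vJ hb.tuI
    hb.tvI hb.tuJ hb.tvJ

/-- The graphs that remain once cliques, 1-cutsets, 1-joins and separations at two nonadjacent
vertices have been excluded. -/
structure Core (G : SimpleGraph V) : Prop where
  bypass : BypassTouch G
  tri : ∀ a b c, G.Adj a b → G.Adj a c → ¬ G.Adj b c
  sq : ∀ a b c d, a ≠ b → c ≠ d → G.Adj a c → G.Adj a d → G.Adj b c → G.Adj b d → False
  cut1 : ¬ Has1Cutset G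
  cut2 : ∀ (a b : V) (X Y : Set V), a ≠ b → ¬ G.Adj a b →
    (∀ v, v ∈ X ∨ v ∈ Y ∨ v = a ∨ v = b) → Disjoint X Y → a ∉ X → a ∉ Y → b ∉ X → b ∉ Y →
    2 ≤ X.ncard → 2 ≤ Y.ncard → (∀ x ∈ X, ∀ y ∈ Y, ¬ G.Adj x y) → False

lemma Core.no_bridge_separation [Finite V] (hG : Core G) {u v w : V} {X Y : Set V}
    (hu : 3 ≤ (G.neighborSet u).ncard) (hv : 3 ≤ (G.neighborSet v).ncard)
    (huX : u ∈ X) (hvY : v ∈ Y) (hd : Disjoint X Y) (hwX : w ∉ X) (hwY : w ∉ Y)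
    (hcov : ∀ z, z ∈ X ∨ z ∈ Y ∨ z = w) (hsep : ∀ x ∈ X, ∀ y ∈ Y, G.Adj x y → x = u ∧ y = v)
    (hwu : ¬ G.Adj w u) : False := by
  have hne : w ≠ u := fun h => hwX (h ▸ huX)
  rw [Set.disjoint_left] at hd
  refine hG.cut2 w u (X \ {u}) Y hne hwu ?_ ?_ (fun h => hwX h.1) hwY (fun h => h.2 rfl)
    (hd huX) ?_ ?_ ?_
  · intro z
    by_cases hz : z = u
    · simp [hz]
    · rcases hcov z with h | h | h <;> simp [h, hz]
  · exact Set.disjoint_left.2 fun a ha => hd ha.1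
  · have hsub : G.neighborSet u ⊆ insert v (X \ {u}) := by
      intro z hz
      rw [SimpleGraph.mem_neighborSet] at hz
      rcases hcov z with h | h | rfl
      · exact .inr ⟨h, hz.ne'⟩
      · exact .inl (hsep u huX z h hz).2
      · exact absurd hz.symm hwu
    have h1 := Set.ncard_le_ncard hsub
    have h2 := Set.ncard_insert_le v (X \ {u})
    omega
  · have hsub : G.neighborSet v ⊆ insert u (insert w (Y \ {v})) := by
      intro z hz
      rw [SimpleGraph.mem_neighborSet] at hz
      rcases hcov z with h | h | rfl
      · exact .inl (hsep z h v hvY hz.symm).1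
      · exact .inr (.inr ⟨h, hz.ne'⟩)
      · exact .inr (.inl rfl)
    have h1 := Set.ncard_le_ncard hsub
    have h2 := Set.ncard_insert_le u (insert w (Y \ {v}))
    have h3 := Set.ncard_insert_le w (Y \ {v})
    have h4 := Set.ncard_sdiff_singleton_add_one hvY
    omega
  · rintro x ⟨hx, hxu⟩ y hy hxy
    exact hxu (hsep x hx y hy hxy).1

lemma Touch.mono_graph {G H : SimpleGraph V} (hle : H ≤ G) {A B : Set V} (h : Touch H A B) :
    Touch G A B := by
  obtain ⟨a, ha, b, hb, hab⟩ := h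
  exact ⟨a, ha, b, hb, hle hab⟩

lemma Conn.mono_graph {G H : SimpleGraph V} (hle : H ≤ G) {A : Set V} (h : Conn H A) :
    Conn G A :=
  ⟨h.1, fun B hB hne hBA => (h.2 B hB hne hBA).mono_graph hle⟩

lemma Core.exists_bypass [Finite V] (hG : Core G) {u v : V}
    (hu : 3 ≤ (G.neighborSet u).ncard) (hv : 3 ≤ (G.neighborSet v).ncard) (huv : G.Adj u v) :
    ∃ I J, Bypass G u v I J := by
  set H := G.deleteEdges {s(u, v)} with hH
  have hadj : ∀ a b, H.Adj a b ↔ G.Adj a b ∧ ¬ (s(a, b) = s(u, v)) := by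
    intro a b
    simp [hH, SimpleGraph.deleteEdges_adj]
  have hle : H ≤ G := fun a b h => ((hadj a b).1 h).1
  have h1 : ¬ Has1Cutset H := by
    rintro ⟨w, X, Y, hXn, hYn, hd, hwX, hwY, hcov, hsep⟩
    have hkey : ∀ x ∈ X, ∀ y ∈ Y, G.Adj x y → s(x, y) = s(u, v) := by
      intro x hx y hy hxy
      by_contra h
      exact hsep x hx y hy ((hadj x y).2 ⟨hxy, h⟩)
    have hd' := Set.disjoint_left.1 hd
    have hnot : ¬ ∃ x ∈ X, ∃ y ∈ Y, G.Adj x y := by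
      have hmain : ∀ X Y : Set V, Disjoint X Y → w ∉ X → w ∉ Y → (∀ z, z ∈ X ∨ z ∈ Y ∨ z = w) →
          (∀ x ∈ X, ∀ y ∈ Y, G.Adj x y → s(x, y) = s(u, v)) → u ∈ X → v ∈ Y → False := by
        intro X Y hd hwX hwY hcov hkey huX hvY
        have hd' := Set.disjoint_left.1 hd
        have hk : ∀ x ∈ X, ∀ y ∈ Y, G.Adj x y → x = u ∧ y = v := by
          intro x hx y hy hxy
          have := hkey x hx y hy hxy
          rw [Sym2.eq_iff] at this
          rcases this with h | ⟨rfl, rfl⟩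
          · exact h
          · exact absurd hvY (hd' hx)
        by_cases hwu : G.Adj w u
        · refine hG.no_bridge_separation hv hu hvY huX hd.symm hwY hwX
            (fun z => ?_) (fun x hx y hy hxy => (hk y hy x hx hxy.symm).symm)
            (fun hwv => hG.tri w u v hwu hwv huv)
          have := hcov z
          tauto
        · exact hG.no_bridge_separation hu hv huX hvY hd hwX hwY hcov hk hwu
      rintro ⟨x, hx, y, hy, hxy⟩
      have := hkey x hx y hy hxy
      rw [Sym2.eq_iff] at this
      rcases this with ⟨rfl, rfl⟩ | ⟨rfl, rfl⟩
      · exact hmain X Y hd hwX hwY hcov hkey hx hy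
      · refine hmain Y X hd.symm hwY hwX (fun z => ?_) (fun x hx y hy hxy => ?_) hy hx
        · have := hcov z
          tauto
        · rw [Sym2.eq_swap]
          exact hkey y hy x hx hxy.symm
    exact hG.cut1 ⟨w, X, Y, hXn, hYn, hd, hwX, hwY, hcov,
      fun x hx y hy hxy => hnot ⟨x, hx, y, hy, hxy⟩⟩
  have hdeg : 1 < (G.neighborSet u \ {v}).ncard := by
    have := Set.ncard_sdiff_singleton_add_one (s := G.neighborSet u) (a := v) huv
    omega
  obtain ⟨t, ht, t', ht', htt'⟩ := (Set.one_lt_ncard).1 hdeg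
  have hut : ∀ t ∈ G.neighborSet u \ {v}, H.Adj u t := by
    rintro t ⟨ht, htv⟩
    refine (hadj u t).2 ⟨ht, fun h => htv ?_⟩
    rw [Sym2.eq_iff] at h
    rcases h with ⟨-, rfl⟩ | ⟨rfl, rfl⟩ <;> rfl
  have hnuv : ¬ H.Adj u v := by simp [hadj]
  obtain ⟨I, J, hIJ, huI, huJ, hvI, hvJ, hI, hJ⟩ :=
    twoLinks h1 (hut t ht) (hut t' ht') htt' huv.ne'
  rcases hI with ⟨-, h⟩ | ⟨hI, h3, h4⟩
  · exact absurd h hnuv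
  rcases hJ with ⟨-, h⟩ | ⟨hJ, h5, h6⟩
  · exact absurd h hnuv
  exact ⟨I, J, huv, hI.mono_graph hle, hJ.mono_graph hle, hIJ, huI, hvI, huJ, hvJ,
    h3.mono_graph hle, h4.mono_graph hle, h5.mono_graph hle, h6.mono_graph hle⟩

/-- Two disjoint edges `uv`, `xy` and four pairwise disjoint connections between their ends, of
total size bounded by the size of any bypass. -/
structure Ladder (G : SimpleGraph V) (u v x y : V) (A B C D : Set V) : Prop where
  huv : G.Adj u v
  hxy : G.Adj x y
  ux : Link G u x A
  vx : Link G v x B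
  uy : Link G u y C
  vy : Link G v y D
  disj : List.Pairwise Disjoint [{u}, {v}, {x}, {y}, A, B, C, D]
  min : ∀ u v I J, Bypass G u v I J →
    A.ncard + B.ncard + C.ncard + D.ncard + 2 ≤ I.ncard + J.ncard

namespace Ladder
variable {u v x y : V} {A B C D : Set V}

lemma swap_left (h : Ladder G u v x y A B C D) : Ladder G v u x y B A D C := by
  refine ⟨h.huv.symm, h.hxy, h.vx, h.ux, h.vy, h.uy, ?_, fun a b I J hT => ?_⟩
  · have := h.disj
    simp only [List.pairwise_cons, List.mem_cons, List.not_mem_nil, or_false,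
      forall_eq_or_imp, forall_eq] at this ⊢
    grind
  · have := h.min a b I J hT
    omega

lemma swap_right (h : Ladder G u v x y A B C D) : Ladder G u v y x C D A B := by
  refine ⟨h.huv, h.hxy.symm, h.uy, h.vy, h.ux, h.vx, ?_, fun a b I J hT => ?_⟩
  · have := h.disj
    simp only [List.pairwise_cons, List.mem_cons, List.not_mem_nil, or_false,
      forall_eq_or_imp, forall_eq] at this ⊢
    grind
  · have := h.min a b I J hT
    omega

lemma exchange (h : Ladder G u v x y A B C D) : Ladder G x y u v A C B D := by
  refine ⟨h.hxy, h.huv, h.ux.symm, h.uy.symm, h.vx.symm, h.vy.symm, ?_, fun a b I J hT => ?_⟩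
  · have := h.disj
    simp only [List.pairwise_cons, List.mem_cons, List.not_mem_nil, or_false,
      forall_eq_or_imp, forall_eq] at this ⊢
    grind
  · have := h.min a b I J hT
    omega

lemma not_adj [Finite V] (hG : Core G) (h : Ladder G u v x y A B C D) : ¬ G.Adj u x := by
  intro hux
  have hd := h.disj
  simp [List.pairwise_cons] at hd
  have := h.min u x (insert v B) (insert y C)
    ⟨hux, h.vx.symm.conn_insert, h.uy.conn_insert, by simp; grind,
      by simp; grind, by simp; grind, by simp; grind, by simp; grind,
      ⟨u, rfl, v, .inl rfl, h.huv⟩, h.vx.symm.touch_insert,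
      h.uy.touch_insert, ⟨x, rfl, y, .inl rfl, h.hxy⟩⟩
  have h1 := Set.ncard_insert_le v B
  have h2 := Set.ncard_insert_le y C
  have hD : D = ∅ := by
    rw [← Set.ncard_eq_zero]
    omega
  rcases h.vy with ⟨-, hvy⟩ | ⟨h', -⟩
  · exact hG.sq u y v x (by grind) (by grind) h.huv hux hvy.symm h.hxy.symm
  · exact absurd hD h'.1.ne_empty

lemma conn [Finite V] (hG : Core G) (h : Ladder G u v x y A B C D) :
    Conn G A ∧ Touch G {u} A ∧ Touch G {x} A :=
  h.ux.resolve_left fun h' => h.not_adj hG h'.2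

lemma union_conn (h : Ladder G u v x y A B C D) : Conn G (insert y (C ∪ D)) := by
  have := h.uy.conn_insert.union_inter h.vy.conn_insert (x := y) (.inl rfl) (.inl rfl)
  rwa [← Set.insert_union_distrib] at this

lemma not_touch_terminal [Finite V] (hG : Core G) (h : Ladder G u v x y A B C D) :
    ¬ Touch G {u} B := by
  intro hux
  have hd := h.disj
  simp [List.pairwise_cons] at hd
  have := h.min u v (insert x B) (insert y (C ∪ D))
    ⟨h.huv, h.vx.conn_insert, h.union_conn, by simp; grind,
      by simp; grind, by simp; grind, by simp; grind, by simp; grind,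
      hux.mono subset_rfl (Set.subset_insert _ _), h.vx.touch_insert,
      h.uy.touch_insert.mono subset_rfl (by grind), h.vy.touch_insert.mono subset_rfl (by grind)⟩
  have h1 := Set.ncard_insert_le x B
  have h2 := Set.ncard_insert_le y (C ∪ D)
  have h3 := Set.ncard_union_le C D
  have h4 := (Set.ncard_pos).2 (h.conn hG).1.1
  omega

lemma not_touch_side [Finite V] (hG : Core G) (h : Ladder G u v x y A B C D) :
    ¬ Touch G A B := by
  intro hux
  have hd := h.disj
  simp [List.pairwise_cons] at hd
  have := h.min u v (A ∪ B) (insert y (C ∪ D))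
    ⟨h.huv, (h.conn hG).1.union_touch (h.swap_left.conn hG).1 hux, h.union_conn,
      by simp; grind,
      by simp; grind, by simp; grind, by simp; grind, by simp; grind,
      (h.conn hG).2.1.mono subset_rfl (by grind),
      (h.swap_left.conn hG).2.1.mono subset_rfl (by grind),
      h.uy.touch_insert.mono subset_rfl (by grind), h.vy.touch_insert.mono subset_rfl (by grind)⟩
  have h1 := Set.ncard_union_le A B
  have h2 := Set.ncard_insert_le y (C ∪ D)
  have h3 := Set.ncard_union_le C D
  omega

lemma link_of_touch [Finite V] (hG : Core G) (h : Ladder G u v x y A B C D) {a d : V}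
    (ha : a ∈ A) (hdD : d ∈ D) (had : G.Adj a d) : Link G x a (A \ {a}) := by
  have hd := h.disj
  simp [List.pairwise_cons] at hd
  obtain ⟨M, hM, hl⟩ := (h.conn hG).1.exists_link ha (h.conn hG).2.2
  have hD := h.swap_left.swap_right.conn hG
  obtain ⟨M', hM', hl'⟩ := hD.1.exists_link hdD hD.2.2
  have hI : Conn G (insert v B ∪ insert u C) :=
    h.vx.symm.conn_insert.union_touch h.uy.symm.conn_insert ⟨v, .inl rfl, u, .inl rfl, h.huv.symm⟩
  have hJ : Conn G (insert a M ∪ insert d M') :=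
    hl.conn_insert.union_touch hl'.conn_insert ⟨a, .inl rfl, d, .inl rfl, had⟩
  have hMA : insert a M ⊆ A := Set.insert_subset ha (hM.trans Set.sdiff_subset)
  have hMD : insert d M' ⊆ D := Set.insert_subset hdD (hM'.trans Set.sdiff_subset)
  have hJs : insert a M ∪ insert d M' ⊆ A ∪ D := Set.union_subset_union hMA hMD
  have := h.min x y _ _ ⟨h.hxy, hI, hJ, Set.disjoint_of_subset_right hJs (by
      simp; grind),
      by simp; grind, by simp; grind, fun h' => ?_, fun h' => ?_,
      h.vx.symm.touch_insert.mono subset_rfl (by grind),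
      h.uy.symm.touch_insert.mono subset_rfl (by grind),
      hl.touch_insert.mono subset_rfl (by grind),
      hl'.touch_insert.mono subset_rfl (by grind)⟩
  · have h1 := Set.ncard_union_le (insert v B) (insert u C)
    have h2 := Set.ncard_union_le (insert a M) (insert d M')
    have h3 := Set.ncard_insert_le v B
    have h4 := Set.ncard_insert_le u C
    have h5 := Set.ncard_insert_le a M
    have h6 := Set.ncard_insert_le d M'
    have h7 := Set.ncard_sdiff_singleton_add_one ha
    have h8 := Set.ncard_sdiff_singleton_add_one hdD
    have h9 := Set.ncard_le_ncard hM'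
    have := Set.eq_of_subset_of_ncard_le hM (by omega)
    rwa [← this]
  · have := hJs h'
    simp at this
    grind
  · have := hJs h'
    simp at this
    grind

lemma adj_of_touch [Finite V] (hG : Core G) (h : Ladder G u v x y A B C D) {a d : V}
    (ha : a ∈ A) (hdD : d ∈ D) (had : G.Adj a d) : G.Adj u a := by
  have hd := h.disj
  simp [List.pairwise_cons] at hd
  have h1 := h.link_of_touch hG ha hdD had
  have h2 := h.exchange.link_of_touch hG ha hdD had
  rcases h2 with h2 | ⟨-, h2, -⟩
  · exact h2.2
  rcases h1 with h1 | ⟨h3, h1, -⟩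
  · rw [h1.1] at h2
    simp at h2
  exfalso
  have hL : Link G u x (A \ {a}) := .inr ⟨h3, h2, h1⟩
  have hI := h.vx.conn_insert.union_inter hL.conn_insert (x := x) (.inl rfl) (.inl rfl)
  have hs : insert x B ∪ insert x (A \ {a}) ⊆ insert x (A ∪ B) := by grind
  have := h.min u v (insert x B ∪ insert x (A \ {a})) (insert y (C ∪ D))
    ⟨h.huv, hI, h.union_conn,
      Set.disjoint_of_subset_left hs (by simp; grind),
      by simp; grind, by simp; grind, by simp; grind, by simp; grind,
      hL.touch_insert.mono subset_rfl (by grind),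
      h.vx.touch_insert.mono subset_rfl (by grind),
      h.uy.touch_insert.mono subset_rfl (by grind), h.vy.touch_insert.mono subset_rfl (by grind)⟩
  rw [← Set.insert_union_distrib] at this
  have h1 := Set.ncard_insert_le x (B ∪ A \ {a})
  have h2 := Set.ncard_union_le B (A \ {a})
  have h3 := Set.ncard_insert_le y (C ∪ D)
  have h4 := Set.ncard_union_le C D
  have h7 := Set.ncard_sdiff_singleton_add_one ha
  omega

lemma not_touch_opposite [Finite V] (hG : Core G) (h : Ladder G u v x y A B C D) :
    ¬ Touch G A D := by
  rintro ⟨a, ha, d, hd, had⟩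
  have h1 := h.adj_of_touch hG ha hd had
  have h2 := h.swap_left.swap_right.adj_of_touch hG hd ha had.symm
  have hdj := h.disj
  simp [List.pairwise_cons] at hdj
  exact hG.sq u d a v (by grind) (by grind) h1 h.huv had.symm h2.symm

end Ladder

theorem Core.exists_ladder [Finite V] (hG : Core G) {u v : V}
    (hu : 3 ≤ (G.neighborSet u).ncard) (hv : 3 ≤ (G.neighborSet v).ncard) (huv : G.Adj u v) :
    ∃ u v x y A B C D, Ladder G u v x y A B C D := by
  classical
  have hex : ∃ n, ∃ u v I J, Bypass G u v I J ∧ I.ncard + J.ncard = n := by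
    obtain ⟨I, J, h⟩ := hG.exists_bypass hu hv huv
    exact ⟨_, u, v, I, J, h, rfl⟩
  obtain ⟨u, v, I, J, h, hn⟩ := Nat.find_spec hex
  have hmin : ∀ u v I' J', Bypass G u v I' J' → I.ncard + J.ncard ≤ I'.ncard + J'.ncard := by
    intro u v I' J' h'
    rw [hn]
    exact Nat.find_min' hex ⟨u, v, I', J', h', rfl⟩
  have ht : Touch G I J := hG.bypass u v I J h
  obtain ⟨x, hx, y, hy, hxy⟩ := ht
  have hIJ := Set.disjoint_left.1 h.disj
  obtain ⟨A, hA, hlA⟩ := h.connI.exists_link hx h.tuI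
  obtain ⟨B, hB, hlB⟩ := h.connI.exists_link hx h.tvI
  obtain ⟨C, hC, hlC⟩ := h.connJ.exists_link hy h.tuJ
  obtain ⟨D, hD, hlD⟩ := h.connJ.exists_link hy h.tvJ
  have key : ∀ (I J A B : Set V) (x : V), Bypass G u v I J →
      (∀ u v I' J', Bypass G u v I' J' → I.ncard + J.ncard ≤ I'.ncard + J'.ncard) →
      x ∈ I → A ⊆ I \ {x} → B ⊆ I \ {x} → Link G u x A → Link G v x B → Disjoint A B := by
    intro I J A B x h hmin hx hA hB hlA hlB
    rw [Set.disjoint_left]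
    intro z hzA hzB
    rcases hlA with ⟨rfl, -⟩ | ⟨h1, h2, -⟩
    · exact hzA
    rcases hlB with ⟨rfl, -⟩ | ⟨h3, h4, -⟩
    · exact hzB
    have hAB : A ∪ B ⊆ I \ {x} := Set.union_subset hA hB
    have hAB' : A ∪ B ⊆ I := hAB.trans Set.sdiff_subset
    have := hmin u v (A ∪ B) J ⟨h.adj, h1.union_inter h3 hzA hzB, h.connJ,
      h.disj.mono_left hAB', fun h' => h.uI (hAB' h'), fun h' => h.vI (hAB' h'), h.uJ, h.vJ,
      h2.mono subset_rfl Set.subset_union_left, h4.mono subset_rfl Set.subset_union_right,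
      h.tuJ, h.tvJ⟩
    have h5 := Set.ncard_le_ncard hAB
    have h6 := Set.ncard_sdiff_singleton_add_one hx
    omega
  have hABd := key I J A B x h hmin hx hA hB hlA hlB
  have hCDd := key J I C D y ⟨h.adj, h.connJ, h.connI, h.disj.symm, h.uJ, h.vJ, h.uI, h.vI,
    h.tuJ, h.tvJ, h.tuI, h.tvI⟩ (fun u v I' J' h' => by
      have := hmin u v I' J' h'
      omega) hy hC hD hlC hlD
  have h1 := Set.ncard_le_ncard (Set.union_subset hA hB)
  have h2 := Set.ncard_le_ncard (Set.union_subset hC hD)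
  rw [Set.ncard_union_eq hABd] at h1
  rw [Set.ncard_union_eq hCDd] at h2
  have h3 := Set.ncard_sdiff_singleton_add_one hx
  have h4 := Set.ncard_sdiff_singleton_add_one hy
  refine ⟨u, v, x, y, A, B, C, D, h.adj, hxy, hlA, hlB, hlC, hlD, ?_, fun u v I' J' h' => ?_⟩
  · have huI := h.uI
    have hvI := h.vI
    have huJ := h.uJ
    have hvJ := h.vJ
    have huv := h.adj.ne
    simp only [List.pairwise_cons, List.mem_cons, List.not_mem_nil, or_false,
      forall_eq_or_imp, forall_eq, Set.disjoint_left, Set.mem_singleton_iff, Set.subset_def,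
      Set.mem_sdiff] at *
    grind
  · have := hmin u v I' J' h'
    omega

end UF

namespace UF

/-! ### Bitmask arithmetic

A pattern on the nodes `0, …, n - 1` (`n ≤ 32`) is stored as a number `M` whose bit `32 * i + j`
tells whether `i` and `j` are adjacent; sets of nodes are stored as bitmasks. The functions are
written with recursors so that the kernel evaluates them quickly. -/

/-- The mask of the neighbours of the node `i`. -/
def row (M i : ℕ) : ℕ := Nat.land (Nat.shiftRight M (Nat.mul 32 i)) 4294967295

def bit (i : ℕ) : ℕ := Nat.shiftLeft 1 i

def diff (a b : ℕ) : ℕ := Nat.xor a (Nat.land a b)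

/-- The nodes reachable inside `R` from the set `F`, where only the nodes in `Q` still have to be
processed. -/
def flood (M R : ℕ) (k : ℕ) : ℕ → ℕ → ℕ :=
  Nat.rec (fun F _ => F) (fun _ ih F Q => bif Nat.beq Q 0 then F else
    (fun new => ih (Nat.lor F new) (Nat.lor (diff Q (bit (Nat.log2 Q))) new))
      (diff (Nat.land (row M (Nat.log2 Q)) R) F)) k

/-- The union of the neighbourhoods of the nodes in `P`. -/
def nbrs (M : ℕ) (k : ℕ) : ℕ → ℕ :=
  Nat.rec (fun _ => 0) (fun _ ih P => bif Nat.beq P 0 then 0 else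
    Nat.lor (row M (Nat.log2 P)) (ih (diff P (bit (Nat.log2 P))))) k

/-- There is a path from `u` to `v` with nonempty interior inside `R`. -/
def reach (M u v R : ℕ) : Bool :=
  bif Nat.beq (Nat.land (row M v) (flood M R 32 (Nat.land (row M u) R) (Nat.land (row M u) R))) 0
  then false else true

/-- The edge `uv` has two bypasses that do not touch: one inside `I` and the other one away from
`I`. -/
def bypassed (M n s u v I : ℕ) : Bool :=
  bif Nat.testBit s u && Nat.testBit s v && Nat.testBit (row M u) v &&
    Nat.ble (Nat.add u 1) n && Nat.ble (Nat.add v 1) n && reach M u v I then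
    reach M u v (diff (Nat.sub (bit n) 1)
      (Nat.lor (Nat.lor I (nbrs M 32 I)) (Nat.lor (bit u) (bit v))))
  else false

/-- `bypassed` with the edge and the set packed into one number. -/
def refutes (M n s c : ℕ) : Bool :=
  bypassed M n s (Nat.mod c 32) (Nat.mod (Nat.div c 32) 32)
    (diff (Nat.land (Nat.sub (bit n) 1) (Nat.div c 1024))
      (Nat.lor (bit (Nat.mod c 32)) (bit (Nat.mod (Nat.div c 32) 32))))

def anyList {α : Type} (f : α → Bool) (l : List α) : Bool :=
  List.rec false (fun a _ ih => bif f a then true else ih) l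

def allList {α : Type} (f : α → Bool) (l : List α) : Bool :=
  List.rec true (fun a _ ih => bif f a then ih else false) l

def anyBelow (f : ℕ → Bool) (n : ℕ) : Bool :=
  Nat.rec false (fun i ih => bif f i then true else ih) n

def allBelow (f : ℕ → Bool) (n : ℕ) : Bool :=
  Nat.rec true (fun i ih => bif f i then ih else false) n

/-- The mask contains at least two nodes. -/
def two (x : ℕ) : Bool :=
  bif Nat.beq x 0 then false else
    bif Nat.beq (diff x (bit (Nat.log2 x))) 0 then false else true

/-- The singleton nodes `i` and `k` are adjacent with a common singleton neighbour, or have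
two common singleton neighbours. -/
def close (M s i k : ℕ) : Bool :=
  bif Nat.testBit (row M i) k then
    bif Nat.beq (Nat.land (Nat.land (row M i) (row M k)) s) 0 then false else true
  else two (Nat.land (Nat.land (row M i) (row M k)) s)

/-- The singleton nodes span a triangle or a square. -/
def small (M n s : ℕ) : Bool :=
  anyBelow (fun i => bif Nat.testBit s i then
    anyBelow (fun k => bif Nat.testBit s k then close M s i k else false) i else false) n

def addEdge (M i j : ℕ) : ℕ :=
  Nat.lor M (Nat.lor (bit (Nat.add (Nat.mul 32 i) j)) (bit (Nat.add (Nat.mul 32 j) i)))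

def delEdge (M i j : ℕ) : ℕ :=
  diff M (Nat.lor (bit (Nat.add (Nat.mul 32 i) j)) (bit (Nat.add (Nat.mul 32 j) i)))

/-- Add the node `n` with neighbours `T`. -/
def addNode (M n T : ℕ) : ℕ :=
  Nat.rec M (fun i ih => bif Nat.testBit T i then addEdge ih n i else ih) n

def ofEdges (l : List (ℕ × ℕ)) : ℕ := List.rec 0 (fun e _ ih => addEdge ih e.1 e.2) l

/-- `f` is the mask of a nonempty connected set of nodes. -/
def connMask (M f : ℕ) : Bool :=
  bif Nat.beq f 0 then false else
    Nat.beq (flood M f 32 (bit (Nat.log2 f)) (bit (Nat.log2 f))) f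

def pack (l : List ℕ) : ℕ := List.rec 0 (fun a _ ih => Nat.lor a (Nat.shiftLeft ih 32)) l

/-- A pattern: the number of nodes, the mask of the nodes that are single vertices, and the
adjacencies. -/
structure Pat where
  n : ℕ
  s : ℕ
  M : ℕ

/-- The rows of `F` are the fibres of a contraction onto the pattern `K`. -/
def contracts (M n s : ℕ) (K : Pat) (F : ℕ) : Bool :=
  Nat.ble K.n 32 && allBelow (fun i =>
    connMask M (row F i) && Nat.beq (diff (row F i) (Nat.sub (bit n) 1)) 0 &&
    (bif Nat.testBit K.s i then
      Nat.beq (bit (Nat.log2 (row F i))) (row F i) && Nat.testBit s (Nat.log2 (row F i))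
      else true) &&
    (bif Nat.testBit (row K.M i) i then false else true) &&
    allBelow (fun k => Nat.beq (Nat.land (row F i) (row F k)) 0 &&
      (bif Nat.beq (Nat.land (nbrs M 32 (row F i)) (row F k)) 0 then
        (bif Nat.testBit (row K.M i) k then false else true) &&
        (bif Nat.testBit (row K.M k) i then false else true)
      else Nat.testBit (row K.M i) k && Nat.testBit (row K.M k) i)) i) K.n

/-- Add a leg from the node `b` to a terminal, if `c` holds, and continue with `k`. -/
def legStep (c : Bool) (M n T : ℕ) (k : ℕ → ℕ → Bool) : Bool :=
  bif c then k (addNode M n T) (Nat.add n 1) else k M n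

def select (i a b c : ℕ) : ℕ := bif Nat.beq i 0 then a else bif Nat.beq i 1 then b else c

def delIf (c : Bool) (M i j : ℕ) : ℕ := bif c then delEdge M i j else M

def legMask (B p q j x y i : ℕ) : ℕ :=
  Nat.lor (Nat.lor (bit B) (bit (select i p q j)))
    (bif Nat.beq y i then bit (select x p q j) else 0)

def resolve (M n B p q j m x y : ℕ) (k : ℕ → ℕ → Bool) : Bool :=
  legStep (Nat.testBit m 0)
    (delIf (Nat.testBit m 0) (delIf (Nat.testBit m 1) (delIf (Nat.testBit m 2) M B j) B q) B p) n
    (legMask B p q j x y 0) fun M n =>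
  legStep (Nat.testBit m 1) M n (legMask B p q j x y 1) fun M n =>
  legStep (Nat.testBit m 2) M n (legMask B p q j x y 2) k

def shapes : List (ℕ × ℕ × ℕ) :=
  [(0, 3, 3), (1, 3, 3), (2, 3, 3), (3, 3, 3), (4, 3, 3), (5, 3, 3), (6, 3, 3), (7, 3, 3),
    (2, 2, 1), (3, 2, 1), (4, 0, 2), (6, 0, 2), (4, 1, 2), (5, 1, 2)]

def inner (n s i : ℕ) : Bool := Nat.ble (Nat.add i 1) n && Nat.testBit s i

def distinct (p q j : ℕ) : Bool :=
  bif Nat.beq p q then false else bif Nat.beq p j then false else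
    bif Nat.beq q j then false else true

/-- The pattern has no model: every way of resolving the blobs in the list leads to a
contradiction or to a larger pattern. -/
def refutesTree (maps : List (Pat × ℕ)) (cands : List ℕ) (j : ℕ) (l : List (ℕ × ℕ × ℕ)) :
    ℕ → ℕ → ℕ → Bool :=
  List.rec (motive := fun _ => ℕ → ℕ → ℕ → Bool)
    (fun M n s => small M n s || anyList (refutes M n s) cands ||
      anyList (fun c => contracts M n s c.1 c.2) maps)
    (fun a _ ih M n s => small M n s || anyList (refutes M n s) cands ||
      anyList (fun c => contracts M n s c.1 c.2) maps ||
      (Nat.ble n 28 && Nat.ble (Nat.add a.1 1) n && inner n s a.2.1 && inner n s a.2.2 &&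
        inner n s j && distinct a.2.1 a.2.2 j &&
        Nat.beq (row M a.1) (Nat.lor (Nat.lor (bit a.2.1) (bit a.2.2)) (bit j)) &&
        allList (fun v => resolve M n a.1 a.2.1 a.2.2 j v.1 v.2.1 v.2.2 fun M n =>
          ih M n (Nat.lor s (bit a.1))) shapes)) l

/-- The data used to show that a pattern with a maximal model has no further attachments. -/
structure Certificate where
  blobs : List (ℕ × ℕ × ℕ)
  cands : List ℕ
  maps : List (Pat × ℕ)
  treeCands : List ℕ
  trees : List (ℕ × List (ℕ × ℕ × ℕ))

def branchMask (b : ℕ × ℕ × ℕ) : ℕ := Nat.lor (bit b.1) (Nat.lor (bit b.2.1) (bit b.2.2))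

/-- The mask `T` lies inside a branch or contains at most one node. -/
def isLocal (c : Certificate) (T : ℕ) : Bool :=
  Nat.beq (diff T (bit (Nat.log2 T))) 0 ||
  anyList (fun b => Nat.beq (diff T (branchMask b)) 0) c.blobs

def nearRow (M n s i : ℕ) : ℕ :=
  Nat.rec 0 (fun k ih => bif Nat.testBit s k then bif Nat.beq i k then ih else
    bif Nat.testBit (row M i) k then Nat.lor ih (bit k) else
    bif Nat.beq (Nat.land (Nat.land (row M i) (row M k)) s) 0 then ih
      else Nat.lor ih (bit k) else ih) n

def checkSingle (K : Pat) (c : Certificate) (T : ℕ) : Bool :=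
  isLocal c T || anyList (refutes (addNode K.M K.n T) (Nat.add K.n 1) (Nat.lor K.s (bit K.n)))
    c.cands ||
  anyList (fun t => Nat.beq t.1 T && refutesTree c.maps c.treeCands K.n t.2 (addNode K.M K.n T)
    (Nat.add K.n 1) (Nat.lor K.s (bit K.n))) c.trees

def checkSingles (K : Pat) (c : Certificate) (i : ℕ) : ℕ → Bool :=
  Nat.rec (checkSingle K c) (fun i ih T => ih T &&
    (bif Nat.testBit K.s i then
      bif Nat.beq (Nat.land T (nearRow K.M K.n K.s i)) 0 then ih (Nat.lor T (bit i)) else true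
      else ih (Nat.lor T (bit i)))) i

def checkPair (K : Pat) (c : Certificate) (D E : ℕ) : Bool :=
  isLocal c (Nat.lor D E) ||
  anyList (refutes (addNode K.M K.n (Nat.lor D E)) (Nat.add K.n 1) K.s) c.cands ||
  small (addNode K.M K.n D) (Nat.add K.n 1) (Nat.lor K.s (bit K.n)) ||
  anyList (refutes (addNode (addNode K.M K.n D) (Nat.add K.n 1) (Nat.lor E (bit K.n)))
    (Nat.add K.n 2) (Nat.lor K.s (bit K.n))) c.cands

def onTerminals (K : Pat) (c : Certificate) (f : ℕ → Bool) : Bool :=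
  allBelow (fun i => bif Nat.testBit K.s i then f (bit i) else true) K.n &&
  allList (fun b => f (Nat.lor (bit b.2.1) (bit b.2.2))) c.blobs

def checkPairs (K : Pat) (c : Certificate) : Bool :=
  onTerminals K c fun D => onTerminals K c fun E => checkPair K c D E

def patP8 : Pat := ⟨8, 15, ofEdges [(0, 1), (2, 3), (0, 4), (4, 2), (1, 5), (5, 2), (0, 6), (6,
    3), (1, 7), (7, 3)]⟩

def patP9 : Pat := ⟨9, 63, ofEdges [(0, 1), (1, 2), (2, 3), (3, 4), (4, 5), (5, 0), (0, 6), (6,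
    3), (1, 7), (7, 4), (2, 8), (8, 5)]⟩

def patP10 : Pat := ⟨10, 1023, ofEdges [(0, 1), (1, 2), (2, 3), (3, 4), (4, 5), (5, 0), (0, 6),
    (6, 3), (1, 7), (7, 4), (2, 8), (8, 5), (9, 6), (9, 7), (9, 8)]⟩

def patH11 : Pat := ⟨11, 63, ofEdges [(0, 2), (0, 3), (1, 4), (1, 5), (0, 6), (6, 1), (2, 7), (7,
    4), (2, 8), (8, 5), (3, 9), (9, 4), (3, 10), (10, 5)]⟩

def patH12 : Pat := ⟨12, 1215, ofEdges [(0, 2), (0, 3), (1, 4), (1, 5), (0, 6), (6, 1), (2, 7),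
    (7, 4), (2, 8), (8, 5), (3, 9), (9, 4), (3, 10), (10, 5), (11, 7), (11, 10)]⟩

def patH13 : Pat := ⟨13, 1983, ofEdges [(0, 2), (0, 3), (1, 4), (1, 5), (0, 6), (6, 1), (2, 7),
    (7, 4), (2, 8), (8, 5), (3, 9), (9, 4), (3, 10), (10, 5), (11, 7), (11, 10), (12, 8), (12,
    9)]⟩

def patH14 : Pat := ⟨14, 16383, ofEdges [(0, 2), (0, 3), (1, 4), (1, 5), (0, 6), (6, 1), (2, 7),
    (7, 4), (2, 8), (8, 5), (3, 9), (9, 4), (3, 10), (10, 5), (11, 7), (11, 10), (12, 8), (12,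
    9), (13, 11), (13, 12), (13, 6)]⟩

def certP8 : Certificate where
  blobs := [(4, 0, 2), (5, 1, 2), (6, 0, 3), (7, 1, 3)]
  cands := [204801, 165955, 53249, 83011, 133128, 17448, 73800, 36968, 262145, 262211, 34824,
    32808, 139336, 131176, 526344, 525352, 532552, 528488, 16392, 544776, 131112, 16456, 32840,
    561256]
  maps := [(patH11, pack [1, 4, 2, 64, 8, 32, 16, 128, 512, 1024, 256]), (patH11, pack [1, 4, 2,
    64, 8, 32, 16, 128, 512, 1024, 2304]), (patH11, pack [1, 4, 2, 64, 8, 32, 16, 128, 512, 2048,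
    1280]), (patH11, pack [1, 4, 2, 64, 8, 32, 16, 128, 512, 2048, 5376]), (patH11, pack [1, 8,
    2, 16, 4, 128, 64, 32, 1024, 512, 256]), (patH11, pack [1, 8, 2, 16, 4, 128, 64, 32, 1024,
    512, 2304]), (patH11, pack [1, 8, 2, 16, 4, 128, 64, 32, 2048, 512, 1280]), (patH11, pack [1,
    8, 2, 16, 4, 128, 64, 32, 2048, 512, 5376]), (patH11, pack [2, 4, 1, 128, 8, 16, 32, 64, 512,
    1024, 256]), (patH11, pack [2, 4, 1, 128, 8, 16, 32, 64, 512, 1024, 2304]), (patH11, pack [2,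
    4, 1, 128, 8, 16, 32, 64, 512, 2048, 1280]), (patH11, pack [2, 4, 1, 128, 8, 16, 32, 64, 512,
    2048, 5376]), (patH11, pack [2, 8, 1, 32, 4, 64, 128, 16, 1024, 512, 256]), (patH11, pack [2,
    8, 1, 32, 4, 64, 128, 16, 1024, 512, 2304]), (patH11, pack [2, 8, 1, 32, 4, 64, 128, 16,
    2048, 512, 1280]), (patH11, pack [2, 8, 1, 32, 4, 64, 128, 16, 2048, 512, 5376]), (patH12,
    pack [1, 4, 2, 64, 8, 32, 16, 128, 512, 1024, 256, 2048]), (patH12, pack [1, 8, 2, 16, 4,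
    128, 64, 32, 2048, 512, 256, 1024]), (patH12, pack [1, 16, 2, 64, 256, 4, 512, 128, 32, 1024,
    8, 2048]), (patH12, pack [1, 64, 2, 16, 256, 8, 2048, 32, 128, 1024, 4, 512]), (patP9, pack
    [1, 2, 32, 4, 8, 64, 16, 128, 256]), (patP9, pack [1, 2, 32, 4, 8, 64, 16, 128, 768]),
    (patP9, pack [1, 2, 32, 4, 8, 64, 16, 128, 1792]), (patP9, pack [1, 2, 128, 8, 4, 16, 64, 32,
    256]), (patP9, pack [1, 2, 128, 8, 4, 16, 64, 32, 768]), (patP9, pack [1, 2, 128, 8, 4, 16,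
    64, 32, 1792])]
  treeCands := [159745, 110593, 344131, 560196, 543813, 77828, 143397, 134246, 68711, 2207745,
    28678, 458753, 593064, 2231398, 658568, 68776, 607299, 134280, 2242564, 35908, 19525,
    1192072, 45095, 327783, 2657480, 278529, 101443, 667685, 1077254, 133288, 2198595, 133128,
    139336, 36968, 559336, 1474627, 426051, 143496, 1607912, 1359873, 150595, 2247747, 602116,
    17448, 66696, 139464, 4194536, 4268264, 2981889, 393217, 83011, 327684, 294980, 393253,
    278597, 2125830, 393318, 657576, 1083624, 6850792, 142404, 2176037, 3424325, 2899974,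
    1070182, 1093671, 2142247, 1087591, 2136167, 1103048]
  trees := [(56, [(4, 0, 2), (5, 1, 2)]), (82, [(6, 0, 3), (4, 0, 2)]), (96, [(5, 1, 2), (6, 0,
    3)]), (112, [(5, 1, 2), (4, 0, 2), (6, 0, 3)]), (144, [(4, 0, 2), (7, 1, 3)]), (161, [(5, 1,
    2), (7, 1, 3)]), (176, [(4, 0, 2), (5, 1, 2), (7, 1, 3)]), (196, [(6, 0, 3), (7, 1, 3)]),
    (208, [(4, 0, 2), (6, 0, 3), (7, 1, 3)]), (224, [(5, 1, 2), (6, 0, 3), (7, 1, 3)]), (240,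
    [(5, 1, 2), (7, 1, 3), (4, 0, 2)])]

def certP9 : Certificate where
  blobs := [(6, 0, 3), (7, 1, 4), (8, 2, 5)]
  cands := [299009, 74786, 149571, 137316, 74885, 90117, 295970, 266281, 147561, 147625, 180225,
    540739, 268293, 133129, 133193, 131209]
  maps := [(patH13, pack [1, 64, 2, 32, 8, 512, 1024, 4, 128, 16, 256, 4096, 2048]), (patH13,
    pack [2, 128, 1, 4, 16, 512, 2048, 32, 64, 8, 256, 4096, 1024]), (patP10, pack [1, 2, 4, 8,
    16, 32, 64, 128, 256, 512])]
  treeCands := [852035, 61441, 14471, 2818148, 917637, 2818049, 40036, 720897, 57350, 28711,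
    2111623, 5111842, 2252834, 50278, 671846, 35975, 35912, 28840, 1048777, 1182921]
  trees := [(448, [(6, 0, 3), (7, 1, 4), (8, 2, 5)])]

def certP10 : Certificate where
  blobs := []
  cands := [180225, 295970, 68675, 137316, 851973, 28711, 14471, 50278, 598088, 155849, 74885,
    657414, 268521, 1048744, 1048841]
  maps := []
  treeCands := []
  trees := []

def certH11 : Certificate where
  blobs := [(6, 0, 1), (7, 2, 4), (8, 2, 5), (9, 3, 4), (10, 3, 5)]
  cands := [1351682, 675843, 262219, 524395, 266251, 599076, 362498, 430116, 67755, 215042,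
    332837, 1597477, 67723, 1081387, 671851, 1123365, 542891, 1343563, 1148931, 1056779, 267371,
    540715, 201764, 1089547, 2101251, 1089579, 1083531, 4203595, 4199531]
  maps := [(patH12, pack [1, 2, 4, 8, 16, 32, 64, 128, 256, 512, 1024, 2048]), (patH12, pack [1,
    2, 4, 8, 16, 32, 64, 128, 256, 512, 1024, 6144]), (patH12, pack [1, 2, 4, 8, 16, 32, 64, 128,
    256, 512, 1024, 14336]), (patH12, pack [1, 2, 4, 8, 32, 16, 64, 256, 128, 1024, 512, 2048]),
    (patH12, pack [1, 2, 4, 8, 32, 16, 64, 256, 128, 1024, 512, 6144]), (patH12, pack [1, 2, 4,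
    8, 32, 16, 64, 256, 128, 1024, 512, 14336]), (patH13, pack [4, 16, 1, 256, 2, 512, 128, 64,
    8, 32, 2048, 4096, 1024]), (patH13, pack [4, 32, 1, 128, 2, 1024, 256, 64, 8, 16, 2048,
    4096, 512])]
  treeCands := [2756611, 575594, 1099881, 4556802, 362498, 275626, 136395, 144521, 215042,
    4409346, 12945410, 1225764, 1081387, 540715, 297163, 2687012, 4330699, 4745386, 75083,
    4793380, 1123365, 549926, 532491, 4269387, 16913611, 1081611, 2293796, 2621476, 3145765,
    33830058, 135179, 267467, 4461771, 12797954, 2621443, 5317669, 1091590, 13640907, 33690827,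
    1062155, 4265227, 4329739, 5275915, 599076, 4347910, 4346918, 4295786, 1347587, 675843]
  trees := [(385, [(8, 2, 5), (7, 2, 4)]), (642, [(7, 2, 4), (9, 3, 4)]), (768, [(9, 3, 4), (8,
    2, 5)]), (832, [(6, 0, 1), (9, 3, 4), (8, 2, 5)]), (960, [(6, 0, 1), (7, 2, 4), (8, 2, 5)]),
    (1152, [(10, 3, 5), (7, 2, 4)]), (1216, [(6, 0, 1), (10, 3, 5), (7, 2, 4)]), (1282, [(8, 2,
    5), (10, 3, 5)]), (1472, [(10, 3, 5), (6, 0, 1), (7, 2, 4)]), (1537, [(10, 3, 5), (9, 3,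
    4)]), (1728, [(6, 0, 1), (7, 2, 4), (9, 3, 4)]), (1856, [(8, 2, 5), (6, 0, 1), (9, 3, 4)]),
    (1920, [(8, 2, 5), (7, 2, 4), (9, 3, 4)]), (1984, [(10, 3, 5), (6, 0, 1), (7, 2, 4)])]

def certH12 : Certificate where
  blobs := [(6, 0, 1), (8, 2, 5), (9, 3, 4), (11, 7, 10)]
  cands := [300138, 551082, 3284994, 1347587, 1123365, 101482, 413733, 1343596, 1613860, 2233450,
    542892, 1148931, 2244652, 313415, 295244, 537735, 2246826, 70892, 266252, 2228300, 2769002,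
    2232652, 201868, 3155015, 8523788, 8398156, 8397900, 8393836]
  maps := [(patH13, pack [1, 2, 4, 8, 16, 32, 64, 128, 256, 512, 1024, 2048, 4096]), (patH13,
    pack [1, 2, 4, 8, 16, 32, 64, 128, 256, 512, 1024, 2048, 12288]), (patH13, pack [1, 2, 4, 8,
    16, 32, 64, 128, 256, 512, 1024, 2048, 28672]), (patH13, pack [4, 32, 1, 128, 2, 1024, 256,
    64, 8, 16, 2048, 4096, 512]), (patH13, pack [4, 32, 1, 128, 2, 1024, 256, 64, 8, 16, 2048,
    12288, 512]), (patH13, pack [4, 32, 1, 128, 2, 1024, 256, 64, 8, 16, 2048, 28672, 512])]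
  treeCands := [144715, 1090632, 1100011, 153768, 6553770, 2233450, 1351682, 11542828, 3154220,
    1148931, 675843]
  trees := [(768, [(8, 2, 5), (9, 3, 4)]), (2112, [(11, 7, 10), (6, 0, 1)]), (2880, [(9, 3, 4),
    (6, 0, 1), (8, 2, 5)])]

def certH13 : Certificate where
  blobs := [(6, 0, 1), (11, 7, 10), (12, 8, 9)]
  cands := [5013610, 76970, 3284994, 430116, 1099881, 332837, 551082, 1062056, 2769002, 1351682,
    4727880, 2232589, 4591753, 4489549, 2244653, 1148931, 3155015, 1096839]
  maps := [(patH14, pack [1, 2, 4, 8, 16, 32, 64, 128, 256, 512, 1024, 2048, 4096, 8192])]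
  treeCands := [10552426, 14942378, 13172739, 1614092, 275626, 300138, 11567372]
  trees := [(6208, [(6, 0, 1), (12, 8, 9), (11, 7, 10)])]

def certH14 : Certificate where
  blobs := []
  cands := [10552426, 4989098, 182603, 1149293, 14942279, 2769293, 8472811, 275756, 1347587,
    3281064, 13115398, 4737229, 599076, 10621196, 10682370, 10948645, 10633254, 10553479,
    10717256, 10699881, 10691721]
  maps := []
  treeCands := []
  trees := []

lemma checkSingles_P8 : checkSingles patP8 certP8 patP8.n 0 = true := by decide +kernel

lemma checkPairs_P8 : checkPairs patP8 certP8 = true := by decide +kernel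

lemma checkSingles_P9 : checkSingles patP9 certP9 patP9.n 0 = true := by decide +kernel

lemma checkPairs_P9 : checkPairs patP9 certP9 = true := by decide +kernel

lemma checkSingles_P10 : checkSingles patP10 certP10 patP10.n 0 = true := by decide +kernel

lemma checkPairs_P10 : checkPairs patP10 certP10 = true := by decide +kernel

lemma checkSingles_H11 : checkSingles patH11 certH11 patH11.n 0 = true := by decide +kernel

lemma checkPairs_H11 : checkPairs patH11 certH11 = true := by decide +kernel

lemma checkSingles_H12 : checkSingles patH12 certH12 patH12.n 0 = true := by decide +kernel

lemma checkPairs_H12 : checkPairs patH12 certH12 = true := by decide +kernel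

lemma checkSingles_H13 : checkSingles patH13 certH13 patH13.n 0 = true := by decide +kernel

lemma checkPairs_H13 : checkPairs patH13 certH13 = true := by decide +kernel

lemma checkSingles_H14 : checkSingles patH14 certH14 patH14.n 0 = true := by decide +kernel

lemma checkPairs_H14 : checkPairs patH14 certH14 = true := by decide +kernel

lemma testBit_land (a b i : ℕ) : (Nat.land a b).testBit i = (a.testBit i && b.testBit i) :=
  Nat.testBit_and a b i

lemma testBit_lor (a b i : ℕ) : (Nat.lor a b).testBit i = (a.testBit i || b.testBit i) :=
  Nat.testBit_or a b i

lemma testBit_row (M i j : ℕ) :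
    (row M i).testBit j = (decide (j < 32) && M.testBit (32 * i + j)) := by
  have : (4294967295 : ℕ) = 2 ^ 32 - 1 := by norm_num
  rw [row, testBit_land, this, Nat.testBit_two_pow_sub_one, Bool.and_comm]
  congr 1
  exact Nat.testBit_shiftRight M

lemma bit_eq (i : ℕ) : bit i = 2 ^ i := by
  change 1 <<< i = _
  rw [Nat.shiftLeft_eq, one_mul]

lemma testBit_bit (i j : ℕ) : (bit i).testBit j = decide (i = j) := by
  rw [bit_eq, Nat.testBit_two_pow]

lemma testBit_mask (n i : ℕ) : (Nat.sub (bit n) 1).testBit i = decide (i < n) := by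
  rw [bit_eq]
  exact Nat.testBit_two_pow_sub_one n i

lemma testBit_diff (a b i : ℕ) : (diff a b).testBit i = (a.testBit i && !b.testBit i) := by
  change (a ^^^ (a &&& b)).testBit i = _
  rw [Nat.testBit_xor, Nat.testBit_and]
  cases a.testBit i <;> cases b.testBit i <;> rfl

lemma diff_eq_zero {a b : ℕ} : diff a b = 0 ↔ ∀ i, a.testBit i → b.testBit i := by
  constructor
  · intro h i hi
    have := testBit_diff a b i
    rw [h, Nat.zero_testBit] at this
    simpa [hi] using this.symm
  · intro h
    refine Nat.eq_of_testBit_eq fun i => ?_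
    rw [testBit_diff, Nat.zero_testBit]
    have := h i
    cases ha : a.testBit i <;> simp_all

lemma land_eq_zero {a b : ℕ} : Nat.land a b = 0 ↔ ∀ i, a.testBit i → ¬ b.testBit i := by
  constructor
  · intro h i hi hb
    have := testBit_land a b i
    rw [h, Nat.zero_testBit] at this
    simp [hi, hb] at this
  · intro h
    refine Nat.eq_of_testBit_eq fun i => ?_
    rw [testBit_land, Nat.zero_testBit]
    have := h i
    cases ha : a.testBit i <;> simp_all

lemma land_ne_zero {a b : ℕ} : Nat.land a b ≠ 0 ↔ ∃ i, a.testBit i ∧ b.testBit i := by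
  rw [Ne, land_eq_zero]
  push Not
  rfl

lemma testBit_addEdge {M i j k l : ℕ} (hi : i < 32) (hj : j < 32) :
    (row (addEdge M i j) k).testBit l ↔
      (row M k).testBit l ∨ (k = i ∧ l = j) ∨ (k = j ∧ l = i) := by
  simp only [testBit_row, addEdge, testBit_lor, testBit_bit]
  change (decide (l < 32) && (M.testBit (32 * k + l) ||
    (decide (32 * i + j = 32 * k + l) || decide (32 * j + i = 32 * k + l)))) = true ↔ _
  simp only [Bool.and_eq_true, Bool.or_eq_true, decide_eq_true_eq]
  constructor
  · rintro ⟨h1, h | h | h⟩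
    · exact .inl ⟨h1, h⟩
    · right; left; omega
    · right; right; omega
  · rintro (⟨h1, h⟩ | h | h)
    · exact ⟨h1, .inl h⟩
    · refine ⟨by omega, .inr (.inl (by omega))⟩
    · refine ⟨by omega, .inr (.inr (by omega))⟩

lemma testBit_delEdge {M i j k l : ℕ} (hi : i < 32) (hj : j < 32) :
    (row (delEdge M i j) k).testBit l ↔
      (row M k).testBit l ∧ ¬ (k = i ∧ l = j) ∧ ¬ (k = j ∧ l = i) := by
  simp only [testBit_row, delEdge, testBit_diff, testBit_lor, testBit_bit]
  change (decide (l < 32) && (M.testBit (32 * k + l) &&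
    !(decide (32 * i + j = 32 * k + l) || decide (32 * j + i = 32 * k + l)))) = true ↔ _
  simp only [Bool.and_eq_true, Bool.not_eq_true', Bool.or_eq_false_iff, decide_eq_true_eq,
    decide_eq_false_iff_not]
  constructor
  · rintro ⟨h1, h, h2, h3⟩
    exact ⟨⟨h1, h⟩, by omega, by omega⟩
  · rintro ⟨⟨h1, h⟩, h2, h3⟩
    exact ⟨h1, h, by omega, by omega⟩

lemma testBit_addNode {M n T : ℕ} (hn : n < 32) (k l : ℕ) :
    (row (addNode M n T) k).testBit l ↔ (row M k).testBit l ∨ (k = n ∧ l < n ∧ T.testBit l) ∨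
      (l = n ∧ k < n ∧ T.testBit k) := by
  suffices h : ∀ m, m ≤ n → ((row (Nat.rec M (fun i ih => bif Nat.testBit T i then
      addEdge ih n i else ih) m : ℕ) k).testBit l ↔ (row M k).testBit l ∨
      (k = n ∧ l < m ∧ T.testBit l) ∨ (l = n ∧ k < m ∧ T.testBit k)) from h n le_rfl
  intro m
  induction m with
  | zero => simp
  | succ m ih =>
    intro hm
    specialize ih (by omega)
    cases h : T.testBit m
    · simp only [h, cond_false, ih]
      have h1 : ∀ a, (a < m + 1 ∧ T.testBit a = true) ↔ (a < m ∧ T.testBit a = true) := by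
        intro a
        constructor
        · rintro ⟨h1, h2⟩
          have : a ≠ m := by rintro rfl; simp_all
          exact ⟨by omega, h2⟩
        · rintro ⟨h1, h2⟩
          exact ⟨by omega, h2⟩
      rw [h1, h1]
    · simp only [h, cond_true]
      rw [testBit_addEdge hn (by omega), ih]
      have h1 : ∀ a, (a < m + 1 ∧ T.testBit a = true) ↔ (a < m ∧ T.testBit a = true) ∨ a = m := by
        intro a
        constructor
        · rintro ⟨h1, h2⟩
          by_cases h3 : a = m
          · exact .inr h3
          · exact .inl ⟨by omega, h2⟩
        · rintro (⟨h1, h2⟩ | rfl)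
          · exact ⟨by omega, h2⟩
          · exact ⟨by omega, h⟩
      rw [h1, h1]
      tauto

lemma ne_of_beq {a b : ℕ} (h : Nat.beq a b = false) : a ≠ b := Nat.ne_of_beq_eq_false h

lemma flood_induction {M R : ℕ} {p : ℕ → Prop}
    (step : ∀ i j, p i → R.testBit j → (row M i).testBit j → p j) (k : ℕ) :
    ∀ F Q, (∀ i, F.testBit i → p i) → (∀ i, Q.testBit i → p i) →
      ∀ i, (flood M R k F Q).testBit i → p i := by
  induction k with
  | zero => exact fun F Q hF _ i hi => hF i hi
  | succ k ih =>
    intro F Q hF hQ i hi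
    cases hq : Nat.beq Q 0
    · have hne : Q ≠ 0 := by rintro rfl; simp at hq
      have e : flood M R (k + 1) F Q = (fun new => flood M R k (Nat.lor F new)
          (Nat.lor (diff Q (bit (Nat.log2 Q))) new))
          (diff (Nat.land (row M (Nat.log2 Q)) R) F) := by
        change (bif Nat.beq Q 0 then _ else _) = _
        rw [hq]; rfl
      rw [e] at hi
      have hnew : ∀ j, (diff (Nat.land (row M (Nat.log2 Q)) R) F).testBit j → p j := by
        intro j hj
        rw [testBit_diff, testBit_land] at hj
        simp only [Bool.and_eq_true] at hj
        exact step _ _ (hQ _ (Nat.testBit_log2 hne)) hj.1.2 hj.1.1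
      refine ih _ _ ?_ ?_ i hi
      · intro j hj
        rw [testBit_lor, Bool.or_eq_true] at hj
        exact hj.elim (hF j) (hnew j)
      · intro j hj
        rw [testBit_lor, Bool.or_eq_true, testBit_diff, Bool.and_eq_true] at hj
        exact hj.elim (fun h => hQ j h.1) (hnew j)
    · have e : flood M R (k + 1) F Q = F := by
        change (bif Nat.beq Q 0 then _ else _) = _
        rw [hq]; rfl
      rw [e] at hi
      exact hF i hi

lemma testBit_nbrs {M k P j : ℕ} (hP : P < 2 ^ k) :
    (nbrs M k P).testBit j ↔ ∃ i, P.testBit i ∧ (row M i).testBit j := by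
  induction k generalizing P with
  | zero =>
    obtain rfl : P = 0 := by omega
    simp [nbrs]
  | succ k ih =>
    cases hq : Nat.beq P 0
    · have hne : P ≠ 0 := by rintro rfl; simp at hq
      have e : nbrs M (k + 1) P = Nat.lor (row M (Nat.log2 P))
          (nbrs M k (diff P (bit (Nat.log2 P)))) := by
        change (bif Nat.beq P 0 then _ else _) = _
        rw [hq]; rfl
      have hlt : diff P (bit (Nat.log2 P)) < 2 ^ k := by
        refine Nat.lt_pow_two_of_testBit _ fun i hi => ?_
        rw [testBit_diff, testBit_bit]
        by_cases h : P.log2 = i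
        · simp [h]
        · have h1 : P.log2 < k + 1 := (Nat.log2_lt hne).2 hP
          have h2 : P < 2 ^ i := (Nat.log2_lt hne).1 (by omega)
          rw [Nat.testBit_lt_two_pow h2]; rfl
      rw [e, testBit_lor, Bool.or_eq_true, ih hlt]
      constructor
      · rintro (h | ⟨i, h1, h2⟩)
        · exact ⟨_, Nat.testBit_log2 hne, h⟩
        · rw [testBit_diff, Bool.and_eq_true] at h1
          exact ⟨i, h1.1, h2⟩
      · rintro ⟨i, h1, h2⟩
        by_cases h : P.log2 = i
        · exact .inl (h ▸ h2)
        · exact .inr ⟨i, by simp [testBit_diff, testBit_bit, h1, h], h2⟩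
    · have hP0 : P = 0 := Nat.eq_of_beq_eq_true hq
      subst hP0
      have e : nbrs M (k + 1) 0 = 0 := rfl
      simp [e]

lemma anyList_eq_true {α : Type} {f : α → Bool} {l : List α} (h : anyList f l = true) :
    ∃ a ∈ l, f a = true := by
  induction l with
  | nil => simp [anyList] at h
  | cons a l ih =>
    change (bif f a then true else anyList f l) = true at h
    cases hf : f a
    · rw [hf] at h
      obtain ⟨b, hb, hb'⟩ := ih h
      exact ⟨b, by simp [hb], hb'⟩
    · exact ⟨a, by simp, hf⟩

lemma allList_eq_true {α : Type} {f : α → Bool} {l : List α} (h : allList f l = true) :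
    ∀ a ∈ l, f a = true := by
  induction l with
  | nil => simp
  | cons a l ih =>
    change (bif f a then allList f l else false) = true at h
    cases hf : f a
    · rw [hf] at h
      simp at h
    · rw [hf] at h
      intro b hb
      rcases List.mem_cons.1 hb with rfl | hb
      · exact hf
      · exact ih h b hb

lemma anyBelow_eq_true {f : ℕ → Bool} {n : ℕ} (h : anyBelow f n = true) : ∃ i < n, f i = true := by
  induction n with
  | zero => simp [anyBelow] at h
  | succ n ih =>
    change (bif f n then true else anyBelow f n) = true at h
    cases hf : f n
    · rw [hf] at h
      obtain ⟨b, hb, hb'⟩ := ih h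
      exact ⟨b, by omega, hb'⟩
    · exact ⟨n, by simp, hf⟩

lemma allBelow_eq_true {f : ℕ → Bool} {n : ℕ} (h : allBelow f n = true) : ∀ i < n, f i = true := by
  induction n with
  | zero => simp
  | succ n ih =>
    change (bif f n then allBelow f n else false) = true at h
    cases hf : f n
    · rw [hf] at h
      simp at h
    · rw [hf] at h
      intro b hb
      rcases Nat.lt_succ_iff_lt_or_eq.1 hb with hb | rfl
      · exact ih h b hb
      · exact hf

lemma two_eq_true {x : ℕ} (h : two x = true) : ∃ i j, i ≠ j ∧ x.testBit i ∧ x.testBit j := by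
  unfold two at h
  cases hx : Nat.beq x 0
  · cases hy : Nat.beq (diff x (bit x.log2)) 0
    · have hx' : x ≠ 0 := by rintro rfl; simp at hx
      have hy' : diff x (bit x.log2) ≠ 0 := by intro h; simp [h] at hy
      have := Nat.testBit_log2 hy'
      rw [testBit_diff, testBit_bit] at this
      simp only [Bool.and_eq_true, Bool.not_eq_true', decide_eq_false_iff_not] at this
      exact ⟨_, _, this.2, Nat.testBit_log2 hx', this.1⟩
    · simp [hx, hy] at h
  · simp [hx] at h

end UF

namespace UF

variable {V : Type} {G : SimpleGraph V}

/-- The union of the sets whose index lies in the mask. -/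
def cover (S : ℕ → Set V) (P : ℕ) : Set V := {v | ∃ i, P.testBit i ∧ v ∈ S i}

lemma subset_cover {S : ℕ → Set V} {P i : ℕ} (h : P.testBit i) : S i ⊆ cover S P :=
  fun _ hv => ⟨i, h, hv⟩

/-- The sets `S i` for `i < n` are disjoint and connected, they touch as prescribed by `M`, and
those in `s` are singletons. -/
structure Model (G : SimpleGraph V) (n s M : ℕ) (S : ℕ → Set V) : Prop where
  le : n ≤ 32
  bound : ∀ i < 32, ∀ k, (row M i).testBit k → i < n ∧ k < n ∧ i ≠ k
  sing : ∀ i, s.testBit i → i < n ∧ ∃ a, S i = {a}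
  conn : ∀ i < n, Conn G (S i)
  disj : ∀ i < n, ∀ k < n, i ≠ k → Disjoint (S i) (S k)
  touch : ∀ i < n, ∀ k < n, i ≠ k → (Touch G (S i) (S k) ↔ (row M i).testBit k)

namespace Model
variable {n s M : ℕ} {S : ℕ → Set V}

lemma eq_of_mem (h : Model G n s M S) {i k : ℕ} (hi : i < n) (hk : k < n) {v : V} (h1 : v ∈ S i)
    (h2 : v ∈ S k) : i = k := by
  by_contra hne
  exact Set.disjoint_left.1 (h.disj i hi k hk hne) h1 h2

lemma touch_of (h : Model G n s M S) {i k : ℕ} (hi : i < n) (hr : (row M i).testBit k) :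
    Touch G (S i) (S k) := by
  have h1 := h.bound i (by have := h.le; omega) k hr
  exact (h.touch i hi k h1.2.1 h1.2.2).2 hr

lemma symm (h : Model G n s M S) {i k : ℕ} (hi : i < n) (hr : (row M i).testBit k) :
    (row M k).testBit i := by
  have h1 := h.bound i (by have := h.le; omega) k hr
  exact (h.touch k h1.2.1 i hi h1.2.2.symm).1 (h.touch_of hi hr).symm

lemma flood_sound (h : Model G n s M S) {R F i : ℕ} {A₀ : Set V} (hR : ∀ i, R.testBit i → i < n)
    (hF : ∀ i, F.testBit i → i < n ∧ ∃ A, Conn G A ∧ A ⊆ cover S R ∧ (A₀ ∩ A).Nonempty ∧ S i ⊆ A)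
    (hi : (flood M R 32 F F).testBit i) :
    i < n ∧ ∃ A, Conn G A ∧ A ⊆ cover S R ∧ (A₀ ∩ A).Nonempty ∧ S i ⊆ A := by
  refine flood_induction (p := fun i => i < n ∧ ∃ A, Conn G A ∧ A ⊆ cover S R ∧
    (A₀ ∩ A).Nonempty ∧ S i ⊆ A) ?_ 32 F F hF hF i hi
  rintro i j ⟨hi, A, hA, hAR, hA0, hiA⟩ hj hij
  refine ⟨hR j hj, A ∪ S j, hA.union_touch (h.conn j (hR j hj))
    ((h.touch_of hi hij).mono hiA subset_rfl), Set.union_subset hAR (subset_cover hj),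
    hA0.mono (Set.inter_subset_inter_right _ Set.subset_union_left), Set.subset_union_right⟩

lemma reach_sound (h : Model G n s M S) {u v R : ℕ} (hu : u < n) (hv : v < n)
    (hR : ∀ i, R.testBit i → i < n) (hr : reach M u v R = true) :
    ∃ I, Conn G I ∧ I ⊆ cover S R ∧ Touch G (S u) I ∧ Touch G (S v) I := by
  unfold reach at hr
  cases hz : Nat.beq (Nat.land (row M v) (flood M R 32 (Nat.land (row M u) R)
    (Nat.land (row M u) R))) 0
  · have : Nat.land (row M v) (flood M R 32 (Nat.land (row M u) R)
      (Nat.land (row M u) R)) ≠ 0 := ne_of_beq hz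
    obtain ⟨i, h1, h2⟩ := land_ne_zero.1 this
    obtain ⟨h3, A, hA, hAR, ⟨x, hx, hxA⟩, hiA⟩ :=
      h.flood_sound (A₀ := {x | Touch G (S u) {x}}) hR (by
      intro j hj
      rw [testBit_land, Bool.and_eq_true] at hj
      refine ⟨hR j hj.2, S j, h.conn j (hR j hj.2), subset_cover hj.2, ?_, subset_rfl⟩
      obtain ⟨a, ha, b, hb, hab⟩ := h.touch_of hu hj.1
      exact ⟨b, ⟨a, ha, b, rfl, hab⟩, hb⟩) h2
    refine ⟨A, hA, hAR, Touch.mono hx subset_rfl (by simpa using hxA), ?_⟩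
    exact (h.touch_of hv h1).mono subset_rfl hiA
  · rw [hz] at hr; cases hr

lemma disjoint_cover (h : Model G n s M S) {i P : ℕ} (hi : i < n) (hP : ∀ j, P.testBit j → j < n)
    (hiP : ¬ P.testBit i) : Disjoint (S i) (cover S P) := by
  rw [Set.disjoint_left]
  rintro v hv ⟨j, hj, hvj⟩
  exact hiP (h.eq_of_mem hi (hP j hj) hv hvj ▸ hj)

lemma lt_pow (hn : n ≤ 32) {P : ℕ} (hP : ∀ i, P.testBit i → i < n) : P < 2 ^ 32 := by
  refine Nat.lt_pow_two_of_testBit _ fun i hi => ?_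
  by_contra hne
  have := hP i (by simpa using hne)
  omega

lemma not_bypassed (h : Model G n s M S) (hG : BypassTouch G) {u v I : ℕ}
    (hI : ∀ i, I.testBit i → i < n) (huI : ¬ I.testBit u) (hvI : ¬ I.testBit v) :
    bypassed M n s u v I = false := by
  by_contra hb
  rw [Bool.not_eq_false] at hb
  unfold bypassed at hb
  cases hc : (Nat.testBit s u && Nat.testBit s v && Nat.testBit (row M u) v &&
    Nat.ble (Nat.add u 1) n && Nat.ble (Nat.add v 1) n && reach M u v I)
  · simp [hc] at hb
  simp only [hc, cond_true] at hb
  simp only [Bool.and_eq_true] at hc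
  obtain ⟨⟨⟨⟨⟨hsu, hsv⟩, huv⟩, -⟩, -⟩, hr⟩ := hc
  obtain ⟨hu, a, ha⟩ := h.sing u hsu
  obtain ⟨hv, b, hb'⟩ := h.sing v hsv
  set R := diff (Nat.sub (bit n) 1) (Nat.lor (Nat.lor I (nbrs M 32 I)) (Nat.lor (bit u) (bit v)))
    with hRdef
  have hRb : ∀ i, R.testBit i → i < n ∧ ¬ I.testBit i ∧ (∀ j, I.testBit j → ¬ (row M j).testBit i) ∧
      u ≠ i ∧ v ≠ i := by
    intro i hi
    rw [hRdef, testBit_diff, testBit_mask, testBit_lor, testBit_lor, testBit_lor, testBit_bit,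
      testBit_bit] at hi
    simp only [Bool.and_eq_true, Bool.not_eq_true', Bool.or_eq_false_iff, decide_eq_true_eq,
      decide_eq_false_iff_not] at hi
    refine ⟨hi.1, by simp [hi.2.1.1], fun j hj hji => ?_, hi.2.2.1, hi.2.2.2⟩
    have := (testBit_nbrs (lt_pow h.le hI)).2 ⟨j, hj, hji⟩
    rw [hi.2.1.2] at this
    cases this
  have hR : ∀ i, R.testBit i → i < n := fun i hi => (hRb i hi).1
  obtain ⟨A, hA, hAI, huA, hvA⟩ := h.reach_sound hu hv hI hr
  obtain ⟨B, hB, hBR, huB, hvB⟩ := h.reach_sound hu hv hR hb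
  have hab : G.Adj a b := by
    have := h.touch_of hu huv
    rwa [ha, hb', touch_singleton] at this
  have key : ∀ x ∈ A, ∀ y ∈ B, x ≠ y ∧ ¬ G.Adj x y := by
    intro x hx y hy
    obtain ⟨i, hi, hxi⟩ := hAI hx
    obtain ⟨j, hj, hyj⟩ := hBR hy
    have hj' := hRb j hj
    have hij : i ≠ j := by rintro rfl; exact hj'.2.1 hi
    refine ⟨?_, fun hadj => ?_⟩
    · rintro rfl
      exact hij (h.eq_of_mem (hI i hi) hj'.1 hxi hyj)
    · exact hj'.2.2.1 i hi ((h.touch i (hI i hi) j hj'.1 hij).1 ⟨x, hxi, y, hyj, hadj⟩)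
  obtain ⟨x, hx, y, hy, hxy⟩ := hG a b A B
    ⟨hab, hA, hB, Set.disjoint_left.2 fun x hx hy => (key x hx x hy).1 rfl,
      fun hx => Set.disjoint_left.1 (h.disjoint_cover hu hI huI) (ha ▸ rfl) (hAI hx),
      fun hx => Set.disjoint_left.1 (h.disjoint_cover hv hI hvI) (hb' ▸ rfl) (hAI hx),
      fun hx => Set.disjoint_left.1 (h.disjoint_cover hu hR fun h => (hRb u h).2.2.2.1 rfl)
        (ha ▸ rfl) (hBR hx),
      fun hx => Set.disjoint_left.1 (h.disjoint_cover hv hR fun h => (hRb v h).2.2.2.2 rfl)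
        (hb' ▸ rfl) (hBR hx), ha ▸ huA, hb' ▸ hvA, ha ▸ huB, hb' ▸ hvB⟩
  exact (key x hx y hy).2 hxy

lemma not_refutes (h : Model G n s M S) (hG : BypassTouch G) (c : ℕ) :
    refutes M n s c = false := by
  have key : ∀ i, (diff (Nat.land (Nat.sub (bit n) 1) (Nat.div c 1024))
      (Nat.lor (bit (Nat.mod c 32)) (bit (Nat.mod (Nat.div c 32) 32)))).testBit i →
      i < n ∧ Nat.mod c 32 ≠ i ∧ Nat.mod (Nat.div c 32) 32 ≠ i := by
    intro i hi
    rw [testBit_diff, testBit_land, testBit_mask, testBit_lor, testBit_bit, testBit_bit] at hi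
    simp only [Bool.and_eq_true, Bool.not_eq_true', Bool.or_eq_false_iff, decide_eq_true_eq,
      decide_eq_false_iff_not] at hi
    exact ⟨hi.1.1, hi.2⟩
  exact h.not_bypassed hG (fun i hi => (key i hi).1) (fun hi => (key _ hi).2.1 rfl)
    (fun hi => (key _ hi).2.2 rfl)

lemma adj_of (h : Model G n s M S) {i k : ℕ} {a b : V} (hi : i < n) (ha : S i = {a})
    (hb : S k = {b}) (hr : (row M i).testBit k) : G.Adj a b := by
  have := h.touch_of hi hr
  rwa [ha, hb, touch_singleton] at this

lemma ne_of (h : Model G n s M S) {i k : ℕ} {a b : V} (hi : i < n) (hk : k < n) (ha : S i = {a})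
    (hb : S k = {b}) (hik : i ≠ k) : a ≠ b := by
  rintro rfl
  exact hik (h.eq_of_mem hi hk (v := a) (ha ▸ rfl) (hb ▸ rfl))

lemma not_small (h : Model G n s M S) (hG : Core G) : small M n s = false := by
  by_contra hb
  rw [Bool.not_eq_false] at hb
  obtain ⟨i, hi, h1⟩ := anyBelow_eq_true hb
  cases hsi : s.testBit i
  · simp [hsi] at h1
  rw [hsi, cond_true] at h1
  obtain ⟨k, hk, h2⟩ := anyBelow_eq_true h1
  cases hsk : s.testBit k
  · simp [hsk] at h2
  rw [hsk, cond_true] at h2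
  obtain ⟨hin, a, ha⟩ := h.sing i hsi
  obtain ⟨hkn, b, hb⟩ := h.sing k hsk
  unfold close at h2
  cases hr : (row M i).testBit k
  · rw [hr, cond_false] at h2
    obtain ⟨p, q, hpq, hp, hq⟩ := two_eq_true h2
    simp only [testBit_land, Bool.and_eq_true] at hp hq
    obtain ⟨hpn, c, hc⟩ := h.sing p hp.2
    obtain ⟨hqn, d, hd⟩ := h.sing q hq.2
    exact hG.sq a b c d (h.ne_of hin hkn ha hb hk.ne') (h.ne_of hpn hqn hc hd hpq)
      (h.adj_of hin ha hc hp.1.1) (h.adj_of hin ha hd hq.1.1) (h.adj_of hkn hb hc hp.1.2)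
      (h.adj_of hkn hb hd hq.1.2)
  · rw [hr, cond_true] at h2
    cases hz : Nat.beq (Nat.land (Nat.land (row M i) (row M k)) s) 0
    · have : Nat.land (Nat.land (row M i) (row M k)) s ≠ 0 := ne_of_beq hz
      obtain ⟨p, hp, hps⟩ := land_ne_zero.1 this
      simp only [testBit_land, Bool.and_eq_true] at hp
      obtain ⟨hpn, c, hc⟩ := h.sing p hps
      exact hG.tri a b c (h.adj_of hin ha hb hr) (h.adj_of hin ha hc hp.1)
        (h.adj_of hkn hb hc hp.2)
    · rw [hz] at h2; cases h2

end Model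

lemma conn_of_forall {A : Set V} {A₀ : Set V} (h0 : Conn G A₀) (h1 : A₀ ⊆ A)
    (h : ∀ y ∈ A, ∃ C ⊆ A, Conn G C ∧ A₀ ⊆ C ∧ y ∈ C) : Conn G A := by
  refine ⟨h0.1.mono h1, fun B hB hne hBA => ?_⟩
  obtain ⟨x, hx⟩ := h0.1
  obtain ⟨y, hyB, z, hz, hzB⟩ : ∃ y ∈ B, ∃ z ∈ A, z ∉ B := by
    obtain ⟨y, hy⟩ := hne
    obtain ⟨z, hz, hzB⟩ := Set.not_subset.1 (fun h => hBA (hB.antisymm h))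
    exact ⟨y, hy, z, hz, hzB⟩
  by_cases hxB : x ∈ B
  · obtain ⟨C, hCA, hC, hC0, hzC⟩ := h z hz
    have := touch_diff_of_left (T := A) hC ⟨x, hC0 hx, hxB⟩ (fun h => hzB (h hzC))
    rwa [Set.union_eq_self_of_subset_left hCA] at this
  · obtain ⟨C, hCA, hC, hC0, hyC⟩ := h y (hB hyB)
    have := touch_diff_of_left (T := A) hC ⟨y, hyC, hyB⟩ (fun h => hxB (h (hC0 hx)))
    rwa [Set.union_eq_self_of_subset_left hCA] at this

/-- The pattern uses only its own nodes and has no loops. -/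
def Pat.Valid (K : Pat) : Prop :=
  (∀ i < 32, ∀ k < 32, (row K.M i).testBit k → i < K.n ∧ k < K.n ∧ i ≠ k) ∧ K.s < 2 ^ K.n

namespace Model
variable {n s M : ℕ} {S : ℕ → Set V}

lemma conn_cover (h : Model G n s M S) {f : ℕ} (hf : ∀ i, f.testBit i → i < n)
    (hc : connMask M f = true) : Conn G (cover S f) := by
  unfold connMask at hc
  cases hz : Nat.beq f 0
  · have hne : f ≠ 0 := by rintro rfl; simp at hz
    rw [hz, cond_false] at hc
    have hfl := Nat.eq_of_beq_eq_true hc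
    have hl := Nat.testBit_log2 hne
    refine conn_of_forall (h.conn _ (hf _ hl)) (subset_cover hl) ?_
    rintro y ⟨i, hi, hy⟩
    rw [← hfl] at hi
    obtain ⟨x, hx⟩ := (h.conn _ (hf _ hl)).1
    have key := flood_induction (M := M) (R := f) (p := fun i => i < n ∧ ∃ A, Conn G A ∧
      A ⊆ cover S f ∧ S (Nat.log2 f) ⊆ A ∧ S i ⊆ A) (by
        rintro i j ⟨hi, A, hA, hAR, hA0, hiA⟩ hj hij
        exact ⟨hf j hj, A ∪ S j, hA.union_touch (h.conn j (hf j hj))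
          ((h.touch_of hi hij).mono hiA subset_rfl), Set.union_subset hAR (subset_cover hj),
          hA0.trans Set.subset_union_left, Set.subset_union_right⟩) 32
        (bit (Nat.log2 f)) (bit (Nat.log2 f))
    have h0 : ∀ i, (bit (Nat.log2 f)).testBit i → i < n ∧ ∃ A, Conn G A ∧
      A ⊆ cover S f ∧ S (Nat.log2 f) ⊆ A ∧ S i ⊆ A := by
      intro i hi
      rw [testBit_bit, decide_eq_true_eq] at hi
      subst hi
      exact ⟨hf _ hl, _, h.conn _ (hf _ hl), subset_cover hl, subset_rfl, subset_rfl⟩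
    obtain ⟨-, A, hA, hAf, hA0, hiA⟩ := key h0 h0 i hi
    exact ⟨A, hAf, hA, hA0, hiA hy⟩
  · rw [hz] at hc; cases hc

lemma touch_cover (h : Model G n s M S) {f g : ℕ} (hf : ∀ i, f.testBit i → i < n)
    (hg : ∀ i, g.testBit i → i < n) (hfg : Nat.land f g = 0) :
    Touch G (cover S f) (cover S g) ↔ Nat.land (nbrs M 32 f) g ≠ 0 := by
  rw [land_ne_zero]
  constructor
  · rintro ⟨x, ⟨i, hi, hx⟩, y, ⟨j, hj, hy⟩, hxy⟩
    have hij : i ≠ j := by rintro rfl; exact land_eq_zero.1 hfg i hi hj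
    exact ⟨j, (testBit_nbrs (lt_pow h.le hf)).2
      ⟨i, hi, (h.touch i (hf i hi) j (hg j hj) hij).1 ⟨x, hx, y, hy, hxy⟩⟩, hj⟩
  · rintro ⟨j, hj, hj'⟩
    obtain ⟨i, hi, hij⟩ := (testBit_nbrs (lt_pow h.le hf)).1 hj
    exact (h.touch_of (hf i hi) hij).mono (subset_cover hi) (subset_cover hj')

lemma of_contracts (h : Model G n s M S) {K : Pat} {F : ℕ} (hK : K.Valid)
    (hc : contracts M n s K F = true) :
    Model G K.n K.s K.M (fun i => cover S (row F i)) := by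
  unfold contracts at hc
  rw [Bool.and_eq_true] at hc
  obtain ⟨hle, hc⟩ := hc
  have hle' := Nat.le_of_ble_eq_true hle
  have hc := allBelow_eq_true hc
  simp only [Bool.and_eq_true] at hc
  have hF : ∀ i < K.n, ∀ j, (row F i).testBit j → j < n := by
    intro i hi j hj
    have := diff_eq_zero.1 (Nat.eq_of_beq_eq_true (hc i hi).1.1.1.2) j hj
    rwa [testBit_mask, decide_eq_true_eq] at this
  have hlt : ∀ i < K.n, ∀ k < i, Nat.land (row F i) (row F k) = 0 ∧
      ((Nat.land (nbrs M 32 (row F i)) (row F k) ≠ 0 ↔ (row K.M i).testBit k) ∧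
        (Nat.land (nbrs M 32 (row F i)) (row F k) ≠ 0 ↔ (row K.M k).testBit i)) := by
    intro i hi k hk
    have h1 := allBelow_eq_true (hc i hi).2 k hk
    rw [Bool.and_eq_true] at h1
    refine ⟨Nat.eq_of_beq_eq_true h1.1, ?_⟩
    have h2 := h1.2
    cases hz : Nat.beq (Nat.land (nbrs M 32 (row F i)) (row F k)) 0
    · have : Nat.land (nbrs M 32 (row F i)) (row F k) ≠ 0 := ne_of_beq hz
      rw [hz, cond_false, Bool.and_eq_true] at h2
      exact ⟨⟨fun _ => h2.1, fun _ => this⟩, ⟨fun _ => h2.2, fun _ => this⟩⟩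
    · have : Nat.land (nbrs M 32 (row F i)) (row F k) = 0 := Nat.eq_of_beq_eq_true hz
      rw [hz, cond_true, Bool.and_eq_true] at h2
      have h3 : (row K.M i).testBit k = false := by
        cases h : (row K.M i).testBit k
        · rfl
        · simp [h] at h2
      have h4 : (row K.M k).testBit i = false := by
        cases h : (row K.M k).testBit i
        · rfl
        · simp [h] at h2
      rw [h3, h4]
      exact ⟨⟨fun h => absurd this h, fun h => by cases h⟩,
        ⟨fun h => absurd this h, fun h => by cases h⟩⟩
  have hd : ∀ i < K.n, ∀ k < i, Disjoint (cover S (row F i)) (cover S (row F k)) := by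
    intro i hi k hk
    rw [Set.disjoint_left]
    rintro v ⟨a, ha, hva⟩ ⟨b, hb, hvb⟩
    have : a = b := h.eq_of_mem (hF i hi a ha) (hF k (by omega) b hb) hva hvb
    subst this
    exact land_eq_zero.1 (hlt i hi k hk).1 a ha hb
  have ht : ∀ i < K.n, ∀ k < i, (Touch G (cover S (row F i)) (cover S (row F k)) ↔
      Nat.land (nbrs M 32 (row F i)) (row F k) ≠ 0) := fun i hi k hk =>
    h.touch_cover (hF i hi) (hF k (by omega)) (hlt i hi k hk).1
  refine ⟨hle', ?_, ?_, ?_, ?_, ?_⟩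
  · intro i hi k hk
    refine hK.1 i hi k ?_ hk
    rw [testBit_row] at hk
    simp only [Bool.and_eq_true, decide_eq_true_eq] at hk
    exact hk.1
  · intro i hi
    have hin : i < K.n := by
      by_contra hne
      rw [Nat.testBit_lt_two_pow (hK.2.trans_le (Nat.pow_le_pow_right (by omega) (by omega)))] at hi
      cases hi
    refine ⟨hin, ?_⟩
    have h1 := (hc i hin).1.1.2
    rw [hi, cond_true, Bool.and_eq_true] at h1
    obtain ⟨-, a, ha⟩ := h.sing _ h1.2
    refine ⟨a, ?_⟩
    have h2 := Nat.eq_of_beq_eq_true h1.1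
    rw [← ha]
    ext v
    constructor
    · rintro ⟨j, hj, hv⟩
      rw [← h2, testBit_bit, decide_eq_true_eq] at hj
      exact hj ▸ hv
    · intro hv
      refine ⟨_, ?_, hv⟩
      rw [← h2, testBit_bit, decide_eq_true_eq, h2]
  · exact fun i hi => h.conn_cover (hF i hi) (hc i hi).1.1.1.1
  · intro i hi k hk hik
    rcases lt_or_gt_of_ne hik with hlt' | hlt'
    · exact (hd k hk i hlt').symm
    · exact hd i hi k hlt'
  · intro i hi k hk hik
    rcases lt_or_gt_of_ne hik with hlt' | hlt'
    · rw [touch_comm, ht k hk i hlt', (hlt k hk i hlt').2.2]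
    · rw [ht i hi k hlt', (hlt i hi k hlt').2.1]

end Model

lemma Conn.exists_first_link [Finite V] {D : Set V} (hD : Conn G D) {u : V} (hu : Touch G {u} D)
    {N : V → Prop} (hN : ∃ z ∈ D, N z) :
    ∃ z ∈ D, N z ∧ ∃ L ⊆ D \ {z}, Link G u z L ∧ ∀ w ∈ L, ¬ N w := by
  obtain ⟨z₀, hz₀, hN₀⟩ := hN
  obtain ⟨L₀, hL₀, hl₀⟩ := hD.exists_link hz₀ hu
  have hfin : {L : Set V | ∃ z ∈ D, N z ∧ L ⊆ D \ {z} ∧ Link G u z L}.Finite := Set.toFinite _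
  obtain ⟨L, ⟨z, hz, hNz, hL, hl⟩, hmin⟩ :=
    hfin.exists_minimal ⟨L₀, z₀, hz₀, hN₀, hL₀, hl₀⟩
  refine ⟨z, hz, hNz, L, hL, hl, fun w hw hNw => ?_⟩
  rcases hl with ⟨rfl, -⟩ | ⟨hc, huL, -⟩
  · exact hw
  · obtain ⟨L', hL', hl'⟩ := hc.exists_link hw huL
    have hsub : L' ⊆ L := hL'.trans Set.sdiff_subset
    have := hmin ⟨w, (hL hw).1, hNw, fun x hx => ⟨(hL (hsub hx)).1, (hL' hx).2⟩, hl'⟩ hsub hw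
    exact (hL' this).2 rfl

lemma touch_singleton_left {a : V} {B : Set V} : Touch G {a} B ↔ ∃ b ∈ B, G.Adj a b := by
  simp [Touch]

/-- Three links from `p`, `q`, `j` to `s` inside `B`, with almost no further adjacencies. -/
structure WeakTripod (G : SimpleGraph V) (B : Set V) (p q j s : V) (P Q J : Set V) : Prop where
  mem : s ∈ B
  subP : P ⊆ B \ {s}
  subQ : Q ⊆ B \ {s}
  subJ : J ⊆ B \ {s}
  linkP : Link G p s P
  linkQ : Link G q s Q
  linkJ : Link G j s J
  disjPQ : Disjoint P Q
  disjPJ : Disjoint P J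
  disjQJ : Disjoint Q J
  touchPQ : ¬ Touch G P Q
  touchPJ : ¬ Touch G P J
  touchQJ : ¬ Touch G Q J
  pQ : ¬ Touch G {p} Q
  qP : ¬ Touch G {q} P
  jP : ¬ Touch G {j} P
  jQ : Touch G {j} Q → J = ∅
  pJ : Touch G {p} J → P = ∅
  qJ : Touch G {q} J → Q = ∅
  pqJ : ¬ (Touch G {p} J ∧ Touch G {q} J)

lemma WeakTripod.swap {B : Set V} {p q j s : V} {P Q J : Set V}
    (h : WeakTripod G B p q j s P Q J) (hjQ : ¬ Touch G {j} Q) : WeakTripod G B q p j s Q P J where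
  mem := h.mem
  subP := h.subQ
  subQ := h.subP
  subJ := h.subJ
  linkP := h.linkQ
  linkQ := h.linkP
  linkJ := h.linkJ
  disjPQ := h.disjPQ.symm
  disjPJ := h.disjQJ
  disjQJ := h.disjPJ
  touchPQ := fun t => h.touchPQ t.symm
  touchPJ := h.touchQJ
  touchQJ := h.touchPJ
  pQ := h.qP
  qP := h.pQ
  jP := hjQ
  jQ := fun t => absurd t h.jP
  pJ := h.qJ
  qJ := h.pJ
  pqJ := fun t => h.pqJ t.symm

/-- `A` is minimal among the connected sets touched by `p` and `q`. -/
structure Connector (G : SimpleGraph V) (p q : V) (A : Set V) : Prop where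
  conn : Conn G A
  left : Touch G {p} A
  right : Touch G {q} A
  min : ∀ A' ⊆ A, Conn G A' → Touch G {p} A' → Touch G {q} A' → A' = A

lemma Connector.symm {p q : V} {A : Set V} (h : Connector G p q A) : Connector G q p A :=
  ⟨h.conn, h.right, h.left, fun A' h1 h2 h3 h4 => h.min A' h1 h2 h4 h3⟩

lemma exists_connector [Finite V] {p q : V} {B : Set V} (hB : Conn G B) (hp : Touch G {p} B)
    (hq : Touch G {q} B) : ∃ A ⊆ B, Connector G p q A := by
  have hfin : {A : Set V | A ⊆ B ∧ Conn G A ∧ Touch G {p} A ∧ Touch G {q} A}.Finite :=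
    Set.toFinite _
  obtain ⟨A, ⟨h1, h2, h3, h4⟩, hmin⟩ := hfin.exists_minimal ⟨B, subset_rfl, hB, hp, hq⟩
  exact ⟨A, h1, h2, h3, h4, fun A' ha hb hc hd =>
    ha.antisymm (hmin ⟨ha.trans h1, hb, hc, hd⟩ ha)⟩

lemma Connector.not_touch {p q s : V} {A L : Set V} (h : Connector G p q A) (hs : s ∈ A)
    (hL : L ⊆ A \ {s}) (hl : Link G p s L) : ¬ Touch G {q} L := by
  rcases hl with ⟨rfl, -⟩ | ⟨hc, hp, -⟩
  · exact not_touch_empty_right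
  · intro hq
    have := h.min L (hL.trans Set.sdiff_subset) hc hp hq
    exact (hL (this ▸ hs)).2 rfl

lemma Connector.separate {p q s : V} {A L L' : Set V} (h : Connector G p q A) (hs : s ∈ A)
    (hL : L ⊆ A \ {s}) (hl : Link G p s L) (hL' : L' ⊆ A \ {s}) (hl' : Link G q s L') :
    Disjoint L L' ∧ ¬ Touch G L L' := by
  rcases hl with ⟨rfl, -⟩ | ⟨hc, hp, -⟩
  · simp
  rcases hl' with ⟨rfl, -⟩ | ⟨hc', hq, -⟩
  · simp
  have key : ¬ Conn G (L ∪ L') := by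
    intro hcc
    have := h.min (L ∪ L') (Set.union_subset (hL.trans Set.sdiff_subset)
      (hL'.trans Set.sdiff_subset)) hcc (hp.mono subset_rfl Set.subset_union_left)
      (hq.mono subset_rfl Set.subset_union_right)
    have hs' : s ∈ L ∪ L' := this ▸ hs
    exact hs'.elim (fun h => (hL h).2 rfl) (fun h => (hL' h).2 rfl)
  refine ⟨Set.disjoint_left.2 fun x hx hx' => key (hc.union_inter hc' hx hx'), fun ht =>
    key (hc.union_touch hc' ht)⟩

lemma exists_weakTripod_of_touch [Finite V] {B A : Set V} {p q j : V} (hAB : A ⊆ B)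
    (hA : Connector G p q A) (hj : Touch G {j} A) :
    ∃ s P Q J, WeakTripod G B p q j s P Q J := by
  obtain ⟨_, rfl, z, hz, hjz⟩ := hj
  obtain ⟨s, hs, hjs, P, hP, hl, hN⟩ := hA.conn.exists_first_link hA.left ⟨z, hz, hjz⟩
  obtain ⟨Q, hQ, hl'⟩ := hA.conn.exists_link hs hA.right
  obtain ⟨h1, h2⟩ := hA.separate hs hP hl hQ hl'
  have hmono : ∀ {X : Set V}, X ⊆ A \ {s} → X ⊆ B \ {s} := fun h x hx =>
    ⟨hAB (h hx).1, (h hx).2⟩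
  exact ⟨s, P, Q, ∅, {
    mem := hAB hs
    subP := hmono hP
    subQ := hmono hQ
    subJ := Set.empty_subset _
    linkP := hl
    linkQ := hl'
    linkJ := .inl ⟨rfl, hjs⟩
    disjPQ := h1
    disjPJ := by simp
    disjQJ := by simp
    touchPQ := h2
    touchPJ := not_touch_empty_right
    touchQJ := not_touch_empty_right
    pQ := hA.symm.not_touch hs hQ hl'
    qP := hA.not_touch hs hP hl
    jP := by
      rintro ⟨_, rfl, w, hw, h⟩
      exact hN w hw h
    jQ := fun _ => rfl
    pJ := fun h => absurd h not_touch_empty_right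
    qJ := fun h => absurd h not_touch_empty_right
    pqJ := fun h => not_touch_empty_right h.1 }⟩

/-- A minimal connected set outside `A` linking `j` to `A`, ending in `t`. -/
structure Arm (G : SimpleGraph V) (A B : Set V) (j t : V) (L : Set V) : Prop where
  mem : t ∈ B \ A
  sub : L ⊆ (B \ A) \ {t}
  link : Link G j t L
  touch : Touch G {t} A
  not_touch : ¬ Touch G A L

lemma exists_arm [Finite V] {A B : Set V} {j : V} (hAB : A ⊆ B) (hA : A.Nonempty) (hB : Conn G B)
    (hj : Touch G {j} B) (hjA : ¬ Touch G {j} A) : ∃ t L, Arm G A B j t L := by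
  obtain ⟨_, rfl, t₀, ht₀, hjt⟩ := hj
  have ht₀A : t₀ ∉ A := fun h => hjA ⟨_, rfl, t₀, h, hjt⟩
  obtain ⟨S, hS1, hS2, hS3, hS4⟩ := exists_component (G := G) (R := B \ A) ⟨ht₀, ht₀A⟩
  have hSA : Touch G A S := by
    have hne : S ≠ B := by
      rintro rfl
      obtain ⟨a, ha⟩ := hA
      exact (hS2 (hAB ha)).2 ha
    obtain ⟨s, hs, y, hy, hsy⟩ := hB.2 S (hS2.trans Set.sdiff_subset) hS3.1 hne
    by_cases hyA : y ∈ A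
    · exact ⟨y, hyA, s, hs, hsy.symm⟩
    · exact absurd hsy (hS4 y ⟨hy.1, hyA⟩ hy.2 s hs)
  have : ∃ z ∈ S, Touch G A {z} := by
    obtain ⟨a, ha, s, hs, h⟩ := hSA
    exact ⟨s, hs, a, ha, s, rfl, h⟩
  obtain ⟨t, ht, htA, L, hL, hl, hN⟩ := hS3.exists_first_link ⟨_, rfl, t₀, hS1, hjt⟩ this
  refine ⟨t, L, hS2 ht, fun x hx => ⟨hS2 (hL hx).1, (hL hx).2⟩, hl, htA.symm, ?_⟩
  rintro ⟨a, ha, w, hw, h⟩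
  exact hN w hw ⟨a, ha, w, rfl, h⟩

lemma Arm.conn {A B L : Set V} {j t : V} (h : Arm G A B j t L) : Conn G (insert t L) :=
  h.link.conn_insert

lemma Arm.insert_sub {A B L : Set V} {j t : V} (h : Arm G A B j t L) : insert t L ⊆ B \ A :=
  Set.insert_subset h.mem fun _ hx => (h.sub hx).1

/-- `B` is minimal among the connected sets touched by `p`, `q` and `j`. -/
def MinTouched (G : SimpleGraph V) (p q j : V) (B : Set V) : Prop :=
  ∀ B' ⊆ B, Conn G B' → Touch G {p} B' → Touch G {q} B' → Touch G {j} B' → B' = B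

lemma exists_weakTripod_of_arm_touch [Finite V] {B A L : Set V} {p q j t : V} (hAB : A ⊆ B)
    (hA : Connector G p q A) (hjA : ¬ Touch G {j} A) (hB : MinTouched G p q j B)
    (hL : Arm G A B j t L) (hp : Touch G {p} (insert t L)) :
    ∃ s P Q J, WeakTripod G B p q j s P Q J ∧ ¬ Touch G {j} Q := by
  have hqL : ¬ Touch G {q} (insert t L) := by
    intro hq
    have := hB _ (hL.insert_sub.trans Set.sdiff_subset) hL.conn hp hq hL.link.touch_insert
    obtain ⟨a, ha⟩ := hA.conn.1
    exact (hL.insert_sub (this ▸ hAB ha)).2 ha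
  obtain ⟨a₀, ha₀, hta₀⟩ := touch_singleton_left.1 hL.touch
  obtain ⟨a, ha, hta, Q, hQ, hl, hN⟩ := hA.conn.exists_first_link hA.right
    (N := fun a => G.Adj t a) ⟨a₀, ha₀, hta₀⟩
  have hQA : Q ⊆ A := hQ.trans Set.sdiff_subset
  have hcQ : Conn G (insert a Q) := hl.conn_insert
  have hconn : Conn G (insert a Q ∪ insert t L) :=
    hcQ.union_touch hL.conn ⟨a, by simp, t, by simp, hta.symm⟩
  have hBeq := hB _ (Set.union_subset ((Set.insert_subset ha hQA).trans hAB)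
    (hL.insert_sub.trans Set.sdiff_subset)) hconn (hp.mono subset_rfl Set.subset_union_right)
    (hl.touch_insert.mono subset_rfl Set.subset_union_left)
    (hL.link.touch_insert.mono subset_rfl Set.subset_union_right)
  have hAeq : A = insert a Q := by
    refine Set.Subset.antisymm (fun x hx => ?_) (Set.insert_subset ha hQA)
    have : x ∈ insert a Q ∪ insert t L := hBeq ▸ hAB hx
    exact this.elim id fun h => absurd hx (hL.insert_sub h).2
  have hpQ := hA.symm.not_touch ha hQ hl
  have hpa : G.Adj p a := by
    have := hA.left
    rw [hAeq, Set.insert_eq, touch_union_right] at this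
    simpa using this.resolve_right hpQ
  have hjQ : ¬ Touch G {j} Q := fun h => hjA (h.mono subset_rfl hQA)
  refine ⟨a, ∅, Q, insert t L, ?_, hjQ⟩
  exact {
    mem := hAB ha
    subP := Set.empty_subset _
    subQ := fun x hx => ⟨hAB (hQA hx), (hQ hx).2⟩
    subJ := fun x hx => ⟨(hL.insert_sub hx).1, by
      rintro rfl
      exact (hL.insert_sub hx).2 ha⟩
    linkP := .inl ⟨rfl, hpa⟩
    linkQ := hl
    linkJ := .inr ⟨hL.conn, hL.link.touch_insert, a, rfl, t, by simp, hta.symm⟩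
    disjPQ := by simp
    disjPJ := by simp
    disjQJ := Set.disjoint_left.2 fun x hx hx' => (hL.insert_sub hx').2 (hQA hx)
    touchPQ := not_touch_empty_left
    touchPJ := not_touch_empty_left
    touchQJ := by
      rw [Set.insert_eq, touch_union_right]
      rintro (⟨x, hx, _, rfl, h⟩ | h)
      · exact hN x hx h.symm
      · exact hL.not_touch (h.mono hQA subset_rfl)
    pQ := hpQ
    qP := not_touch_empty_right
    jP := not_touch_empty_right
    jQ := fun h => absurd h hjQ
    pJ := fun _ => rfl
    qJ := fun h => absurd h hqL
    pqJ := fun h => hqL h.2 }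

lemma exists_weakTripod_of_arm_not_touch [Finite V]
    (htri : ∀ a b c, G.Adj a b → G.Adj a c → ¬ G.Adj b c)
    {B A L : Set V} {p q j t : V} (hAB : A ⊆ B)
    (hA : Connector G p q A) (hjA : ¬ Touch G {j} A)
    (hL : Arm G A B j t L) (hp : ¬ Touch G {p} (insert t L)) (hq : ¬ Touch G {q} (insert t L)) :
    ∃ s P Q J, WeakTripod G B p q j s P Q J := by
  obtain ⟨a₀, ha₀, hta₀⟩ := touch_singleton_left.1 hL.touch
  obtain ⟨a, ha, hta, P, hP, hlP, hNP⟩ := hA.conn.exists_first_link hA.left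
    (N := fun a => G.Adj t a) ⟨a₀, ha₀, hta₀⟩
  obtain ⟨Q, hQ, hlQ⟩ := hA.conn.exists_link ha hA.right
  obtain ⟨hdPQ, htPQ⟩ := hA.separate ha hP hlP hQ hlQ
  have hPA : P ⊆ A := hP.trans Set.sdiff_subset
  have hQA : Q ⊆ A := hQ.trans Set.sdiff_subset
  have hqP := hA.not_touch ha hP hlP
  have hpQ := hA.symm.not_touch ha hQ hlQ
  have hdL : ∀ {X : Set V}, X ⊆ A → Disjoint X (insert t L) := fun hX =>
    Set.disjoint_left.2 fun x hx hx' => (hL.insert_sub hx').2 (hX hx)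
  have htP : ¬ Touch G P {t} := by
    rintro ⟨x, hx, _, rfl, h⟩
    exact hNP x hx h.symm
  by_cases htQ : Touch G {t} Q
  · obtain ⟨b₀, hb₀, htb₀⟩ := touch_singleton_left.1 htQ
    have hQc : Conn G Q ∧ Touch G {q} Q := by
      rcases hlQ with ⟨rfl, -⟩ | h
      · cases hb₀
      · exact ⟨h.1, h.2.1⟩
    obtain ⟨b, hb, htb, R, hR, hlR, hNR⟩ := hQc.1.exists_first_link hQc.2
      (N := fun a => G.Adj t a) ⟨b₀, hb₀, htb₀⟩
    have hRQ : R ⊆ Q := hR.trans Set.sdiff_subset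
    have hab : ¬ G.Adj a b := htri t a b hta htb
    have hPA' : insert a P ⊆ A := Set.insert_subset ha hPA
    have hRQ' : insert b R ⊆ Q := Set.insert_subset hb hRQ
    have hRA' : insert b R ⊆ A := hRQ'.trans hQA
    have haQ : a ∉ Q := fun h => (hQ h).2 rfl
    have hbP : b ∉ insert a P := by
      rintro (rfl | h)
      · exact haQ hb
      · exact Set.disjoint_left.1 hdPQ h hb
    have hconn : ∀ {X : Set V}, X ⊆ Q → (X.Nonempty → Conn G X ∧ Touch G {q} X) → b ∉ X →
        ¬ Touch G {a} X := by
      intro X hX hXc hbX h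
      have hXne : X.Nonempty := by
        obtain ⟨_, _, x, hx, _⟩ := h
        exact ⟨x, hx⟩
      have := hA.min (insert a P ∪ X) (Set.union_subset hPA' (hX.trans hQA))
        (hlP.conn_insert.union_touch (hXc hXne).1 (h.mono (by simp) subset_rfl))
        (hlP.touch_insert.mono subset_rfl Set.subset_union_left)
        ((hXc hXne).2.mono subset_rfl Set.subset_union_right)
      have hb' : b ∈ insert a P ∪ X := this ▸ hQA hb
      exact hb'.elim hbP hbX
    have htR : ¬ Touch G {t} R := by
      rintro ⟨_, rfl, x, hx, h⟩
      exact hNR x hx h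
    have hne : ∀ {X : Set V}, X ⊆ A → X ⊆ B \ {t} := by
      refine fun hX x hx => ⟨hAB (hX hx), ?_⟩
      rintro rfl
      exact hL.mem.2 (hX hx)
    have hsubL : L ⊆ insert t L := Set.subset_insert _ _
    refine ⟨t, insert a P, insert b R, L, ?_⟩
    exact {
      mem := hL.mem.1
      subP := hne hPA'
      subQ := hne hRA'
      subJ := fun x hx => ⟨(hL.sub hx).1.1, (hL.sub hx).2⟩
      linkP := .inr ⟨hlP.conn_insert, hlP.touch_insert, t, rfl, a, by simp, hta⟩
      linkQ := .inr ⟨hlR.conn_insert, hlR.touch_insert, t, rfl, b, by simp, htb⟩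
      linkJ := hL.link
      disjPQ := by
        rw [Set.disjoint_insert_left]
        exact ⟨fun h => haQ (hRQ' h), hdPQ.mono_right hRQ'⟩
      disjPJ := (hdL hPA').mono_right hsubL
      disjQJ := (hdL hRA').mono_right hsubL
      touchPQ := by
        rw [Set.insert_eq, touch_union_left]
        rintro (h | h)
        · rw [Set.insert_eq, touch_union_right] at h
          rcases h with h | h
          · exact hab (touch_singleton.1 h)
          · refine hconn hRQ (fun hne => ?_) (fun h => (hR h).2 rfl) h
            rcases hlR with ⟨rfl, -⟩ | h
            · exact absurd hne Set.not_nonempty_empty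
            · exact ⟨h.1, h.2.1⟩
        · exact htPQ (h.mono subset_rfl hRQ')
      touchPJ := fun h => hL.not_touch (h.mono hPA' subset_rfl)
      touchQJ := fun h => hL.not_touch (h.mono hRA' subset_rfl)
      pQ := fun h => hpQ (h.mono subset_rfl hRQ')
      qP := by
        intro h
        have := hA.min _ hPA' hlP.conn_insert hlP.touch_insert h
        exact hbP (this ▸ hQA hb)
      jP := fun h => hjA (h.mono subset_rfl hPA')
      jQ := fun h => absurd (h.mono subset_rfl hRA') hjA
      pJ := fun h => absurd (h.mono subset_rfl hsubL) hp
      qJ := fun h => absurd (h.mono subset_rfl hsubL) hq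
      pqJ := fun h => hp (h.1.mono subset_rfl hsubL) }
  · refine ⟨a, P, Q, insert t L, ?_⟩
    exact {
      mem := hAB ha
      subP := fun x hx => ⟨hAB (hP hx).1, (hP hx).2⟩
      subQ := fun x hx => ⟨hAB (hQ hx).1, (hQ hx).2⟩
      subJ := fun x hx => ⟨(hL.insert_sub hx).1, by
        rintro rfl
        exact (hL.insert_sub hx).2 ha⟩
      linkP := hlP
      linkQ := hlQ
      linkJ := .inr ⟨hL.conn, hL.link.touch_insert, a, rfl, t, by simp, hta.symm⟩
      disjPQ := hdPQ
      disjPJ := hdL hPA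
      disjQJ := hdL hQA
      touchPQ := htPQ
      touchPJ := by
        rw [Set.insert_eq, touch_union_right]
        rintro (h | h)
        · exact htP h
        · exact hL.not_touch (h.mono hPA subset_rfl)
      touchQJ := by
        rw [Set.insert_eq, touch_union_right]
        rintro (h | h)
        · exact htQ h.symm
        · exact hL.not_touch (h.mono hQA subset_rfl)
      pQ := hpQ
      qP := hqP
      jP := fun h => hjA (h.mono subset_rfl hPA)
      jQ := fun h => absurd (h.mono subset_rfl hQA) hjA
      pJ := fun h => absurd h hp
      qJ := fun h => absurd h hq
      pqJ := fun h => hp h.1 }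

lemma WeakTripod.mono {B B' : Set V} {p q j s : V} {P Q J : Set V}
    (h : WeakTripod G B p q j s P Q J) (hB : B ⊆ B') : WeakTripod G B' p q j s P Q J :=
  { h with
    mem := hB h.mem
    subP := fun _ hx => ⟨hB (h.subP hx).1, (h.subP hx).2⟩
    subQ := fun _ hx => ⟨hB (h.subQ hx).1, (h.subQ hx).2⟩
    subJ := fun _ hx => ⟨hB (h.subJ hx).1, (h.subJ hx).2⟩ }

lemma exists_weakTripod [Finite V] (htri : ∀ a b c, G.Adj a b → G.Adj a c → ¬ G.Adj b c)
    {B : Set V} {p q j : V} (hB : Conn G B) (hp : Touch G {p} B) (hq : Touch G {q} B)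
    (hj : Touch G {j} B) : ∃ s P Q J, WeakTripod G B p q j s P Q J := by
  have hfin : {B' : Set V | B' ⊆ B ∧ Conn G B' ∧ Touch G {p} B' ∧ Touch G {q} B' ∧
    Touch G {j} B'}.Finite := Set.toFinite _
  obtain ⟨B', ⟨h1, h2, h3, h4, h5⟩, hmin⟩ := hfin.exists_minimal ⟨B, subset_rfl, hB, hp, hq, hj⟩
  have hmin' : MinTouched G p q j B' := fun X ha hb hc hd he =>
    ha.antisymm (hmin ⟨ha.trans h1, hb, hc, hd, he⟩ ha)
  suffices h : ∃ s P Q J, WeakTripod G B' p q j s P Q J by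
    obtain ⟨s, P, Q, J, h⟩ := h
    exact ⟨s, P, Q, J, h.mono h1⟩
  obtain ⟨A, hAB, hA⟩ := exists_connector h2 h3 h4
  by_cases hjA : Touch G {j} A
  · exact exists_weakTripod_of_touch hAB hA hjA
  obtain ⟨t, L, hL⟩ := exists_arm hAB hA.conn.1 h2 h5 hjA
  by_cases hpL : Touch G {p} (insert t L)
  · obtain ⟨s, P, Q, J, h, -⟩ := exists_weakTripod_of_arm_touch hAB hA hjA hmin' hL hpL
    exact ⟨s, P, Q, J, h⟩
  by_cases hqL : Touch G {q} (insert t L)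
  · obtain ⟨s, P, Q, J, h, h'⟩ := exists_weakTripod_of_arm_touch hAB hA.symm hjA
      (fun X ha hb hc hd he => hmin' X ha hb hd hc he) hL hqL
    exact ⟨s, Q, P, J, h.swap h'⟩
  exact exists_weakTripod_of_arm_not_touch htri hAB hA hjA hL hpL hqL

/-- Three induced legs from the terminals `t 0`, `t 1`, `t 2` to `c`; the only further adjacency
is between `t x` and the leg of `t y`. -/
structure Tripod (G : SimpleGraph V) (B : Set V) (t : ℕ → V) (c : V) (L : ℕ → Set V)
    (m x y : ℕ) : Prop where
  mem : c ∈ B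
  shape : (m, x, y) ∈ shapes
  nonempty : ∀ i < 3, (m.testBit i ↔ (L i).Nonempty)
  sub : ∀ i < 3, L i ⊆ B \ {c}
  disj : ∀ i < 3, ∀ k < 3, i ≠ k → Disjoint (L i) (L k)
  not_touch : ∀ i < 3, ∀ k < 3, i ≠ k → ¬ Touch G (L i) (L k)
  leg : ∀ i < 3, (L i = ∅ ∧ G.Adj (t i) c) ∨
    (Conn G (L i) ∧ Touch G {t i} (L i) ∧ Touch G {c} (L i) ∧ ¬ G.Adj (t i) c)
  cross : ∀ i < 3, ∀ k < 3, i ≠ k → (Touch G {t k} (L i) ↔ k = x ∧ i = y)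

lemma WeakTripod.shortcutP {B : Set V} {p q j s : V} {P Q J : Set V}
    (h : WeakTripod G B p q j s P Q J) (hps : G.Adj p s) : WeakTripod G B p q j s ∅ Q J :=
  { h with
    subP := Set.empty_subset _
    linkP := .inl ⟨rfl, hps⟩
    disjPQ := by simp
    disjPJ := by simp
    touchPQ := by simp
    touchPJ := by simp
    qP := by simp
    jP := by simp
    pJ := fun _ => rfl }

lemma WeakTripod.shortcutQ {B : Set V} {p q j s : V} {P Q J : Set V}
    (h : WeakTripod G B p q j s P Q J) (hqs : G.Adj q s) : WeakTripod G B p q j s P ∅ J :=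
  { h with
    subQ := Set.empty_subset _
    linkQ := .inl ⟨rfl, hqs⟩
    disjPQ := by simp
    disjQJ := by simp
    touchPQ := by simp
    touchQJ := by simp
    pQ := by simp
    jQ := fun h => absurd h (by simp)
    qJ := fun _ => rfl }

lemma WeakTripod.shortcutJ {B : Set V} {p q j s : V} {P Q J : Set V}
    (h : WeakTripod G B p q j s P Q J) (hjs : G.Adj j s) : WeakTripod G B p q j s P Q ∅ :=
  { h with
    subJ := Set.empty_subset _
    linkJ := .inl ⟨rfl, hjs⟩
    disjPJ := by simp
    disjQJ := by simp
    touchPJ := by simp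
    touchQJ := by simp
    jQ := fun _ => rfl
    pJ := fun h => absurd h (by simp)
    qJ := fun h => absurd h (by simp)
    pqJ := by simp }

lemma WeakTripod.normalize {B : Set V} {p q j s : V} {P Q J : Set V}
    (h : WeakTripod G B p q j s P Q J) : ∃ P Q J, WeakTripod G B p q j s P Q J ∧
      (G.Adj p s → P = ∅) ∧ (G.Adj q s → Q = ∅) ∧ (G.Adj j s → J = ∅) := by
  obtain ⟨P, h, hP⟩ : ∃ P, WeakTripod G B p q j s P Q J ∧ (G.Adj p s → P = ∅) := by
    by_cases hps : G.Adj p s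
    · exact ⟨∅, h.shortcutP hps, fun _ => rfl⟩
    · exact ⟨P, h, fun h => absurd h hps⟩
  obtain ⟨Q, h, hQ⟩ : ∃ Q, WeakTripod G B p q j s P Q J ∧ (G.Adj q s → Q = ∅) := by
    by_cases hps : G.Adj q s
    · exact ⟨∅, h.shortcutQ hps, fun _ => rfl⟩
    · exact ⟨Q, h, fun h => absurd h hps⟩
  obtain ⟨J, h, hJ⟩ : ∃ J, WeakTripod G B p q j s P Q J ∧ (G.Adj j s → J = ∅) := by
    by_cases hps : G.Adj j s
    · exact ⟨∅, h.shortcutJ hps, fun _ => rfl⟩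
    · exact ⟨J, h, fun h => absurd h hps⟩
  exact ⟨P, Q, J, h, hP, hQ, hJ⟩

lemma Link.leg {p s : V} {P : Set V} (h : Link G p s P) (hP : G.Adj p s → P = ∅) :
    (P = ∅ ∧ G.Adj p s) ∨ (Conn G P ∧ Touch G {p} P ∧ Touch G {s} P ∧ ¬ G.Adj p s) := by
  rcases h with h | ⟨h1, h2, h3⟩
  · exact .inl h
  · refine .inr ⟨h1, h2, h3, fun hps => ?_⟩
    rw [hP hps] at h1
    exact Set.not_nonempty_empty h1.1

/-- The first, second or third of three objects. -/
def pick {α : Type} (a b c : α) (i : ℕ) : α := if i = 0 then a else if i = 1 then b else c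

lemma exists_shape (P Q J : Set V) : ∃ m, (m = 0 ∨ m = 1 ∨ m = 2 ∨ m = 3 ∨ m = 4 ∨ m = 5 ∨ m = 6 ∨
    m = 7) ∧ (m.testBit 0 ↔ P.Nonempty) ∧ (m.testBit 1 ↔ Q.Nonempty) ∧
    (m.testBit 2 ↔ J.Nonempty) := by
  by_cases hP : P.Nonempty <;> by_cases hQ : Q.Nonempty <;> by_cases hJ : J.Nonempty
  · exact ⟨7, by simp, by simp [hP, hQ, hJ, Nat.testBit]⟩
  · exact ⟨3, by simp, by simp [hP, hQ, hJ, Nat.testBit]⟩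
  · exact ⟨5, by simp, by simp [hP, hQ, hJ, Nat.testBit]⟩
  · exact ⟨1, by simp, by simp [hP, hQ, hJ, Nat.testBit]⟩
  · exact ⟨6, by simp, by simp [hP, hQ, hJ, Nat.testBit]⟩
  · exact ⟨2, by simp, by simp [hP, hQ, hJ, Nat.testBit]⟩
  · exact ⟨4, by simp, by simp [hP, hQ, hJ, Nat.testBit]⟩
  · exact ⟨0, by simp, by simp [hP, hQ, hJ, Nat.testBit]⟩

lemma nonempty_of_touch {A B : Set V} (h : Touch G A B) : B.Nonempty := by
  obtain ⟨_, _, b, hb, _⟩ := h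
  exact ⟨b, hb⟩

lemma forall_lt_three {p : ℕ → Prop} (h0 : p 0) (h1 : p 1) (h2 : p 2) : ∀ i < 3, p i := by
  intro i hi
  interval_cases i
  exacts [h0, h1, h2]

lemma WeakTripod.tripod {B : Set V} {p q j s : V} {P Q J : Set V}
    (h : WeakTripod G B p q j s P Q J) (hP : G.Adj p s → P = ∅) (hQ : G.Adj q s → Q = ∅)
    (hJ : G.Adj j s → J = ∅) :
    ∃ m x y, Tripod G B (pick p q j) s (pick P Q J) m x y := by
  obtain ⟨m, hm, hmP, hmQ, hmJ⟩ := exists_shape P Q J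
  have hc : ∃ x y, (m, x, y) ∈ shapes ∧ ¬ (0 = x ∧ 1 = y) ∧ ¬ (1 = x ∧ 0 = y) ∧ ¬ (2 = x ∧ 0 = y) ∧
      (Touch G {j} Q ↔ 2 = x ∧ 1 = y) ∧ (Touch G {p} J ↔ 0 = x ∧ 2 = y) ∧
      (Touch G {q} J ↔ 1 = x ∧ 2 = y) := by
    by_cases h1 : Touch G {j} Q
    · have hJe := h.jQ h1
      subst hJe
      have h2 := nonempty_of_touch h1
      refine ⟨2, 1, ?_, by simp [h1]⟩
      rw [← hmQ] at h2
      have h3 : ¬ m.testBit 2 := hmJ.not.2 Set.not_nonempty_empty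
      rcases hm with rfl | rfl | rfl | rfl | rfl | rfl | rfl | rfl <;>
        first
        | exact absurd h2 (by decide)
        | exact absurd (by decide) h3
        | simp [shapes]
    by_cases h4 : Touch G {p} J
    · have hPe := h.pJ h4
      subst hPe
      have h2 := nonempty_of_touch h4
      have h5 : ¬ Touch G {q} J := fun h5 => h.pqJ ⟨h4, h5⟩
      refine ⟨0, 2, ?_, by simp [h1, h4, h5]⟩
      rw [← hmJ] at h2
      have h3 : ¬ m.testBit 0 := hmP.not.2 Set.not_nonempty_empty
      rcases hm with rfl | rfl | rfl | rfl | rfl | rfl | rfl | rfl <;>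
        first
        | exact absurd h2 (by decide)
        | exact absurd (by decide) h3
        | simp [shapes]
    by_cases h5 : Touch G {q} J
    · have hQe := h.qJ h5
      subst hQe
      have h2 := nonempty_of_touch h5
      refine ⟨1, 2, ?_, by simp [h4, h5]⟩
      rw [← hmJ] at h2
      have h3 : ¬ m.testBit 1 := hmQ.not.2 Set.not_nonempty_empty
      rcases hm with rfl | rfl | rfl | rfl | rfl | rfl | rfl | rfl <;>
        first
        | exact absurd h2 (by decide)
        | exact absurd (by decide) h3
        | simp [shapes]
    · refine ⟨3, 3, ?_, by simp [h1, h4, h5]⟩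
      rcases hm with rfl | rfl | rfl | rfl | rfl | rfl | rfl | rfl <;> simp [shapes]
  obtain ⟨x, y, hs, h01, h10, h20, h21, h02, h12⟩ := hc
  refine ⟨m, x, y, ?_⟩
  exact {
    mem := h.mem
    shape := hs
    nonempty := forall_lt_three hmP hmQ hmJ
    sub := forall_lt_three h.subP h.subQ h.subJ
    disj := forall_lt_three
      (forall_lt_three (fun h => absurd rfl h) (fun _ => h.disjPQ) (fun _ => h.disjPJ))
      (forall_lt_three (fun _ => h.disjPQ.symm) (fun h => absurd rfl h) (fun _ => h.disjQJ))
      (forall_lt_three (fun _ => h.disjPJ.symm) (fun _ => h.disjQJ.symm) (fun h => absurd rfl h))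
    not_touch := forall_lt_three
      (forall_lt_three (fun h => absurd rfl h) (fun _ => h.touchPQ) (fun _ => h.touchPJ))
      (forall_lt_three (fun _ t => h.touchPQ t.symm) (fun h => absurd rfl h) (fun _ => h.touchQJ))
      (forall_lt_three (fun _ t => h.touchPJ t.symm) (fun _ t => h.touchQJ t.symm)
        (fun h => absurd rfl h))
    leg := forall_lt_three (h.linkP.leg hP) (h.linkQ.leg hQ) (h.linkJ.leg hJ)
    cross := forall_lt_three
      (forall_lt_three (fun h => absurd rfl h)
        (fun _ => ⟨fun t => absurd t h.qP, fun t => absurd t h10⟩)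
        (fun _ => ⟨fun t => absurd t h.jP, fun t => absurd t h20⟩))
      (forall_lt_three (fun _ => ⟨fun t => absurd t h.pQ, fun t => absurd t h01⟩)
        (fun h => absurd rfl h) (fun _ => h21))
      (forall_lt_three (fun _ => h02) (fun _ => h12) (fun h => absurd rfl h)) }

lemma exists_tripod [Finite V] (htri : ∀ a b c, G.Adj a b → G.Adj a c → ¬ G.Adj b c)
    {B : Set V} {p q j : V} (hB : Conn G B) (hp : Touch G {p} B) (hq : Touch G {q} B)
    (hj : Touch G {j} B) : ∃ c L m x y, Tripod G B (pick p q j) c L m x y := by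
  obtain ⟨s, P, Q, J, h⟩ := exists_weakTripod htri hB hp hq hj
  obtain ⟨P, Q, J, h, hP, hQ, hJ⟩ := h.normalize
  obtain ⟨m, x, y, h⟩ := h.tripod hP hQ hJ
  exact ⟨s, _, m, x, y, h⟩

namespace Model
variable {n s M : ℕ} {S : ℕ → Set V}

lemma insertNode (h : Model G n s M S) (hn : n < 32) {J : Set V} {T s' : ℕ} (hJ : Conn G J)
    (hd : ∀ i < n, Disjoint (S i) J) (hT : ∀ i < n, (T.testBit i ↔ Touch G J (S i)))
    (hs : ∀ i, s'.testBit i → s.testBit i ∨ (i = n ∧ ∃ a, J = {a})) :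
    Model G (n + 1) s' (addNode M n T) (Function.update S n J) where
  le := hn
  bound := by
    intro i hi k hk
    rw [testBit_addNode hn] at hk
    rcases hk with hk | hk | hk
    · have := h.bound i hi k hk
      omega
    · omega
    · omega
  sing := by
    intro i hi
    rcases hs i hi with hi | ⟨rfl, ha⟩
    · obtain ⟨h1, h2⟩ := h.sing i hi
      refine ⟨by omega, ?_⟩
      rwa [Function.update_of_ne (by omega)]
    · exact ⟨by omega, by rwa [Function.update_self]⟩
  conn := by
    intro i hi
    by_cases hin : i = n
    · subst hin
      rwa [Function.update_self]
    · rw [Function.update_of_ne hin]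
      exact h.conn i (by omega)
  disj := by
    intro i hi k hk hik
    by_cases hin : i = n
    · subst hin
      rw [Function.update_self, Function.update_of_ne hik.symm]
      exact (hd k (by omega)).symm
    · rw [Function.update_of_ne hin]
      by_cases hkn : k = n
      · subst hkn
        rw [Function.update_self]
        exact hd i (by omega)
      · rw [Function.update_of_ne hkn]
        exact h.disj i (by omega) k (by omega) hik
  touch := by
    intro i hi k hk hik
    rw [testBit_addNode hn]
    have hout : ∀ i < 32, ∀ k, i = n ∨ k = n → ¬ (row M i).testBit k := by
      intro i hi k hik hr
      have := h.bound i hi k hr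
      omega
    have hi32 : i < 32 := by omega
    by_cases hin : i = n
    · subst hin
      rw [Function.update_self, Function.update_of_ne hik.symm, ← hT k (by omega)]
      have := hout i hi32 k (.inl rfl)
      constructor
      · exact fun h => .inr (.inl ⟨rfl, by omega, h⟩)
      · rintro (h | h | h)
        · exact absurd h this
        · exact h.2.2
        · omega
    · rw [Function.update_of_ne hin]
      by_cases hkn : k = n
      · subst hkn
        rw [Function.update_self, touch_comm, ← hT i (by omega)]
        have := hout i hi32 k (.inr rfl)
        constructor
        · exact fun h => .inr (.inr ⟨rfl, by omega, h⟩)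
        · rintro (h | h | h)
          · exact absurd h this
          · omega
          · exact h.2.2
      · rw [Function.update_of_ne hkn, h.touch i (by omega) k (by omega) hik]
        constructor
        · exact fun h => .inl h
        · rintro (h | h | h)
          · exact h
          · omega
          · omega

lemma shrink (h : Model G n s M S) {b : ℕ} {c : V} (hb : b < n) (hc : c ∈ S b) {M' s' : ℕ}
    (hs : ∀ i, s'.testBit i → s.testBit i ∨ i = b)
    (hM : ∀ i < 32, ∀ k, ((row M' i).testBit k ↔ (row M i).testBit k ∧ (i = b → Touch G {c} (S k)) ∧
      (k = b → Touch G {c} (S i)))) :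
    Model G n s' M' (Function.update S b {c}) where
  le := h.le
  bound := fun i hi k hk => h.bound i hi k ((hM i hi k).1 hk).1
  sing := by
    intro i hi
    by_cases hib : i = b
    · subst hib
      exact ⟨hb, c, by rw [Function.update_self]⟩
    · rw [Function.update_of_ne hib]
      exact h.sing i ((hs i hi).resolve_right hib)
  conn := by
    intro i hi
    by_cases hib : i = b
    · subst hib
      rw [Function.update_self]
      exact conn_singleton c
    · rw [Function.update_of_ne hib]
      exact h.conn i hi
  disj := by
    intro i hi k hk hik
    by_cases hib : i = b
    · subst hib
      rw [Function.update_self, Function.update_of_ne hik.symm]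
      exact (h.disj i hi k hk hik).mono_left (Set.singleton_subset_iff.2 hc)
    · rw [Function.update_of_ne hib]
      by_cases hkb : k = b
      · subst hkb
        rw [Function.update_self]
        exact (h.disj i hi k hk hik).mono_right (Set.singleton_subset_iff.2 hc)
      · rw [Function.update_of_ne hkb]
        exact h.disj i hi k hk hik
  touch := by
    intro i hi k hk hik
    rw [hM i (hi.trans_le h.le), ← h.touch i hi k hk hik]
    by_cases hib : i = b
    · subst hib
      rw [Function.update_self, Function.update_of_ne hik.symm]
      constructor
      · exact fun t => ⟨t.mono (Set.singleton_subset_iff.2 hc) subset_rfl, fun _ => t,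
          fun h => absurd h.symm hik⟩
      · exact fun t => t.2.1 rfl
    · rw [Function.update_of_ne hib]
      by_cases hkb : k = b
      · subst hkb
        rw [Function.update_self]
        constructor
        · exact fun t => ⟨t.mono subset_rfl (Set.singleton_subset_iff.2 hc),
            fun h => absurd h hik, fun _ => t.symm⟩
        · exact fun t => (t.2.2 rfl).symm
      · rw [Function.update_of_ne hkb]
        exact ⟨fun t => ⟨t, fun h => absurd h hib, fun h => absurd h hkb⟩, fun t => t.1⟩

end Model

/-- The nodes `N, …, n - 1` of the model are legs with index less than `k`. -/
structure LegModel (G : SimpleGraph V) (N k : ℕ) (S₀ L : ℕ → Set V) (n s M : ℕ) : Prop where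
  le : n ≤ N + k
  ge : N ≤ n
  model : ∃ S, Model G n s M S ∧ (∀ i < N, S i = S₀ i) ∧
    ∀ i, N ≤ i → i < n → ∃ l < k, S i = L l

lemma LegModel.step {N k n s M T : ℕ} {S₀ L : ℕ → Set V} (h : LegModel G N k S₀ L n s M)
    (hk : N + k < 32) {c : Bool} {f : ℕ → ℕ → Bool} (hc : c = true → Conn G (L k))
    (hdisj : ∀ l < k, Disjoint (L l) (L k)) (hnt : ∀ l < k, ¬ Touch G (L k) (L l))
    (hT : ∀ i, T.testBit i → i < N) (hd : ∀ i < N, Disjoint (S₀ i) (L k))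
    (hT' : c = true → ∀ i < N, (T.testBit i ↔ Touch G (L k) (S₀ i)))
    (hf : legStep c M n T f = true) :
    ∃ n' M', LegModel G N (k + 1) S₀ L n' s M' ∧ f M' n' = true := by
  obtain ⟨S, hS, hS1, hS2⟩ := h.model
  have hle := h.le
  have hge := h.ge
  cases c
  · exact ⟨n, M, ⟨by omega, h.ge, S, hS, hS1, fun i h1 h2 => by
      obtain ⟨l, hl, hl'⟩ := hS2 i h1 h2
      exact ⟨l, by omega, hl'⟩⟩, hf⟩
  · refine ⟨n + 1, addNode M n T, ⟨by omega, by omega, Function.update S n (L k),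
      hS.insertNode (s' := s) (by omega) (hc rfl) ?_ ?_ (fun i hi => .inl hi), ?_, ?_⟩, hf⟩
    · intro i hi
      rcases lt_or_ge i N with hi' | hi'
      · rw [hS1 i hi']
        exact hd i hi'
      · obtain ⟨l, hl, hl'⟩ := hS2 i hi' hi
        rw [hl']
        exact hdisj l hl
    · intro i hi
      rcases lt_or_ge i N with hi' | hi'
      · rw [hS1 i hi']
        exact hT' rfl i hi'
      · obtain ⟨l, hl, hl'⟩ := hS2 i hi' hi
        rw [hl']
        exact ⟨fun h => absurd (hT i h) (by omega), fun h => absurd h (hnt l hl)⟩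
    · intro i hi
      rw [Function.update_of_ne (by omega)]
      exact hS1 i hi
    · intro i h1 h2
      by_cases hin : i = n
      · subst hin
        exact ⟨k, by omega, by rw [Function.update_self]⟩
      · rw [Function.update_of_ne hin]
        obtain ⟨l, hl, hl'⟩ := hS2 i h1 (by omega)
        exact ⟨l, by omega, hl'⟩

lemma select_eq_pick (i a b c : ℕ) : select i a b c = pick a b c i := by
  unfold select pick
  rcases i with _ | _ | i <;> rfl

lemma testBit_delIf {c : Bool} {M i j k l : ℕ} (hi : i < 32) (hj : j < 32) :
    (row (delIf c M i j) k).testBit l ↔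
      (row M k).testBit l ∧ (c = true → ¬ (k = i ∧ l = j) ∧ ¬ (k = j ∧ l = i)) := by
  cases c
  · simp [delIf]
  · simp [delIf, testBit_delEdge hi hj]

lemma testBit_legMask {B p q j x y i k : ℕ} :
    (legMask B p q j x y i).testBit k ↔ k = B ∨ k = pick p q j i ∨ (y = i ∧ k = pick p q j x) := by
  unfold legMask
  rw [select_eq_pick, select_eq_pick]
  cases h : Nat.beq y i
  · have := Nat.ne_of_beq_eq_false h
    rw [cond_false, testBit_lor, testBit_lor, testBit_bit, testBit_bit, Nat.zero_testBit]
    grind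
  · have := Nat.eq_of_beq_eq_true h
    rw [cond_true, testBit_lor, testBit_lor, testBit_bit, testBit_bit, testBit_bit]
    grind

lemma Model.resolve_sound [Finite V] {n s M : ℕ} {S : ℕ → Set V} (hG : Core G)
    (h : Model G n s M S) {b p q j : ℕ} (hn : n ≤ 28) (hb : b < n) (hp : s.testBit p)
    (hq : s.testBit q) (hj : s.testBit j) (hpq : p ≠ q) (hpj : p ≠ j) (hqj : q ≠ j)
    (hrow : ∀ i, (row M b).testBit i ↔ i = p ∨ i = q ∨ i = j) {f : ℕ → ℕ → Bool}
    (hf : ∀ v ∈ shapes, resolve M n b p q j v.1 v.2.1 v.2.2 f = true) :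
    ∃ n' M' S', Model G n' (Nat.lor s (bit b)) M' S' ∧ f M' n' = true := by
  obtain ⟨hpn, a₀, ha₀⟩ := h.sing p hp
  obtain ⟨hqn, a₁, ha₁⟩ := h.sing q hq
  obtain ⟨hjn, a₂, ha₂⟩ := h.sing j hj
  have htouch : ∀ {i a}, (row M b).testBit i → S i = {a} → Touch G {a} (S b) := by
    intro i a hi ha
    rw [← ha]
    exact (h.touch_of hb hi).symm
  have hpb := (hrow p).2 (.inl rfl)
  have hqb := (hrow q).2 (.inr (.inl rfl))
  have hjb := (hrow j).2 (.inr (.inr rfl))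
  obtain ⟨c, L, m, x, y, hL⟩ := exists_tripod hG.tri (h.conn b hb) (htouch hpb ha₀)
    (htouch hqb ha₁) (htouch hjb ha₂)
  have hres := hf _ hL.shape
  set N := pick p q j with hN
  set t := pick a₀ a₁ a₂ with ht
  have hNn : ∀ i < 3, N i < n := forall_lt_three hpn hqn hjn
  have hNb : ∀ i < 3, N i ≠ b := forall_lt_three (h.bound b (by omega) p hpb).2.2.symm
    (h.bound b (by omega) q hqb).2.2.symm (h.bound b (by omega) j hjb).2.2.symm
  have hSN : ∀ i < 3, S (N i) = {t i} := forall_lt_three ha₀ ha₁ ha₂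
  have hNinj : ∀ i < 3, ∀ k < 3, N i = N k → i = k := forall_lt_three
    (forall_lt_three (fun _ => rfl) (fun h => absurd h hpq) (fun h => absurd h hpj))
    (forall_lt_three (fun h => absurd h.symm hpq) (fun _ => rfl) (fun h => absurd h hqj))
    (forall_lt_three (fun h => absurd h.symm hpj) (fun h => absurd h.symm hqj) (fun _ => rfl))
  have hrow' : ∀ i, (row M b).testBit i → ∃ l < 3, i = N l := by
    intro i hi
    rcases (hrow i).1 hi with rfl | rfl | rfl
    exacts [⟨0, by omega, rfl⟩, ⟨1, by omega, rfl⟩, ⟨2, by omega, rfl⟩]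
  have hm : ∀ i < 3, (m.testBit i = true ↔ ¬ Touch G {c} (S (N i))) := by
    intro i hi
    rw [hL.nonempty i hi, hSN i hi, touch_singleton]
    rcases hL.leg i hi with ⟨h1, h2⟩ | ⟨h1, -, -, h2⟩
    · simp [h1, h2.symm]
    · exact ⟨fun _ h => h2 h.symm, fun _ => h1.1⟩
  set M₁ := delIf (Nat.testBit m 0) (delIf (Nat.testBit m 1) (delIf (Nat.testBit m 2) M b j) b q)
    b p with hM₁
  have hM₁b : ∀ k l, (row M₁ k).testBit l ↔ (row M k).testBit l ∧
      ∀ i < 3, m.testBit i = true → ¬ (k = b ∧ l = N i) ∧ ¬ (k = N i ∧ l = b) := by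
    intro k l
    rw [hM₁, testBit_delIf (by omega) (by omega), testBit_delIf (by omega) (by omega),
      testBit_delIf (by omega) (by omega)]
    constructor
    · rintro ⟨⟨⟨h1, h2⟩, h3⟩, h4⟩
      exact ⟨h1, forall_lt_three h4 h3 h2⟩
    · rintro ⟨h1, h2⟩
      exact ⟨⟨⟨h1, h2 2 (by omega)⟩, h2 1 (by omega)⟩, h2 0 (by omega)⟩
  have hmodel : Model G n (Nat.lor s (bit b)) M₁ (Function.update S b {c}) := by
    refine h.shrink hb hL.mem ?_ ?_
    · intro i hi
      rw [testBit_lor, testBit_bit] at hi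
      exact (by rw [Bool.or_eq_true, decide_eq_true_eq] at hi; exact hi.imp id Eq.symm :
        s.testBit i = true ∨ i = b)
    · intro k hk l
      rw [hM₁b]
      refine and_congr_right fun hkl => ⟨fun hkl' => ⟨?_, ?_⟩, fun hkl' i hi hmi => ⟨?_, ?_⟩⟩
      · rintro rfl
        obtain ⟨i, hi, rfl⟩ := hrow' l hkl
        by_contra hne
        exact (hkl' i hi ((hm i hi).2 hne)).1 ⟨rfl, rfl⟩
      · rintro rfl
        have hkn := (h.bound k hk l hkl).1
        obtain ⟨i, hi, rfl⟩ := hrow' k (h.symm hkn hkl)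
        by_contra hne
        exact (hkl' i hi ((hm i hi).2 hne)).2 ⟨rfl, rfl⟩
      · rintro ⟨rfl, rfl⟩
        exact (hm i hi).1 hmi (hkl'.1 rfl)
      · rintro ⟨rfl, rfl⟩
        exact (hm i hi).1 hmi (hkl'.2 rfl)
  have hx : ∀ i < 3, i = y → x < 3 := by
    have := hL.shape
    simp only [shapes, List.mem_cons, Prod.mk.injEq, List.not_mem_nil, or_false] at this
    intro i hi hiy
    omega
  have hxy : x ≠ y ∨ 3 ≤ y := by
    have := hL.shape
    simp only [shapes, List.mem_cons, Prod.mk.injEq, List.not_mem_nil, or_false] at this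
    omega
  have hmask : ∀ i < 3, ∀ k, (legMask b p q j x y i).testBit k → k < n := by
    intro i hi k hk
    rw [testBit_legMask] at hk
    rcases hk with rfl | rfl | ⟨h1, rfl⟩
    · exact hb
    · exact hNn i hi
    · exact hNn x (hx i hi h1.symm)
  have hLS : ∀ i < 3, L i ⊆ S b := fun i hi => (hL.sub i hi).trans Set.sdiff_subset
  have hd : ∀ i < 3, ∀ k < n, Disjoint (Function.update S b {c} k) (L i) := by
    intro i hi k hk
    by_cases hkb : k = b
    · subst hkb
      rw [Function.update_self, Set.disjoint_singleton_left]
      exact fun h => (hL.sub i hi h).2 rfl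
    · rw [Function.update_of_ne hkb]
      exact (h.disj k hk b hb hkb).mono_right (hLS i hi)
  have hT : ∀ i < 3, m.testBit i = true → ∀ k < n, ((legMask b p q j x y i).testBit k ↔
      Touch G (L i) (Function.update S b {c} k)) := by
    intro i hi hmi k hk
    rw [testBit_legMask]
    have hne := (hL.nonempty i hi).1 hmi
    obtain ⟨-, h1, h2, -⟩ := (hL.leg i hi).resolve_left (fun h => hne.ne_empty h.1)
    by_cases hkb : k = b
    · subst hkb
      rw [Function.update_self]
      exact ⟨fun _ => h2.symm, fun _ => .inl rfl⟩
    rw [Function.update_of_ne hkb]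
    constructor
    · rintro (h | rfl | ⟨rfl, rfl⟩)
      · exact absurd h hkb
      · change Touch G (L i) (S (N i))
        rw [hSN i hi]
        exact h1.symm
      · change Touch G (L y) (S (N x))
        rw [hSN x (hx _ hi rfl)]
        exact ((hL.cross y hi x (hx _ hi rfl) (fun h => by omega)).2 ⟨rfl, rfl⟩).symm
    · intro ht
      have hbk := (h.touch b hb k hk (Ne.symm hkb)).1 (ht.mono (hLS i hi) subset_rfl)
      obtain ⟨l, hl, rfl⟩ := hrow' k hbk
      by_cases hil : i = l
      · subst hil
        exact .inr (.inl rfl)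
      · rw [hSN l hl] at ht
        obtain ⟨rfl, rfl⟩ := (hL.cross i hi l hl hil).1 ht.symm
        exact .inr (.inr ⟨rfl, rfl⟩)
  have hconn : ∀ i < 3, m.testBit i = true → Conn G (L i) := by
    intro i hi hmi
    have hne := (hL.nonempty i hi).1 hmi
    exact ((hL.leg i hi).resolve_left (fun h => hne.ne_empty h.1)).1
  have hleg : ∀ i, i < 3 → ∀ M' n' g, LegModel G n i (Function.update S b {c}) L n'
      (Nat.lor s (bit b)) M' → legStep (Nat.testBit m i) M' n' (legMask b p q j x y i) g = true →
      ∃ n'' M'', LegModel G n (i + 1) (Function.update S b {c}) L n'' (Nat.lor s (bit b)) M'' ∧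
        g M'' n'' = true := by
    intro i hi M' n' g hM hg
    refine hM.step (by omega) (hconn i hi) (fun l hl => hL.disj l (by omega) i hi (by omega))
      (fun l hl => hL.not_touch i hi l (by omega) (by omega)) (hmask i hi) (hd i hi) (hT i hi) hg
  have h0 : LegModel G n 0 (Function.update S b {c}) L n (Nat.lor s (bit b)) M₁ :=
    ⟨le_rfl, le_rfl, _, hmodel, fun _ _ => rfl, fun i h1 h2 => by omega⟩
  obtain ⟨n₁, M₂, h1, hres⟩ := hleg 0 (by omega) _ _ _ h0 hres
  obtain ⟨n₂, M₃, h2, hres⟩ := hleg 1 (by omega) _ _ _ h1 hres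
  obtain ⟨n₃, M₄, h3, hres⟩ := hleg 2 (by omega) _ _ _ h2 hres
  obtain ⟨S', hS', -⟩ := h3.model
  exact ⟨_, _, _, hS', hres⟩

def HasModel (G : SimpleGraph V) (K : Pat) : Prop := ∃ S, Model G K.n K.s K.M S

lemma Model.refutesTree_sound [Finite V] (hG : Core G) {maps : List (Pat × ℕ)} {cands : List ℕ}
    {j : ℕ} (hmaps : ∀ c ∈ maps, c.1.Valid) {l : List (ℕ × ℕ × ℕ)} {n s M : ℕ} {S : ℕ → Set V}
    (h : Model G n s M S) (hr : refutesTree maps cands j l M n s = true) :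
    ∃ c ∈ maps, HasModel G c.1 := by
  have base : ∀ {n s M : ℕ} {S : ℕ → Set V}, Model G n s M S →
      (small M n s || anyList (refutes M n s) cands ||
      anyList (fun c => contracts M n s c.1 c.2) maps) = true → ∃ c ∈ maps, HasModel G c.1 := by
    intro n s M S h hb
    rw [h.not_small hG, Bool.false_or, Bool.or_eq_true] at hb
    rcases hb with hb | hb
    · obtain ⟨c, -, hc⟩ := anyList_eq_true hb
      rw [h.not_refutes hG.bypass] at hc
      exact absurd hc Bool.false_ne_true
    · obtain ⟨c, hc, hc'⟩ := anyList_eq_true hb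
      exact ⟨c, hc, _, h.of_contracts (hmaps c hc) hc'⟩
  induction l generalizing n s M S with
  | nil => exact base h hr
  | cons a l ih =>
    change (small M n s || anyList (refutes M n s) cands ||
      anyList (fun c => contracts M n s c.1 c.2) maps ||
      (Nat.ble n 28 && Nat.ble (Nat.add a.1 1) n && inner n s a.2.1 && inner n s a.2.2 &&
        inner n s j && distinct a.2.1 a.2.2 j &&
        Nat.beq (row M a.1) (Nat.lor (Nat.lor (bit a.2.1) (bit a.2.2)) (bit j)) &&
        allList (fun v => resolve M n a.1 a.2.1 a.2.2 j v.1 v.2.1 v.2.2 fun M n =>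
          refutesTree maps cands j l M n (Nat.lor s (bit a.1))) shapes)) = true at hr
    rw [Bool.or_eq_true] at hr
    rcases hr with hr | hr
    · exact base h hr
    simp only [Bool.and_eq_true, inner] at hr
    obtain ⟨⟨⟨⟨⟨⟨⟨h1, h2⟩, -, hp⟩, -, hq⟩, -, hj⟩, hd⟩, hrow⟩, hall⟩ := hr
    have hd' : a.2.1 ≠ a.2.2 ∧ a.2.1 ≠ j ∧ a.2.2 ≠ j := by
      unfold distinct at hd
      refine ⟨?_, ?_, ?_⟩ <;> intro he <;> simp [he] at hd
    obtain ⟨n', M', S', hS', hr'⟩ := h.resolve_sound hG (b := a.1)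
      (Nat.le_of_ble_eq_true h1) (Nat.le_of_ble_eq_true h2) hp hq hj hd'.1 hd'.2.1 hd'.2.2
      (fun i => by
        rw [Nat.eq_of_beq_eq_true hrow, testBit_lor, testBit_lor, testBit_bit, testBit_bit,
          testBit_bit]
        simp only [Bool.or_eq_true, decide_eq_true_eq]
        grind) (allList_eq_true hall)
    exact ih hS' hr'

lemma exists_mask (n : ℕ) (P : ℕ → Prop) : ∃ T : ℕ, ∀ i, T.testBit i ↔ i < n ∧ P i := by
  induction n with
  | zero => exact ⟨0, by simp⟩
  | succ n ih =>
    obtain ⟨T, hT⟩ := ih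
    by_cases hn : P n
    · refine ⟨Nat.lor T (bit n), fun i => ?_⟩
      rw [testBit_lor, testBit_bit, Bool.or_eq_true, decide_eq_true_eq, hT]
      grind
    · refine ⟨T, fun i => ?_⟩
      rw [hT]
      grind

/-- The mask of the nodes touched by `J`. -/
noncomputable def attach (G : SimpleGraph V) (n : ℕ) (S : ℕ → Set V) (J : Set V) : ℕ :=
  Classical.choose (exists_mask n fun i => Touch G J (S i))

lemma testBit_attach {n : ℕ} {S : ℕ → Set V} {J : Set V} {i : ℕ} :
    (attach G n S J).testBit i ↔ i < n ∧ Touch G J (S i) :=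
  Classical.choose_spec (exists_mask n fun i => Touch G J (S i)) i

lemma attach_union {n : ℕ} {S : ℕ → Set V} {I J : Set V} :
    attach G n S (I ∪ J) = Nat.lor (attach G n S I) (attach G n S J) := by
  refine Nat.eq_of_testBit_eq fun i => Bool.eq_iff_iff.2 ?_
  rw [testBit_lor, Bool.or_eq_true, testBit_attach, testBit_attach, testBit_attach,
    touch_union_left, and_or_left]

namespace Model
variable {n s M : ℕ} {S : ℕ → Set V}

lemma absorb (h : Model G n s M S) {b : ℕ} {J : Set V} (hb : b < n) (hsb : s.testBit b = false)
    (hJ : Conn G J) (hd : ∀ i < n, Disjoint (S i) J) (hT : Touch G J (S b))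
    (hrow : ∀ i < n, Touch G J (S i) → i = b ∨ (row M b).testBit i) :
    Model G n s M (Function.update S b (S b ∪ J)) where
  le := h.le
  bound := h.bound
  sing := by
    intro i hi
    rw [Function.update_of_ne (by rintro rfl; simp [hsb] at hi)]
    exact h.sing i hi
  conn := by
    intro i hi
    by_cases hib : i = b
    · subst hib
      rw [Function.update_self]
      exact (h.conn i hi).union_touch hJ hT.symm
    · rw [Function.update_of_ne hib]
      exact h.conn i hi
  disj := by
    intro i hi k hk hik
    by_cases hib : i = b
    · subst hib
      rw [Function.update_self, Function.update_of_ne hik.symm, Set.disjoint_union_left]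
      exact ⟨h.disj i hi k hk hik, (hd k hk).symm⟩
    · rw [Function.update_of_ne hib]
      by_cases hkb : k = b
      · subst hkb
        rw [Function.update_self, Set.disjoint_union_right]
        exact ⟨h.disj i hi k hk hik, hd i hi⟩
      · rw [Function.update_of_ne hkb]
        exact h.disj i hi k hk hik
  touch := by
    intro i hi k hk hik
    rw [← h.touch i hi k hk hik]
    have key : ∀ i < n, i ≠ b → (Touch G (S b ∪ J) (S i) ↔ Touch G (S b) (S i)) := by
      intro i hi hib
      rw [touch_union_left, or_iff_left_iff_imp]
      exact fun ht => (h.touch b hb i hi (Ne.symm hib)).2 ((hrow i hi ht).resolve_left hib)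
    by_cases hib : i = b
    · subst hib
      rw [Function.update_self, Function.update_of_ne hik.symm]
      exact key k hk hik.symm
    · rw [Function.update_of_ne hib]
      by_cases hkb : k = b
      · subst hkb
        rw [Function.update_self, touch_comm, key i hi hib, touch_comm]
      · rw [Function.update_of_ne hkb]

end Model

noncomputable def size (n : ℕ) (S : ℕ → Set V) : ℕ := ∑ i ∈ Finset.range n, (S i).ncard

/-- A model of `K` with as many vertices as possible. -/
structure MaxModel (G : SimpleGraph V) (K : Pat) (S : ℕ → Set V) : Prop where
  model : Model G K.n K.s K.M S
  max : ∀ S', Model G K.n K.s K.M S' → size K.n S' ≤ size K.n S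

lemma HasModel.exists_max [Finite V] {K : Pat} (h : HasModel G K) : ∃ S, MaxModel G K S := by
  have hbdd : ∃ N, ∀ S, Model G K.n K.s K.M S → size K.n S ≤ N := by
    refine ⟨K.n * Nat.card V, fun S _ => ?_⟩
    refine (Finset.sum_le_card_nsmul _ _ _ fun i _ => Set.ncard_le_card (S i)).trans ?_
    simp
  obtain ⟨N, hN⟩ := hbdd
  obtain ⟨S₀, h₀⟩ := h
  by_contra! hne
  have : ∀ m, ∃ S, Model G K.n K.s K.M S ∧ m ≤ size K.n S := by
    intro m
    induction m with
    | zero => exact ⟨S₀, h₀, Nat.zero_le _⟩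
    | succ m ih =>
      obtain ⟨S, hS, hm⟩ := ih
      by_contra! hlt
      exact hne S ⟨hS, fun S' hS' => by have := hlt S' hS'; omega⟩
  obtain ⟨S, hS, hlt⟩ := this (N + 1)
  have := hN S hS
  omega

structure Certificate.Valid (c : Certificate) (K : Pat) : Prop where
  le : K.n ≤ 30
  maps : ∀ m ∈ c.maps, m.1.Valid
  blob : ∀ b ∈ c.blobs, b.1 < K.n ∧ K.s.testBit b.1 = false ∧ K.s.testBit b.2.1 ∧
    K.s.testBit b.2.2 ∧ row K.M b.1 = Nat.lor (bit b.2.1) (bit b.2.2)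

/-- The masks considered by `onTerminals`. -/
def Terminals (K : Pat) (c : Certificate) (T : ℕ) : Prop :=
  (∃ i < K.n, K.s.testBit i ∧ T = bit i) ∨
    ∃ b ∈ c.blobs, T = Nat.lor (bit b.2.1) (bit b.2.2)

lemma onTerminals_sound {c : Certificate} {f : ℕ → Bool} {T : ℕ}
    (hf : onTerminals K c f = true) (hT : Terminals K c T) : f T = true := by
  unfold onTerminals at hf
  rw [Bool.and_eq_true] at hf
  rcases hT with ⟨i, hi, hs, rfl⟩ | ⟨b, hb, rfl⟩
  · have := allBelow_eq_true hf.1 i hi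
    rwa [hs, cond_true] at this
  · exact allList_eq_true hf.2 b hb

lemma isLocal_cases {c : Certificate} {T : ℕ} (h : isLocal c T = true) :
    (∃ i, ∀ k, T.testBit k → k = i) ∨
      ∃ b ∈ c.blobs, ∀ k, T.testBit k → k = b.1 ∨ k = b.2.1 ∨ k = b.2.2 := by
  unfold isLocal at h
  rw [Bool.or_eq_true] at h
  rcases h with h | h
  · refine .inl ⟨T.log2, fun k hk => ?_⟩
    have := diff_eq_zero.1 (Nat.eq_of_beq_eq_true h) k hk
    rw [testBit_bit, decide_eq_true_eq] at this
    exact this.symm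
  · obtain ⟨b, hb, h⟩ := anyList_eq_true h
    refine .inr ⟨b, hb, fun k hk => ?_⟩
    have := diff_eq_zero.1 (Nat.eq_of_beq_eq_true h) k hk
    rw [branchMask, testBit_lor, testBit_lor, testBit_bit, testBit_bit, testBit_bit] at this
    simp only [Bool.or_eq_true, decide_eq_true_eq] at this
    grind

namespace MaxModel
variable {K : Pat} {S : ℕ → Set V}

lemma not_absorb [Finite V] (h : MaxModel G K S) {b : ℕ} {J : Set V} (hb : b < K.n)
    (hsb : K.s.testBit b = false) (hJ : Conn G J) (hd : ∀ i < K.n, Disjoint (S i) J)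
    (hT : Touch G J (S b)) (hrow : ∀ i < K.n, Touch G J (S i) → i = b ∨ (row K.M b).testBit i) :
    False := by
  have h1 := h.max _ (h.model.absorb hb hsb hJ hd hT hrow)
  have h2 : size K.n S < size K.n (Function.update S b (S b ∪ J)) := by
    refine Finset.sum_lt_sum (fun i hi => ?_) ⟨b, Finset.mem_range.2 hb, ?_⟩
    · by_cases hib : i = b
      · subst hib
        rw [Function.update_self]
        exact Set.ncard_le_ncard Set.subset_union_left (Set.toFinite _)
      · rw [Function.update_of_ne hib]
    · rw [Function.update_self, Set.ncard_union_eq (hd b hb)]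
      have := (Set.ncard_pos (Set.toFinite J)).2 hJ.1
      omega
  omega

lemma terminals [Finite V] (h : MaxModel G K S) {c : Certificate} (hc : c.Valid K) {J : Set V}
    (hJ : Conn G J) (hd : ∀ i < K.n, Disjoint (S i) J)
    (hl : isLocal c (attach G K.n S J) = true) (hne : ∃ i < K.n, Touch G J (S i)) :
    Terminals K c (attach G K.n S J) := by
  obtain ⟨i₀, hi₀, ht₀⟩ := hne
  have h0 := testBit_attach.2 ⟨hi₀, ht₀⟩
  have single : ∀ i, (∀ k, (attach G K.n S J).testBit k → k = i) →
      Terminals K c (attach G K.n S J) := by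
    intro i hi
    obtain rfl := hi _ h0
    cases hs : K.s.testBit i₀
    · exact (h.not_absorb hi₀ hs hJ hd ht₀
        fun k hk ht => .inl (hi k (testBit_attach.2 ⟨hk, ht⟩))).elim
    · refine .inl ⟨i₀, hi₀, hs, Nat.eq_of_testBit_eq fun k => Bool.eq_iff_iff.2 ?_⟩
      rw [testBit_bit, decide_eq_true_eq]
      exact ⟨fun hk => (hi k hk).symm, fun hk => hk ▸ h0⟩
  rcases isLocal_cases hl with ⟨i, hi⟩ | ⟨⟨b, p, q⟩, hb, hsub⟩
  · exact single i hi
  obtain ⟨hbn, hsb, -, -, hrow⟩ := hc.blob _ hb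
  dsimp only at *
  have hnb : ¬ (attach G K.n S J).testBit b := by
    intro ht
    refine h.not_absorb hbn hsb hJ hd (testBit_attach.1 ht).2 fun i hi hti => ?_
    rw [hrow, testBit_lor, testBit_bit, testBit_bit, Bool.or_eq_true, decide_eq_true_eq,
      decide_eq_true_eq]
    have := hsub i (testBit_attach.2 ⟨hi, hti⟩)
    grind
  by_cases hp : (attach G K.n S J).testBit p
  · by_cases hq : (attach G K.n S J).testBit q
    · refine .inr ⟨_, hb, Nat.eq_of_testBit_eq fun k => Bool.eq_iff_iff.2 ?_⟩
      rw [testBit_lor, testBit_bit, testBit_bit, Bool.or_eq_true, decide_eq_true_eq,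
        decide_eq_true_eq]
      grind
    · exact single p (by grind)
  · exact single q (by grind)

end MaxModel

lemma testBit_nearRow {M n s i k : ℕ} (h : (nearRow M n s i).testBit k) :
    k < n ∧ s.testBit k ∧ i ≠ k ∧ ((row M i).testBit k ∨
      ∃ l, (row M i).testBit l ∧ (row M k).testBit l ∧ s.testBit l) := by
  induction n with
  | zero =>
    change Nat.testBit 0 k = true at h
    simp at h
  | succ n ih =>
    have ih' : (nearRow M n s i).testBit k → k < n + 1 ∧ s.testBit k ∧ i ≠ k ∧
        ((row M i).testBit k ∨
          ∃ l, (row M i).testBit l ∧ (row M k).testBit l ∧ s.testBit l) := by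
      intro h
      obtain ⟨h1, h2⟩ := ih h
      exact ⟨by omega, h2⟩
    change (bif Nat.testBit s n then bif Nat.beq i n then nearRow M n s i else
      bif Nat.testBit (row M i) n then Nat.lor (nearRow M n s i) (bit n) else
      bif Nat.beq (Nat.land (Nat.land (row M i) (row M n)) s) 0 then nearRow M n s i
      else Nat.lor (nearRow M n s i) (bit n) else nearRow M n s i).testBit k = true at h
    cases hs : s.testBit n
    · rw [hs, cond_false] at h
      exact ih' h
    cases hin : Nat.beq i n
    · have hin' := ne_of_beq hin
      rw [hs, hin, cond_true, cond_false] at h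
      cases hr : (row M i).testBit n
      · rw [hr, cond_false] at h
        cases hz : Nat.beq (Nat.land (Nat.land (row M i) (row M n)) s) 0
        · rw [hz, cond_false, testBit_lor, Bool.or_eq_true, testBit_bit, decide_eq_true_eq] at h
          rcases h with h | rfl
          · exact ih' h
          · obtain ⟨l, hl, hl'⟩ := land_ne_zero.1 (ne_of_beq hz)
            rw [testBit_land, Bool.and_eq_true] at hl
            exact ⟨by omega, hs, hin', .inr ⟨l, hl.1, hl.2, hl'⟩⟩
        · rw [hz, cond_true] at h
          exact ih' h
      · rw [hr, cond_true, testBit_lor, Bool.or_eq_true, testBit_bit, decide_eq_true_eq] at h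
        rcases h with h | rfl
        · exact ih' h
        · exact ⟨by omega, hs, hin', .inl hr⟩
    · rw [hs, hin, cond_true, cond_true] at h
      exact ih' h

lemma checkSingles_sound {K : Pat} {c : Certificate} {U : ℕ}
    (hU : ∀ i k, U.testBit i → U.testBit k → K.s.testBit i →
      ¬ (nearRow K.M K.n K.s i).testBit k) :
    ∀ i T, checkSingles K c i T = true → (∀ k, T.testBit k ↔ i ≤ k ∧ U.testBit k) →
      checkSingle K c U = true := by
  intro i
  induction i with
  | zero =>
    intro T h hT
    have : T = U := Nat.eq_of_testBit_eq fun k => Bool.eq_iff_iff.2 (by simp [hT])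
    subst this
    exact h
  | succ i ih =>
    intro T h hT
    change (checkSingles K c i T && (bif Nat.testBit K.s i then
      bif Nat.beq (Nat.land T (nearRow K.M K.n K.s i)) 0 then checkSingles K c i (Nat.lor T (bit i))
        else true else checkSingles K c i (Nat.lor T (bit i)))) = true at h
    rw [Bool.and_eq_true] at h
    by_cases hi : U.testBit i
    · have h' : checkSingles K c i (Nat.lor T (bit i)) = true := by
        cases hs : K.s.testBit i
        · simpa [hs] using h.2
        · have hz : Nat.land T (nearRow K.M K.n K.s i) = 0 :=
            land_eq_zero.2 fun k hk => hU i k hi ((hT k).1 hk).2 hs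
          have h2 := h.2
          rw [hs, hz, cond_true] at h2
          exact h2
      refine ih _ h' fun k => ?_
      rw [testBit_lor, testBit_bit, Bool.or_eq_true, decide_eq_true_eq, hT]
      grind
    · refine ih _ h.1 fun k => ?_
      rw [hT]
      grind

namespace MaxModel
variable {K : Pat} {S : ℕ → Set V}

lemma isLocal_singleton [Finite V] (hG : Core G) (h : MaxModel G K S) {c : Certificate}
    (hc : c.Valid K) (hm : ∀ m ∈ c.maps, ¬ HasModel G m.1)
    (h1 : checkSingles K c K.n 0 = true) {x : V} (hx : ∀ i < K.n, x ∉ S i) :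
    isLocal c (attach G K.n S {x}) = true := by
  set U := attach G K.n S {x} with hUdef
  have hle := hc.le
  have hU : ∀ i, U.testBit i → i < K.n ∧ Touch G {x} (S i) := fun i hi => testBit_attach.1 hi
  have hadj : ∀ i, U.testBit i → ∀ a, S i = {a} → G.Adj x a := by
    intro i hi a ha
    have := (hU i hi).2
    rwa [ha, touch_singleton] at this
  have hspread : ∀ i k, U.testBit i → U.testBit k → K.s.testBit i →
      ¬ (nearRow K.M K.n K.s i).testBit k := by
    intro i k hi hk hs hik
    obtain ⟨hkn, hsk, hne, hnear⟩ := testBit_nearRow hik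
    obtain ⟨hin, a, ha⟩ := h.model.sing i hs
    obtain ⟨-, b, hb⟩ := h.model.sing k hsk
    have hxa := hadj i hi a ha
    have hxb := hadj k hk b hb
    rcases hnear with hnear | ⟨l, hil, hkl, hsl⟩
    · exact hG.tri x a b hxa hxb (h.model.adj_of hin ha hb hnear)
    · obtain ⟨hln, e, he⟩ := h.model.sing l hsl
      refine hG.sq x e a b ?_ (h.model.ne_of hin hkn ha hb hne) hxa hxb
        (h.model.adj_of hin ha he hil).symm (h.model.adj_of hkn hb he hkl).symm
      rintro rfl
      exact hx l hln (he ▸ rfl)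
  have hcheck := checkSingles_sound hspread K.n 0 h1 fun k => by
    rw [Nat.zero_testBit]
    have := hU k
    grind
  have hd : ∀ i < K.n, Disjoint (S i) {x} := fun i hi => Set.disjoint_singleton_right.2 (hx i hi)
  have hmodel := h.model.insertNode (T := U) (s' := Nat.lor K.s (bit K.n)) (by omega)
    (conn_singleton x)
    hd (fun i hi => by rw [hUdef, testBit_attach]; exact and_iff_right hi) (fun i hi => by
      rw [testBit_lor, testBit_bit, Bool.or_eq_true, decide_eq_true_eq] at hi
      exact hi.imp id fun h => ⟨h.symm, x, rfl⟩)
  unfold checkSingle at hcheck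
  rw [Bool.or_eq_true, Bool.or_eq_true] at hcheck
  rcases hcheck with (hcheck | hcheck) | hcheck
  · exact hcheck
  · obtain ⟨d, -, hd⟩ := anyList_eq_true hcheck
    exact absurd ((hmodel.not_refutes hG.bypass d).symm.trans hd) Bool.false_ne_true
  · obtain ⟨t, -, ht⟩ := anyList_eq_true hcheck
    rw [Bool.and_eq_true] at ht
    obtain ⟨m, hmem, hmod⟩ := hmodel.refutesTree_sound hG hc.maps ht.2
    exact absurd hmod (hm m hmem)

lemma isLocal_attach [Finite V] (hG : Core G) (h : MaxModel G K S) {c : Certificate}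
    (hc : c.Valid K) (hm : ∀ m ∈ c.maps, ¬ HasModel G m.1)
    (h1 : checkSingles K c K.n 0 = true) (h2 : checkPairs K c = true) {J : Set V}
    (hJ : Conn G J) (hd : ∀ i < K.n, Disjoint (S i) J) :
    isLocal c (attach G K.n S J) = true := by
  induction hk : J.ncard using Nat.strong_induction_on generalizing J with
  | _ k ih =>
  subst hk
  have hle := hc.le
  obtain ⟨p, hp⟩ := hJ.1
  by_cases hJp : J = {p}
  · rw [hJp]
    exact h.isLocal_singleton hG hc hm h1 fun i hi hpi => Set.disjoint_left.1 (hd i hi) hpi hp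
  obtain ⟨d, hdJ, hdp, hconn⟩ := hJ.exists_diff_singleton hp hJp
  set J' := J \ {d} with hJ'
  have hJJ : J = {d} ∪ J' := by
    rw [hJ', Set.union_sdiff_self, Set.union_eq_self_of_subset_left (by simpa using hdJ)]
  have hd1 : ∀ i < K.n, Disjoint (S i) {d} := fun i hi =>
    (hd i hi).mono_right (by simpa using hdJ)
  have hd2 : ∀ i < K.n, Disjoint (S i) J' := fun i hi => (hd i hi).mono_right Set.sdiff_subset
  have hlt2 : J'.ncard < J.ncard := Set.ncard_sdiff_singleton_lt_of_mem hdJ (Set.toFinite _)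
  have hpos : 0 < J'.ncard := (Set.ncard_pos (Set.toFinite _)).2 hconn.1
  have l1 := ih _ (by rw [Set.ncard_singleton]; omega) (conn_singleton d) hd1 rfl
  have l2 := ih _ hlt2 hconn hd2 rfl
  have htouch : Touch G J' {d} := by
    have := hJ.2 {d} (by simpa using hdJ) (Set.singleton_nonempty d) (by
      intro he
      rw [← he] at hp
      exact hdp (Set.mem_singleton_iff.1 hp).symm)
    exact this.symm
  rw [hJJ, attach_union]
  by_cases ht1 : ∃ i < K.n, Touch G {d} (S i)
  swap
  · have : attach G K.n S {d} = 0 := Nat.eq_of_testBit_eq fun i => by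
      rw [Nat.zero_testBit, ← Bool.not_eq_true, testBit_attach]
      exact fun hi => ht1 ⟨i, hi⟩
    rw [this]
    simpa using l2
  by_cases ht2 : ∃ i < K.n, Touch G J' (S i)
  swap
  · have : attach G K.n S J' = 0 := Nat.eq_of_testBit_eq fun i => by
      rw [Nat.zero_testBit, ← Bool.not_eq_true, testBit_attach]
      exact fun hi => ht2 ⟨i, hi⟩
    rw [this]
    simpa using l1
  have t1 := h.terminals hc (conn_singleton d) hd1 l1 ht1
  have t2 := h.terminals hc hconn hd2 l2 ht2
  have hcheck := onTerminals_sound (onTerminals_sound h2 t1) t2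
  have hatt : ∀ (I : Set V) i, i < K.n → ((attach G K.n S I).testBit i ↔ Touch G I (S i)) :=
    fun I i hi => by rw [testBit_attach]; exact and_iff_right hi
  have m1 := h.model.insertNode (T := attach G K.n S {d}) (s' := Nat.lor K.s (bit K.n)) (by omega)
    (conn_singleton d) hd1 (hatt _) (fun i hi => by
      rw [testBit_lor, testBit_bit, Bool.or_eq_true, decide_eq_true_eq] at hi
      exact hi.imp id fun h => ⟨h.symm, d, rfl⟩)
  unfold checkPair at hcheck
  simp only [Bool.or_eq_true] at hcheck
  rcases hcheck with ((hcheck | hcheck) | hcheck) | hcheck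
  · exact hcheck
  · obtain ⟨e, -, he⟩ := anyList_eq_true hcheck
    have m := h.model.insertNode (T := attach G K.n S J) (s' := K.s) (by omega) hJ hd (hatt _)
      fun i hi => .inl hi
    rw [hJJ, attach_union] at m
    exact absurd ((m.not_refutes hG.bypass e).symm.trans he) Bool.false_ne_true
  · exact absurd ((m1.not_small hG).symm.trans hcheck) Bool.false_ne_true
  · obtain ⟨e, -, he⟩ := anyList_eq_true hcheck
    have m := m1.insertNode (J := J') (T := Nat.lor (attach G K.n S J') (bit K.n))
      (s' := Nat.lor K.s (bit K.n)) (by omega) hconn (fun i hi => by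
        by_cases hin : i = K.n
        · subst hin
          rw [Function.update_self]
          exact Set.disjoint_sdiff_right
        · rw [Function.update_of_ne hin]
          exact hd2 i (by omega)) (fun i hi => by
        rw [testBit_lor, testBit_bit, Bool.or_eq_true, decide_eq_true_eq]
        by_cases hin : i = K.n
        · subst hin
          rw [Function.update_self]
          simp [htouch]
        · rw [Function.update_of_ne hin, hatt _ i (by omega)]
          simp [Ne.symm hin]) (fun i hi => .inl hi)
    exact absurd ((m.not_refutes hG.bypass e).symm.trans he) Bool.false_ne_true

end MaxModel

structure Certificate.Complete (c : Certificate) (K : Pat) : Prop where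
  valid : c.Valid K
  five_le : 5 ≤ K.n
  cover : ∀ i < K.n, K.s.testBit i = false → ∃ b ∈ c.blobs, b.1 = i
  apart : ∀ b ∈ c.blobs, b.2.1 < K.n ∧ b.2.2 < K.n ∧ b.2.1 ≠ b.2.2 ∧
    (row K.M b.2.1).testBit b.2.2 = false

namespace MaxModel
variable {K : Pat} {S : ℕ → Set V}

lemma ncard_two_le [Finite V] (h : Model G K.n K.s K.M S) (hK : 5 ≤ K.n) (a b c : ℕ) {Y : Set V}
    (hY : ∀ i < K.n, i ≠ a → i ≠ b → i ≠ c → S i ⊆ Y) : 2 ≤ Y.ncard := by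
  obtain ⟨i, k, hi, hk, h4', h1, h2, h3, h1', h2', h3'⟩ : ∃ i k : ℕ, i < 5 ∧ k < 5 ∧ k ≠ i ∧
      i ≠ a ∧ i ≠ b ∧ i ≠ c ∧ k ≠ a ∧ k ≠ b ∧ k ≠ c := by
    have hcard : 2 ≤ (Finset.range 5 \ {a, b, c}).card := by
      have h1 := Finset.le_card_sdiff {a, b, c} (Finset.range 5)
      have h2 := Finset.card_le_three (a := a) (b := b) (c := c)
      rw [Finset.card_range] at h1
      omega
    obtain ⟨i, hi, k, hk, hne⟩ := Finset.one_lt_card.1 hcard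
    simp only [Finset.mem_sdiff, Finset.mem_range, Finset.mem_insert, Finset.mem_singleton,
      not_or] at hi hk
    exact ⟨i, k, hi.1, hk.1, hne.symm, hi.2.1, hi.2.2.1, hi.2.2.2, hk.2.1, hk.2.2.1, hk.2.2.2⟩
  obtain ⟨x, hx⟩ := (h.conn i (by omega)).1
  obtain ⟨y, hy⟩ := (h.conn k (by omega)).1
  have hxy : x ≠ y := by
    rintro rfl
    exact h4' (h.eq_of_mem (by omega) (by omega) hy hx)
  rw [← Set.ncard_pair hxy]
  refine Set.ncard_le_ncard ?_ (Set.toFinite _)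
  rintro z (rfl | rfl)
  exacts [hY i (by omega) h1 h2 h3 hx, hY k (by omega) h1' h2' h3' hy]

variable {c : Certificate}

/-- A blob together with all components attached to exactly its two terminals is one side of a
2-cutset. -/
lemma ncard_blob_lt [Finite V] (hG : Core G) (h : MaxModel G K S) (hc : c.Complete K)
    (hl : ∀ J, Conn G J → (∀ i < K.n, Disjoint (S i) J) → isLocal c (attach G K.n S J) = true)
    {b : ℕ × ℕ × ℕ} (hb : b ∈ c.blobs) {J : Set V} (hd : ∀ i < K.n, Disjoint (S i) J)
    (hJ : ∀ y, y ∉ J → (∀ i < K.n, y ∉ S i) → ∀ x ∈ J, ¬ G.Adj x y)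
    (hT : ∀ i < K.n, Touch G J (S i) → i = b.2.1 ∨ i = b.2.2) : (S b.1 ∪ J).ncard < 2 := by
  obtain ⟨b, p, q⟩ := b
  obtain ⟨hbn, hsb, hsp, hsq, hrow⟩ := hc.valid.blob _ hb
  obtain ⟨hpn, hqn, hpq, hapart⟩ := hc.apart _ hb
  dsimp only at *
  obtain ⟨-, a, ha⟩ := h.model.sing p hsp
  obtain ⟨-, a', ha'⟩ := h.model.sing q hsq
  have hbp : b ≠ p := by rintro rfl; simp [hsb] at hsp
  have hbq : b ≠ q := by rintro rfl; simp [hsb] at hsq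
  by_contra! h2
  have hmem : ∀ {i v}, i < K.n → v ∈ S i → v ∉ J := fun hi hv hvJ =>
    Set.disjoint_left.1 (hd _ hi) hv hvJ
  have hap : a ∈ S p := ha ▸ rfl
  have haq : a' ∈ S q := ha' ▸ rfl
  have haX : a ∉ S b ∪ J := by
    rintro (h1 | h1)
    · exact hbp (h.model.eq_of_mem hbn hpn h1 hap)
    · exact hmem hpn hap h1
  have haX' : a' ∉ S b ∪ J := by
    rintro (h1 | h1)
    · exact hbq (h.model.eq_of_mem hbn hqn h1 haq)
    · exact hmem hqn haq h1
  have hne := h.model.ne_of hpn hqn ha ha' hpq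
  refine hG.cut2 a a' (S b ∪ J) ((S b ∪ J) ∪ {a, a'})ᶜ hne ?_ ?_ ?_ haX ?_ haX' ?_ h2 ?_ ?_
  · intro hadj
    have : Touch G (S p) (S q) := by rwa [ha, ha', touch_singleton]
    rw [h.model.touch p hpn q hqn hpq, hapart] at this
    simp at this
  · intro v
    by_cases hv : v ∈ (S b ∪ J) ∪ {a, a'}
    · simp only [Set.mem_union, Set.mem_insert_iff, Set.mem_singleton_iff] at hv ⊢
      tauto
    · exact .inr (.inl hv)
  · exact Set.disjoint_left.2 fun x hx hx' => hx' (.inl hx)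
  · exact fun h => h (.inr (.inl rfl))
  · exact fun h => h (.inr (.inr rfl))
  · refine ncard_two_le h.model hc.five_le b p q fun i hi h1 h2 h3 v hv => ?_
    rintro ((h4 | h4) | (rfl | rfl))
    · exact h1 (h.model.eq_of_mem hi hbn hv h4)
    · exact hmem hi hv h4
    · exact h2 (h.model.eq_of_mem hi hpn hv hap)
    · exact h3 (h.model.eq_of_mem hi hqn hv haq)
  · intro x hx y hy hxy
    by_cases hyS : ∃ i < K.n, y ∈ S i
    · obtain ⟨i, hi, hyi⟩ := hyS
      have hpq' : i = p ∨ i = q := by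
        rcases hx with hx | hx
        · have hib : b ≠ i := by
            rintro rfl
            exact hy (.inl (.inl hyi))
          have := (h.model.touch b hbn i hi hib).1 ⟨x, hx, y, hyi, hxy⟩
          rw [hrow, testBit_lor, testBit_bit, testBit_bit, Bool.or_eq_true, decide_eq_true_eq,
            decide_eq_true_eq] at this
          exact this.imp Eq.symm Eq.symm
        · exact hT i hi ⟨x, hx, y, hyi, hxy⟩
      rcases hpq' with rfl | rfl
      · rw [ha, Set.mem_singleton_iff] at hyi
        exact hy (.inr (.inl hyi))
      · rw [ha', Set.mem_singleton_iff] at hyi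
        exact hy (.inr (.inr hyi))
    · push Not at hyS
      rcases hx with hx | hx
      · have hd' : ∀ i < K.n, Disjoint (S i) {y} := fun i hi =>
          Set.disjoint_singleton_right.2 (hyS i hi)
        have ht : Touch G {y} (S b) := ⟨y, rfl, x, hx, hxy.symm⟩
        have hatt : (attach G K.n S {y}).testBit b := testBit_attach.2 ⟨hbn, ht⟩
        have := h.terminals hc.valid (conn_singleton y) hd' (hl _ (conn_singleton y) hd')
          ⟨b, hbn, ht⟩
        rcases this with ⟨i, hi, hs, heq⟩ | ⟨e, he, heq⟩
        · rw [heq, testBit_bit, decide_eq_true_eq] at hatt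
          subst hatt
          simp [hsb] at hs
        · obtain ⟨-, -, h1, h2, -⟩ := hc.valid.blob _ he
          rw [heq, testBit_lor, testBit_bit, testBit_bit, Bool.or_eq_true, decide_eq_true_eq,
            decide_eq_true_eq] at hatt
          rcases hatt with hatt | hatt
          · rw [hatt, hsb] at h1
            simp at h1
          · rw [hatt, hsb] at h2
            simp at h2
      · exact hJ y (fun h => hy (.inl (.inr h))) hyS x hx hxy

lemma exists_mem [Finite V] (hG : Core G) (h : MaxModel G K S) (hc : c.Complete K)
    (hl : ∀ J, Conn G J → (∀ i < K.n, Disjoint (S i) J) → isLocal c (attach G K.n S J) = true)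
    (x : V) : ∃ i < K.n, x ∈ S i := by
  have h5 := hc.five_le
  by_contra! hx
  obtain ⟨J, hxJ, hJR, hJ, hout⟩ := exists_component (G := G) (R := {v | ∀ i < K.n, v ∉ S i}) hx
  have hd : ∀ i < K.n, Disjoint (S i) J := fun i hi =>
    Set.disjoint_left.2 fun v hv hvJ => hJR hvJ i hi hv
  have cutvertex : ∀ i < K.n, (∀ k < K.n, Touch G J (S k) → k = i) → ∀ a, a ∈ S i →
      (∀ k < K.n, Touch G J (S k) → S k = {a}) → False := by
    intro i hi hT a ha hTa
    have haJ : a ∉ J := fun haJ => Set.disjoint_left.1 (hd i hi) ha haJ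
    refine hG.cut1 ⟨a, J, (J ∪ {a})ᶜ, hJ.1, ?_, ?_, haJ, ?_, ?_, ?_⟩
    · obtain ⟨k, hk, hki⟩ : ∃ k < 5, k ≠ i := by
        by_cases h0 : i = 0
        exacts [⟨1, by omega, by omega⟩, ⟨0, by omega, by omega⟩]
      obtain ⟨v, hv⟩ := (h.model.conn k (by omega)).1
      refine ⟨v, ?_⟩
      rintro (h1 | rfl)
      · exact Set.disjoint_left.1 (hd k (by omega)) hv h1
      · exact hki (h.model.eq_of_mem (by omega) hi hv ha)
    · exact Set.disjoint_left.2 fun v hv hv' => hv' (.inl hv)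
    · exact fun h => h (.inr rfl)
    · intro w
      by_cases hw : w ∈ J ∪ {a}
      · exact hw.imp id fun h => .inr h
      · exact .inr (.inl hw)
    · intro v hv y hy hvy
      by_cases hyS : ∃ k < K.n, y ∈ S k
      · obtain ⟨k, hk, hyk⟩ := hyS
        have := hTa k hk ⟨v, hv, y, hyk, hvy⟩
        rw [this] at hyk
        exact hy (.inr hyk)
      · push Not at hyS
        exact hout y hyS (fun h => hy (.inl h)) v hv hvy
  by_cases ht : ∃ i < K.n, Touch G J (S i)
  swap
  · push Not at ht
    obtain ⟨a, ha⟩ := (h.model.conn 0 (by omega)).1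
    exact cutvertex 0 (by omega) (fun k hk h => absurd h (ht k hk)) a ha
      fun k hk h => absurd h (ht k hk)
  rcases h.terminals hc.valid hJ hd (hl J hJ hd) ht with ⟨i, hi, hs, heq⟩ | ⟨b, hb, heq⟩
  · have hk : ∀ k < K.n, Touch G J (S k) → k = i := by
      intro k hk ht
      have : (attach G K.n S J).testBit k := testBit_attach.2 ⟨hk, ht⟩
      rw [heq, testBit_bit, decide_eq_true_eq] at this
      exact this.symm
    obtain ⟨-, a, ha⟩ := h.model.sing i hs
    exact cutvertex i hi hk a (ha ▸ rfl) fun k hk' ht => hk k hk' ht ▸ ha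
  · have := h.ncard_blob_lt hG hc hl hb hd (fun y hy hyS x hx => hout y hyS hy x hx)
      fun k hk ht => by
        have : (attach G K.n S J).testBit k := testBit_attach.2 ⟨hk, ht⟩
        rw [heq, testBit_lor, testBit_bit, testBit_bit, Bool.or_eq_true, decide_eq_true_eq,
          decide_eq_true_eq] at this
        exact this.imp Eq.symm Eq.symm
    obtain ⟨hbn, -⟩ := hc.valid.blob _ hb
    rw [Set.ncard_union_eq (hd _ hbn)] at this
    have h1 := (Set.ncard_pos (Set.toFinite _)).2 (h.model.conn _ hbn).1
    have h2 := (Set.ncard_pos (Set.toFinite _)).2 hJ.1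
    omega

lemma exists_eq_singleton [Finite V] (hG : Core G) (h : MaxModel G K S) (hc : c.Complete K)
    (hl : ∀ J, Conn G J → (∀ i < K.n, Disjoint (S i) J) → isLocal c (attach G K.n S J) = true)
    {i : ℕ} (hi : i < K.n) : ∃ a, S i = {a} := by
  cases hs : K.s.testBit i
  · obtain ⟨b, hb, rfl⟩ := hc.cover i hi hs
    have := h.ncard_blob_lt hG hc hl hb (J := ∅) (by simp) (by simp) (by simp)
    rw [Set.union_empty] at this
    have h1 := (Set.ncard_pos (Set.toFinite _)).2 (h.model.conn _ hi).1
    exact Set.ncard_eq_one.1 (by omega)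
  · exact (h.model.sing i hs).2

/-- The graph is the pattern. -/
lemma exists_equiv [Finite V] (hG : Core G) (h : MaxModel G K S) (hc : c.Complete K)
    (hl : ∀ J, Conn G J → (∀ i < K.n, Disjoint (S i) J) → isLocal c (attach G K.n S J) = true) :
    ∃ f : Fin K.n ≃ V, ∀ i k, G.Adj (f i) (f k) ↔ (row K.M i).testBit k := by
  have hsing : ∀ i : Fin K.n, ∃ a, S i = {a} := fun i => h.exists_eq_singleton hG hc hl i.2
  choose f hf using hsing
  have hbij : Function.Bijective f := by
    refine ⟨fun i k hik => ?_, fun x => ?_⟩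
    · exact Fin.ext (h.model.eq_of_mem i.2 k.2 (v := f i) (by rw [hf]; rfl)
        (by rw [hf, hik]; rfl))
    · obtain ⟨i, hi, hx⟩ := h.exists_mem hG hc hl x
      have := hf ⟨i, hi⟩
      rw [this, Set.mem_singleton_iff] at hx
      exact ⟨_, hx.symm⟩
  refine ⟨Equiv.ofBijective f hbij, fun i k => ?_⟩
  change G.Adj (f i) (f k) ↔ _
  by_cases hik : i = k
  · subst hik
    have hle := h.model.le
    refine ⟨fun h => absurd rfl h.ne, fun hr => ?_⟩
    exact absurd rfl (h.model.bound i (by omega) i hr).2.2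
  · have := h.model.touch i i.2 k k.2 (fun h => hik (Fin.ext h))
    rwa [hf, hf, touch_singleton] at this

end MaxModel

lemma isTwoExtensionOf_of_embedding {W : Type} {H : SimpleGraph W} (e : G ↪g H) :
    IsTwoExtensionOf H G := by
  refine ⟨(Set.range e)ᶜ, IsSubdivisionOf.refl _ _ ?_⟩
  rw [compl_compl]
  exact ⟨Equiv.ofInjective e e.injective, by simp [Equiv.ofInjective]⟩

instance : DecidableRel petersen.Adj
  | .inl i, .inl j => decidable_of_iff (i ≠ j ∧ (j = i + 1 ∨ i = j + 1)) (by simp [petersen])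
  | .inr i, .inr j => decidable_of_iff (i ≠ j ∧ (j = i + 2 ∨ i = j + 2)) (by simp [petersen])
  | .inl i, .inr j => decidable_of_iff (i = j) (by simp [petersen])
  | .inr i, .inl j => decidable_of_iff (j = i) (by simp [petersen])

instance : DecidableRel heawood.Adj := fun x y => by
  unfold heawood
  exact decidable_of_iff' _ (SimpleGraph.fromRel_adj _ _ _)

/-- The function `i ↦ g[i]` embeds the pattern `K` in `H` as an induced subgraph. -/
def Pat.EmbeddedBy (K : Pat) {W : Type} (H : SimpleGraph W) (w : W) (g : List W) : Prop :=
  ∀ i < K.n, ∀ k < K.n, (g.getD i w = g.getD k w → i = k) ∧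
    (H.Adj (g.getD i w) (g.getD k w) ↔ (row K.M i).testBit k = true)

instance (K : Pat) {W : Type} [DecidableEq W] (H : SimpleGraph W) [DecidableRel H.Adj] (w : W)
    (g : List W) : Decidable (K.EmbeddedBy H w g) := by
  unfold Pat.EmbeddedBy; infer_instance

lemma embeddedBy_P8 : patP8.EmbeddedBy petersen (.inl 0)
    [.inl 0, .inl 1, .inl 3, .inr 3, .inl 4, .inl 2, .inr 0, .inr 1] := by
  decide +kernel

lemma embeddedBy_P9 : patP9.EmbeddedBy petersen (.inl 0)
    [.inl 0, .inl 1, .inl 2, .inl 3, .inr 3, .inr 0, .inl 4, .inr 1, .inr 2] := by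
  decide +kernel

lemma embeddedBy_P10 : patP10.EmbeddedBy petersen (.inl 0)
    [.inl 0, .inl 1, .inl 2, .inl 3, .inr 3, .inr 0, .inl 4, .inr 1, .inr 2, .inr 4] := by
  decide +kernel

lemma embeddedBy_H11 : patH11.EmbeddedBy heawood 0
    [0, 2, 9, 13, 3, 11, 1, 8, 10, 4, 12] := by
  decide +kernel

lemma embeddedBy_H12 : patH12.EmbeddedBy heawood 0
    [0, 2, 9, 13, 3, 11, 1, 8, 10, 4, 12, 7] := by
  decide +kernel

lemma embeddedBy_H13 : patH13.EmbeddedBy heawood 0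
    [0, 2, 9, 13, 3, 11, 1, 8, 10, 4, 12, 7, 5] := by
  decide +kernel

lemma embeddedBy_H14 : patH14.EmbeddedBy heawood 0
    [0, 2, 9, 13, 3, 11, 1, 8, 10, 4, 12, 7, 5, 6] := by
  decide +kernel

lemma isTwoExtensionOf_of_hasModel [Finite V] (hG : Core G) {W : Type} {H : SimpleGraph W}
    {K : Pat} {c : Certificate} (hc : c.Complete K) (h1 : checkSingles K c K.n 0 = true)
    (h2 : checkPairs K c = true) {w : W} {g : List W} (hK : K.EmbeddedBy H w g)
    (hm : ∀ m ∈ c.maps, ¬ HasModel G m.1)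
    (h : HasModel G K) : IsTwoExtensionOf H G := by
  obtain ⟨S, hS⟩ := h.exists_max
  obtain ⟨f, hf⟩ := hS.exists_equiv hG hc fun J hJ hd =>
    hS.isLocal_attach hG hc.valid hm h1 h2 hJ hd
  refine isTwoExtensionOf_of_embedding ⟨⟨fun x => g.getD (f.symm x) w, fun x y hxy =>
    f.symm.injective (Fin.ext ((hK _ (f.symm x).2 _ (f.symm y).2).1 hxy))⟩, fun {a b} => ?_⟩
  refine (hK _ (f.symm a).2 _ (f.symm b).2).2.trans ?_
  rw [← hf, f.apply_symm_apply, f.apply_symm_apply]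

instance (K : Pat) : Decidable K.Valid := by
  unfold Pat.Valid; infer_instance

def Certificate.completeCheck (c : Certificate) (K : Pat) : Prop :=
  (5 ≤ K.n ∧ K.n ≤ 30) ∧
  (∀ b ∈ c.blobs, b.1 < K.n ∧ K.s.testBit b.1 = false ∧ K.s.testBit b.2.1 = true ∧
    K.s.testBit b.2.2 = true ∧ row K.M b.1 = Nat.lor (bit b.2.1) (bit b.2.2)) ∧
  (∀ i < K.n, K.s.testBit i = false → ∃ b ∈ c.blobs, b.1 = i) ∧
  ∀ b ∈ c.blobs, b.2.1 < K.n ∧ b.2.2 < K.n ∧ b.2.1 ≠ b.2.2 ∧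
    (row K.M b.2.1).testBit b.2.2 = false

instance (c : Certificate) (K : Pat) : Decidable (c.completeCheck K) :=
  by
  unfold Certificate.completeCheck; infer_instance

lemma Certificate.completeCheck.complete {c : Certificate} {K : Pat} (h : c.completeCheck K)
    (hm : ∀ m ∈ c.maps, m.1.Valid) : c.Complete K :=
  ⟨⟨h.1.2, hm, h.2.1⟩, h.1.1, h.2.2.1, h.2.2.2⟩

lemma valid_P9 : patP9.Valid := by decide +kernel

lemma valid_P10 : patP10.Valid := by decide +kernel

lemma valid_H11 : patH11.Valid := by decide +kernel

lemma valid_H12 : patH12.Valid := by decide +kernel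

lemma valid_H13 : patH13.Valid := by decide +kernel

lemma valid_H14 : patH14.Valid := by decide +kernel

lemma complete_P8 : certP8.Complete patP8 := by
  refine Certificate.completeCheck.complete (by decide +kernel) ?_
  simp [certP8, valid_H11, valid_H12, valid_P9]

lemma complete_P9 : certP9.Complete patP9 := by
  refine Certificate.completeCheck.complete (by decide +kernel) ?_
  simp [certP9, valid_H13, valid_P10]

lemma complete_P10 : certP10.Complete patP10 := by
  refine Certificate.completeCheck.complete (by decide +kernel) ?_
  simp [certP10]

lemma complete_H11 : certH11.Complete patH11 := by
  refine Certificate.completeCheck.complete (by decide +kernel) ?_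
  simp [certH11, valid_H12, valid_H13]

lemma complete_H12 : certH12.Complete patH12 := by
  refine Certificate.completeCheck.complete (by decide +kernel) ?_
  simp [certH12, valid_H13]

lemma complete_H13 : certH13.Complete patH13 := by
  refine Certificate.completeCheck.complete (by decide +kernel) ?_
  simp [certH13, valid_H14]

lemma complete_H14 : certH14.Complete patH14 := by
  refine Certificate.completeCheck.complete (by decide +kernel) ?_
  simp [certH14]

lemma isTwoExtensionOf_of_hasModel_P8 [Finite V] (hG : Core G) (h : HasModel G patP8) :
    IsTwoExtensionOf petersen G ∨ IsTwoExtensionOf heawood G := by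
  by_cases h14 : HasModel G patH14
  · exact .inr (isTwoExtensionOf_of_hasModel hG complete_H14 checkSingles_H14
      checkPairs_H14 embeddedBy_H14
      (by simp [certH14]) h14)
  by_cases h13 : HasModel G patH13
  · exact .inr (isTwoExtensionOf_of_hasModel hG complete_H13 checkSingles_H13
      checkPairs_H13 embeddedBy_H13
      (by simp [certH13, h14]) h13)
  by_cases h12 : HasModel G patH12
  · exact .inr (isTwoExtensionOf_of_hasModel hG complete_H12 checkSingles_H12
      checkPairs_H12 embeddedBy_H12
      (by simp [certH12, h13]) h12)
  by_cases h11 : HasModel G patH11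
  · exact .inr (isTwoExtensionOf_of_hasModel hG complete_H11 checkSingles_H11
      checkPairs_H11 embeddedBy_H11
      (by simp [certH11, h12, h13]) h11)
  by_cases h10 : HasModel G patP10
  · exact .inl (isTwoExtensionOf_of_hasModel hG complete_P10 checkSingles_P10
      checkPairs_P10 embeddedBy_P10
      (by simp [certP10]) h10)
  by_cases h9 : HasModel G patP9
  · exact .inl (isTwoExtensionOf_of_hasModel hG complete_P9 checkSingles_P9
      checkPairs_P9 embeddedBy_P9
      (by simp [certP9, h10, h13]) h9)
  · exact .inl (isTwoExtensionOf_of_hasModel hG complete_P8 checkSingles_P8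
      checkPairs_P8 embeddedBy_P8
      (by simp [certP8, h9, h11, h12]) h)

/-- The sets of a ladder, in the order of the nodes of `patP8`. -/
def ladderSet (u v x y : V) (A B C D : Set V) (i : ℕ) : Set V :=
  [{u}, {v}, {x}, {y}, A, B, C, D].getD i ∅

lemma Ladder.touch_iff [Finite V] (hG : Core G) {u v x y : V} {A B C D : Set V}
    (h : Ladder G u v x y A B C D) {i k : ℕ} (hk : k < 8) (hik : i < k) :
    Touch G (ladderSet u v x y A B C D i) (ladderSet u v x y A B C D k) ↔
      (row patP8.M i).testBit k = true := by
  have hr := h.swap_right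
  have hl := h.swap_left
  have hlr := hl.swap_right
  have he := h.exchange
  have her := he.swap_right
  have hel := he.swap_left
  have t : ∀ {P : Prop} {b : Bool}, P → b = true → (P ↔ b = true) := fun h1 h2 => iff_of_true h1 h2
  have f : ∀ {P : Prop} {b : Bool}, ¬ P → b = false → (P ↔ b = true) :=
    fun h1 h2 => iff_of_false h1 (by simp [h2])
  have s1 := fun {a b : V} (h : G.Adj a b) => (touch_singleton (G := G)).2 h
  have s0 := fun {a b : V} (h : ¬ G.Adj a b) => mt (touch_singleton (G := G)).1 h
  have sy := fun {a b : Set V} (h : ¬ Touch G a b) => mt (Touch.symm (G := G)) h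
  interval_cases k <;> interval_cases i <;>
    simp only [ladderSet, List.getD_cons_zero, List.getD_cons_succ]
  · exact t (s1 h.huv) (by decide +kernel)
  · exact f (s0 (h.not_adj hG)) (by decide +kernel)
  · exact f (s0 (hl.not_adj hG)) (by decide +kernel)
  · exact f (s0 (hr.not_adj hG)) (by decide +kernel)
  · exact f (s0 (hlr.not_adj hG)) (by decide +kernel)
  · exact t (s1 h.hxy) (by decide +kernel)
  · exact t (h.conn hG).2.1 (by decide +kernel)
  · exact f (hl.not_touch_terminal hG) (by decide +kernel)
  · exact t (h.conn hG).2.2 (by decide +kernel)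
  · exact f (hel.not_touch_terminal hG) (by decide +kernel)
  · exact f (h.not_touch_terminal hG) (by decide +kernel)
  · exact t (hl.conn hG).2.1 (by decide +kernel)
  · exact t (hl.conn hG).2.2 (by decide +kernel)
  · exact f (hel.swap_right.not_touch_terminal hG) (by decide +kernel)
  · exact f (h.not_touch_side hG) (by decide +kernel)
  · exact t (hr.conn hG).2.1 (by decide +kernel)
  · exact f (hlr.not_touch_terminal hG) (by decide +kernel)
  · exact f (he.not_touch_terminal hG) (by decide +kernel)
  · exact t (hr.conn hG).2.2 (by decide +kernel)
  · exact f (he.not_touch_side hG) (by decide +kernel)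
  · exact f (hl.not_touch_opposite hG) (by decide +kernel)
  · exact f (hr.not_touch_terminal hG) (by decide +kernel)
  · exact t (hlr.conn hG).2.1 (by decide +kernel)
  · exact f (her.not_touch_terminal hG) (by decide +kernel)
  · exact t (hlr.conn hG).2.2 (by decide +kernel)
  · exact f (h.not_touch_opposite hG) (by decide +kernel)
  · exact f (her.not_touch_side hG) (by decide +kernel)
  · exact f (hr.not_touch_side hG) (by decide +kernel)

lemma Ladder.hasModel [Finite V] (hG : Core G) {u v x y : V} {A B C D : Set V}
    (h : Ladder G u v x y A B C D) : HasModel G patP8 := by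
  have hdisj : ∀ {i k : ℕ}, k < 8 → i < k →
      Disjoint (ladderSet u v x y A B C D i) (ladderSet u v x y A B C D k) := by
    intro i k hk hik
    have := List.pairwise_iff_getElem.1 h.disj i k (by simp; omega) (by simpa) hik
    rwa [← List.getD_eq_getElem _ ∅, ← List.getD_eq_getElem _ ∅] at this
  have hsymm : ∀ i < 8, ∀ k < 8, (row patP8.M i).testBit k = (row patP8.M k).testBit i := by
    decide +kernel
  refine ⟨ladderSet u v x y A B C D, by decide +kernel, ?_, ?_, ?_, ?_, ?_⟩
  · have hb : patP8.Valid := by decide +kernel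
    intro i hi k hk
    refine hb.1 i hi k ?_ hk
    rw [testBit_row] at hk
    simp only [Bool.and_eq_true, decide_eq_true_eq] at hk
    exact hk.1
  · have hb : ∀ i, (15 : ℕ).testBit i = true → i < 4 := fun i hi => by
      by_contra hlt
      rw [Nat.testBit_lt_two_pow] at hi
      · cases hi
      · exact lt_of_lt_of_le (by norm_num : 15 < 2 ^ 4)
          (Nat.pow_le_pow_right (by norm_num) (by omega))
    intro i hi
    have := hb i hi
    refine ⟨lt_of_lt_of_le this (by decide), ?_⟩
    interval_cases i <;> simp [ladderSet]
  · intro i hi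
    change i < 8 at hi
    interval_cases i
    exacts [conn_singleton u, conn_singleton v, conn_singleton x, conn_singleton y, (h.conn hG).1,
      (h.swap_left.conn hG).1, (h.swap_right.conn hG).1, (h.swap_left.swap_right.conn hG).1]
  · intro i hi k hk hik
    rcases lt_or_gt_of_ne hik with hlt | hlt
    · exact hdisj hk hlt
    · exact (hdisj hi hlt).symm
  · intro i hi k hk hik
    rcases lt_or_gt_of_ne hik with hlt | hlt
    · exact h.touch_iff hG hk hlt
    · rw [hsymm i hi k hk, touch_comm]
      exact h.touch_iff hG hi hlt

theorem Core.isTwoExtensionOf [Finite V] (hG : Core G) {u v : V}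
    (hu : 3 ≤ (G.neighborSet u).ncard) (hv : 3 ≤ (G.neighborSet v).ncard) (huv : G.Adj u v) :
    IsTwoExtensionOf petersen G ∨ IsTwoExtensionOf heawood G := by
  obtain ⟨u, v, x, y, A, B, C, D, h⟩ := hG.exists_ladder hu hv huv
  exact isTwoExtensionOf_of_hasModel_P8 hG (h.hasModel hG)

lemma ncard_pair_le (a b : V) : ({a, b} : Set V).ncard ≤ 2 :=
  (Set.ncard_insert_le a {b}).trans (by rw [Set.ncard_singleton])

/-- `{a, b}` is a pair of nonadjacent vertices separating `X` from `Y`. -/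
structure Separates (G : SimpleGraph V) (a b : V) (X Y : Set V) : Prop where
  ne : a ≠ b
  nadj : ¬ G.Adj a b
  cover : ∀ v, v ∈ X ∨ v ∈ Y ∨ v = a ∨ v = b
  disj : Disjoint X Y
  aX : a ∉ X
  aY : a ∉ Y
  bX : b ∉ X
  bY : b ∉ Y
  sep : ∀ x ∈ X, ∀ y ∈ Y, ¬ G.Adj x y

lemma Separates.symm {a b : V} {X Y : Set V} (h : Separates G a b X Y) : Separates G a b Y X :=
  ⟨h.ne, h.nadj, fun v => by have := h.cover v; tauto, h.disj.symm, h.aY, h.aX, h.bY, h.bX,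
    fun y hy x hx hxy => h.sep x hx y hy hxy.symm⟩

/-- The side `X` of a pair `a, b` is more than a path between `a` and `b`. -/
def Rich (G : SimpleGraph V) (a b : V) (X : Set V) : Prop :=
  2 ≤ X.ncard ∧ ((∃ v ∈ X, 3 ≤ (G.neighborSet v).ncard) ∨
    2 ≤ (G.neighborSet a ∩ X).ncard ∨ 2 ≤ (G.neighborSet b ∩ X).ncard)

/-- The properties of the graphs to which no decomposition applies, as used in the reduction to
graphs without adjacent vertices of degree 2. -/
structure Indecomposable (G : SimpleGraph V) : Prop where
  bypass : BypassTouch G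
  tri : ∀ a b c, G.Adj a b → G.Adj a c → ¬ G.Adj b c
  sq : ∀ a b c d, a ≠ b → c ≠ d → G.Adj a c → G.Adj a d → G.Adj b c → G.Adj b d → False
  cut1 : ¬ Has1Cutset G
  cut2 : ∀ a b X Y, Separates G a b X Y → Rich G a b X → ¬ Rich G a b Y
  branch : ∃ u v, G.Adj u v ∧ 3 ≤ (G.neighborSet u).ncard ∧ 3 ≤ (G.neighborSet v).ncard

namespace Indecomposable

lemma two_le_degree [Finite V] (hG : Indecomposable G) (w : V) :
    2 ≤ (G.neighborSet w).ncard := by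
  obtain ⟨u, -, -, hu, -⟩ := hG.branch
  by_contra hlt
  have hle : (G.neighborSet w).ncard ≤ 1 := by omega
  have hne : ∃ t, t ≠ w ∧ G.neighborSet w ⊆ {t} := by
    rcases Set.eq_empty_or_nonempty (G.neighborSet w) with h | ⟨t, ht⟩
    · obtain ⟨t, -, ht⟩ := Set.exists_ne_of_one_lt_ncard (by omega : 1 < (G.neighborSet u).ncard) w
      exact ⟨t, ht, h ▸ Set.empty_subset _⟩
    · exact ⟨t, (SimpleGraph.Adj.ne' ht),
        fun s hs => (Set.ncard_le_one_iff (Set.toFinite _)).1 hle hs ht⟩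
  obtain ⟨t, htw, ht⟩ := hne
  obtain ⟨y, hy, hyn⟩ : ∃ y ∈ G.neighborSet u, y ∉ ({w, t} : Set V) :=
    Set.exists_mem_notMem_of_ncard_lt_ncard (lt_of_le_of_lt (ncard_pair_le w t) (by omega))
  refine hG.cut1 ⟨t, {w}, {w, t}ᶜ, ⟨w, rfl⟩, ⟨y, hyn⟩, ?_, by simpa using htw, by simp, ?_, ?_⟩
  · exact Set.disjoint_left.2 fun a ha h => h (.inl ha)
  · intro v
    by_cases v = w <;> by_cases v = t <;> simp_all
  · rintro _ rfl z hz hxz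
    exact hz (.inr (ht hxz))

/-- Without adjacent vertices of degree 2, both sides of a separating pair are rich. -/
lemma rich_of_separates [Finite V] (hG : Indecomposable G)
    (hred : ∀ x y, G.Adj x y → (G.neighborSet x).ncard = 2 → (G.neighborSet y).ncard ≠ 2)
    {a b : V} {X Y : Set V} (h : Separates G a b X Y) (hX : 2 ≤ X.ncard) : Rich G a b X := by
  by_contra hr
  have h2 : ∀ v ∈ X, (G.neighborSet v).ncard = 2 := fun v hv => by
    have := hG.two_le_degree v
    by_contra hne
    exact hr ⟨hX, .inl ⟨v, hv, by omega⟩⟩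
  have ha : ∀ v ∈ X, G.Adj a v := by
    intro v hv
    have hsub : G.neighborSet v ⊆ {a, b} := by
      intro t ht
      rcases h.cover t with h' | h' | h'
      · exact absurd (h2 t h') (hred v t ht (h2 v hv))
      · exact absurd ht (h.sep v hv t h')
      · exact h'
    have heq := Set.eq_of_subset_of_ncard_le hsub (by rw [h2 v hv]; exact ncard_pair_le a b)
    have : a ∈ G.neighborSet v := heq ▸ Set.mem_insert a {b}
    exact SimpleGraph.Adj.symm this
  refine hr ⟨hX, .inr (.inl ?_)⟩
  rwa [Set.inter_eq_right.2 (show X ⊆ G.neighborSet a from fun v hv => ha v hv)]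

lemma core [Finite V] (hG : Indecomposable G)
    (hred : ∀ x y, G.Adj x y → (G.neighborSet x).ncard = 2 → (G.neighborSet y).ncard ≠ 2) :
    Core G := by
  refine ⟨hG.bypass, hG.tri, hG.sq, hG.cut1, ?_⟩
  intro a b X Y hab hnadj hcov hd haX haY hbX hbY hX hY hsep
  have h : Separates G a b X Y := ⟨hab, hnadj, hcov, hd, haX, haY, hbX, hbY, hsep⟩
  exact hG.cut2 a b X Y h (hG.rich_of_separates hred h hX) (hG.rich_of_separates hred h.symm hY)

/-- Two adjacent vertices of degree 2 do not lie on a cycle of length 5. -/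
lemma no_pentagon [Finite V] (hG : Indecomposable G) {x y x' y' z : V}
    (hx : ∀ v, G.Adj x v ↔ v = x' ∨ v = y) (hy : ∀ v, G.Adj y v ↔ v = x ∨ v = y')
    (hne : x' ≠ y') (hzx : z ≠ x) (hzy : z ≠ y) (hx'z : G.Adj x' z) (hy'z : G.Adj y' z) :
    False := by
  have hxx' : G.Adj x x' := (hx x').2 (.inl rfl)
  have hxy : G.Adj x y := (hx y).2 (.inr rfl)
  have hyy' : G.Adj y y' := (hy y').2 (.inr rfl)
  have hx'y' : ¬ G.Adj x' y' := hG.tri z x' y' hx'z.symm hy'z.symm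
  have hyx' : y ≠ x' := fun h => hG.tri z x' y' hx'z.symm hy'z.symm (h ▸ hyy')
  have hxy' : x ≠ y' := fun h => hG.tri z x' y' hx'z.symm hy'z.symm (h ▸ hxx'.symm)
  have hz : ∀ w, G.Adj z w → w = x' ∨ w = y' := by
    intro w hw
    by_contra hcon
    have hwx : w ≠ x := by
      rintro rfl
      rcases (hx z).1 hw.symm with h | h
      · exact hx'z.ne h.symm
      · exact hzy h
    have hwy : w ≠ y := by
      rintro rfl
      rcases (hy z).1 hw.symm with h | h
      · exact hzx h
      · exact hy'z.ne h.symm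
    obtain ⟨K, hwK, hKR, hK, hcomp⟩ := exists_component (G := G)
      (R := ({x', y', z, x, y} : Set V)ᶜ) (x := w) (by simp [hw.ne']; tauto)
    have hK' : ∀ v ∈ K, v ≠ x' ∧ v ≠ y' ∧ v ≠ z ∧ v ≠ x ∧ v ≠ y := fun v hv => by
      have := hKR hv
      simp only [Set.mem_compl_iff, Set.mem_insert_iff, Set.mem_singleton_iff] at this
      tauto
    have htx : ∀ v ∈ K, ¬ G.Adj x v := fun v hv h => by
      have := hK' v hv
      have := (hx v).1 h
      tauto
    have hty : ∀ v ∈ K, ¬ G.Adj y v := fun v hv h => by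
      have := hK' v hv
      have := (hy v).1 h
      tauto
    have htK : Touch G {x', y'} K := by
      by_contra hcon
      refine hG.cut1 (has1Cutset_of_component (z := z) (y := x) hK.1
        (fun h => (hK' x h).2.2.2.1 rfl) hzx.symm (fun h => (hK' z h).2.2.1 rfl) hcomp ?_)
      rintro v hv hvz ⟨_, hvv, s, hs, hvs⟩
      obtain rfl := hvv
      simp only [Set.mem_compl_iff, Set.mem_insert_iff, Set.mem_singleton_iff, not_not] at hv
      rcases hv with rfl | rfl | rfl | rfl | rfl
      · exact hcon ⟨_, .inl rfl, s, hs, hvs⟩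
      · exact hcon ⟨_, .inr rfl, s, hs, hvs⟩
      · exact hvz rfl
      · exact htx s hs hvs
      · exact hty s hs hvs
    have hfin : {L : Set V | L ⊆ K ∧ Conn G L ∧ Touch G {z} L ∧ Touch G {x', y'} L}.Finite :=
      Set.toFinite _
    obtain ⟨L, ⟨hLK, hL, htz, ht⟩, hmin⟩ := hfin.exists_minimal
      ⟨K, subset_rfl, hK, ⟨z, rfl, w, hwK, hw⟩, htK⟩
    have hIx : Conn G {x, y, y'} :=
      (conn_pair hyy').insert_adj (Set.mem_insert y {y'}) hxy
    have hIy : Conn G {y, x, x'} :=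
      (conn_pair hxx').insert_adj (Set.mem_insert x {x'}) hxy.symm
    have h1 : Touch G {x'} L := by
      by_contra hn
      obtain ⟨v, hv, s, hs, hvs⟩ := ht
      rcases hv with rfl | hv
      · exact hn ⟨v, rfl, s, hs, hvs⟩
      obtain rfl : v = y' := hv
      obtain ⟨a, ha, s', hs', has⟩ := hG.bypass z v {y, x, x'} L
        ⟨hy'z.symm, hIy, hL, Set.disjoint_left.2 (by
          have := fun a h => hK' a (hLK h)
          rintro a (rfl | rfl | rfl) h <;> have := this _ h <;> tauto),
          by simp [hzy, hzx, hx'z.ne'], by simp [hyy'.ne', hxy'.symm, hne.symm],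
          fun h => (hK' _ (hLK h)).2.2.1 rfl, fun h => (hK' _ (hLK h)).2.1 rfl,
          ⟨z, rfl, x', by simp, hx'z.symm⟩, ⟨v, rfl, y, by simp, hyy'.symm⟩, htz,
          ⟨v, rfl, s, hs, hvs⟩⟩
      rcases ha with rfl | rfl | rfl
      · exact hty s' (hLK hs') has
      · exact htx s' (hLK hs') has
      · exact hn ⟨_, rfl, s', hs', has⟩
    have h2 : Touch G {y'} L := by
      by_contra hn
      obtain ⟨v, hv, s, hs, hvs⟩ := h1
      obtain rfl : v = x' := hv
      obtain ⟨a, ha, s', hs', has⟩ := hG.bypass z v {x, y, y'} L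
        ⟨hx'z.symm, hIx, hL, Set.disjoint_left.2 (by
          have := fun a h => hK' a (hLK h)
          rintro a (rfl | rfl | rfl) h <;> have := this _ h <;> tauto),
          by simp [hzy, hzx, hy'z.ne'], by simp [hyx'.symm, hxx'.ne', hne],
          fun h => (hK' _ (hLK h)).2.2.1 rfl, fun h => (hK' _ (hLK h)).1 rfl,
          ⟨z, rfl, y', by simp, hy'z.symm⟩, ⟨v, rfl, x, by simp, hxx'.symm⟩, htz,
          ⟨v, rfl, s, hs, hvs⟩⟩
      rcases ha with rfl | rfl | rfl
      · exact htx s' (hLK hs') has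
      · exact hty s' (hLK hs') has
      · exact hn ⟨_, rfl, s', hs', has⟩
    obtain ⟨z', hz', t, htL, hzt⟩ := htz
    rw [Set.mem_singleton_iff.1 hz'] at hzt
    by_cases hLt : L = {t}
    · rw [hLt, touch_singleton] at h1
      exact hG.tri _ x' t hx'z.symm hzt h1
    obtain ⟨d, hdL, hdt, hd⟩ := hL.exists_diff_singleton htL hLt
    have hnt : ¬ Touch G {x', y'} (L \ {d}) := fun h =>
      (hmin (y := L \ {d}) ⟨Set.sdiff_subset.trans hLK, hd, ⟨_, rfl, t, ⟨htL, hdt.symm⟩, hzt⟩, h⟩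
        Set.sdiff_subset hdL).2 rfl
    have hadj : ∀ v ∈ ({x', y'} : Set V), Touch G {v} L → G.Adj v d := by
      rintro v hv ⟨_, rfl, s, hs, hvs⟩
      by_cases hsd : s = d
      · exact hsd ▸ hvs
      · exact absurd ⟨_, hv, s, ⟨hs, hsd⟩, hvs⟩ hnt
    exact hG.sq x' y' z d hne (hK' d (hLK hdL)).2.2.1.symm hx'z (hadj x' (by simp) h1) hy'z
      (hadj y' (by simp) h2)
  have hdeg : ∀ v ∈ ({x, y, z} : Set V), (G.neighborSet v).ncard ≤ 2 := by
    have key : ∀ v s t, (∀ w, G.Adj v w → w = s ∨ w = t) → (G.neighborSet v).ncard ≤ 2 :=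
      fun v s t h => (Set.ncard_le_ncard (t := {s, t}) h).trans (ncard_pair_le s t)
    rintro v (rfl | rfl | rfl)
    · exact key _ _ _ fun w => (hx w).1
    · exact key _ _ _ fun w => (hy w).1
    · exact key _ _ _ hz
  have hclosed : ∀ s ∈ ({x, y, z} : Set V), ∀ t, G.Adj s t → t ∈ ({x', y', x, y, z} : Set V) := by
    rintro v (rfl | rfl | rfl) t ht
    · rcases (hx t).1 ht with rfl | rfl <;> simp
    · rcases (hy t).1 ht with rfl | rfl <;> simp
    · rcases hz t ht with rfl | rfl <;> simp
  have hsep : Separates G x' y' {x, y, z} ({x', y', x, y, z} : Set V)ᶜ := by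
    refine ⟨hne, hx'y', ?_, ?_, ?_, by simp, ?_, by simp, ?_⟩
    · intro v
      simp only [Set.mem_compl_iff, Set.mem_insert_iff, Set.mem_singleton_iff]
      tauto
    · rw [Set.disjoint_left]
      rintro v hv hv'
      exact hv' (.inr (.inr hv))
    · simp [hxx'.ne', hyx'.symm, hx'z.ne]
    · simp [hxy'.symm, hyy'.ne', hy'z.ne]
    · exact fun s hs t ht hst => ht (hclosed s hs t hst)
  refine hG.cut2 _ _ _ _ hsep ⟨?_, .inr (.inl ?_)⟩ ?_
  · exact (Set.ncard_pair hxy.ne).symm.le.trans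
      (Set.ncard_le_ncard (by rintro v (rfl | rfl) <;> simp))
  · refine (Set.ncard_pair hzx.symm).symm.le.trans (Set.ncard_le_ncard ?_)
    rintro v (rfl | rfl)
    · exact ⟨hxx'.symm, by simp⟩
    · exact ⟨hx'z, by simp⟩
  have key : ∀ u, 3 ≤ (G.neighborSet u).ncard → u ≠ x' → u ≠ y' →
      Rich G x' y' ({x', y', x, y, z} : Set V)ᶜ := by
    intro u hu hux huy
    have huS : u ∉ ({x, y, z} : Set V) := fun h => by have := hdeg u h; omega
    have huR : u ∈ ({x', y', x, y, z} : Set V)ᶜ := by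
      rintro (h | h | h)
      exacts [hux h, huy h, huS h]
    obtain ⟨t, ht, htn⟩ : ∃ t ∈ G.neighborSet u, t ∉ ({x', y'} : Set V) :=
      Set.exists_mem_notMem_of_ncard_lt_ncard (lt_of_le_of_lt (ncard_pair_le x' y') (by omega))
    have htR : t ∈ ({x', y', x, y, z} : Set V)ᶜ := by
      rintro (h | h | h)
      · exact htn (.inl h)
      · exact htn (.inr h)
      · exact huR (hclosed t h u (SimpleGraph.Adj.symm ht))
    refine ⟨?_, .inl ⟨u, huR, hu⟩⟩
    refine (Set.ncard_pair (SimpleGraph.Adj.ne ht)).symm.le.trans (Set.ncard_le_ncard ?_)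
    rintro v (rfl | rfl)
    · exact huR
    · exact htR
  obtain ⟨u, v, huv, hu, hv⟩ := hG.branch
  by_cases h : u = x' ∨ u = y'
  · refine key v hv ?_ ?_
    · rintro rfl
      rcases h with rfl | rfl
      · exact huv.ne rfl
      · exact hx'y' huv.symm
    · rintro rfl
      rcases h with rfl | rfl
      · exact hx'y' huv
      · exact huv.ne rfl
  · exact key u hu (fun h' => h (.inl h')) fun h' => h (.inr h')

end Indecomposable

end UF

namespace UF

variable {V W : Type} {G : SimpleGraph V} {H : SimpleGraph W}

/-- `G` is obtained from `H` by subdividing the edge `pq`, where `q` has degree 2 with neighbours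
`p` and `r`; the new vertex is `x` and `i` embeds the vertices of `H` in those of `G`. -/
structure Subdivides (H : SimpleGraph W) (G : SimpleGraph V) (i : W → V) (x : V) (p q r : W) :
    Prop where
  inj : Function.Injective i
  ne : ∀ w, i w ≠ x
  surj : ∀ v, v ≠ x → ∃ w, i w = v
  adj : ∀ a b, H.Adj a b ↔ G.Adj (i a) (i b) ∨ (a = p ∧ b = q) ∨ (a = q ∧ b = p)
  nadj : ¬ G.Adj (i p) (i q)
  adj_new : ∀ v, G.Adj x v ↔ v = i p ∨ v = i q
  adj_q : ∀ t, H.Adj q t ↔ t = p ∨ t = r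
  ne' : p ≠ r

namespace Subdivides
variable {i : W → V} {x : V} {p q r : W}

lemma hpq (h : Subdivides H G i x p q r) : H.Adj p q := (h.adj p q).2 (.inr (.inl ⟨rfl, rfl⟩))

lemma hrq (h : Subdivides H G i x p q r) : H.Adj r q := ((h.adj_q r).2 (.inr rfl)).symm

lemma of_adj (h : Subdivides H G i x p q r) {a b : W} (hab : G.Adj (i a) (i b)) : H.Adj a b :=
  (h.adj a b).2 (.inl hab)

lemma adj_of_ne (h : Subdivides H G i x p q r) {a b : W} (hab : H.Adj a b) (ha : a ≠ q)
    (hb : b ≠ q) : G.Adj (i a) (i b) :=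
  ((h.adj a b).1 hab).elim id fun h => h.elim (fun h => absurd h.2 hb) fun h => absurd h.1 ha

lemma isSubdivisionOf (h : Subdivides H G i x p q r) {U : Type} {P : SimpleGraph U}
    (hP : IsSubdivisionOf P H) : IsSubdivisionOf P G := by
  classical
  have hq : (H.neighborSet q).ncard = 2 := by
    rw [show H.neighborSet q = {p, r} from Set.ext h.adj_q, Set.ncard_pair h.ne']
  refine .step P H p q h.hpq (.inr hq) hP G (RelIso.symm ⟨Equiv.ofBijective
    (Sum.elim i fun _ => x) ⟨?_, ?_⟩, ?_⟩)
  · rintro (a | ⟨⟩) (b | ⟨⟩) hab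
    · exact congrArg _ (h.inj hab)
    · exact absurd hab (h.ne a)
    · exact absurd hab.symm (h.ne b)
    · rfl
  · intro v
    by_cases hv : v = x
    · exact ⟨.inr (), hv.symm⟩
    · obtain ⟨w, hw⟩ := h.surj v hv
      exact ⟨.inl w, hw⟩
  · have hin : ∀ a b, G.Adj (i a) (i b) ↔ H.Adj a b ∧ s(a, b) ≠ s(p, q) := by
      intro a b
      rw [h.adj, ne_eq, Sym2.eq_iff]
      refine ⟨fun hab => ⟨.inl hab, ?_⟩, by tauto⟩
      rintro (⟨rfl, rfl⟩ | ⟨rfl, rfl⟩)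
      · exact h.nadj hab
      · exact h.nadj hab.symm
    have hnew : ∀ b, G.Adj x (i b) ↔ b = p ∨ b = q := by
      intro b
      rw [h.adj_new, h.inj.eq_iff, h.inj.eq_iff]
    rintro (a | ⟨⟩) (b | ⟨⟩)
    · change G.Adj (i a) (i b) ↔ _
      rw [hin]
      simp only [SubdivideEdge, fromRel_adj, ne_eq, Sum.inl.injEq, Sym2.eq_swap (a := b),
        H.adj_comm b, or_self]
      exact ⟨fun h => ⟨h.1.ne, h⟩, fun h => h.2⟩
    · change G.Adj (i a) x ↔ _
      rw [G.adj_comm, hnew]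
      simp [SubdivideEdge]
    · change G.Adj x (i b) ↔ _
      rw [hnew]
      simp [SubdivideEdge]
    · change G.Adj x x ↔ _
      simp [SubdivideEdge]

/-- The neighbour of `i w` corresponding to the neighbour `t` of `w`. -/
noncomputable def lift (i : W → V) (x : V) (p q w t : W) : V :=
  open Classical in if (w = p ∧ t = q) ∨ (w = q ∧ t = p) then x else i t

lemma lift_injective (h : Subdivides H G i x p q r) (w : W) :
    Function.Injective (lift i x p q w) := by
  intro a b hab
  unfold lift at hab
  have := h.hpq.ne
  split_ifs at hab with h1 h2 h2
  · grind
  · exact absurd hab.symm (h.ne b)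
  · exact absurd hab (h.ne a)
  · exact h.inj hab

lemma adj_lift (h : Subdivides H G i x p q r) {w t : W} (hwt : H.Adj w t) :
    G.Adj (i w) (lift i x p q w t) := by
  unfold lift
  split_ifs with h1
  · refine ((h.adj_new _).2 ?_).symm
    rcases h1 with h1 | h1
    · exact .inl (h1.1 ▸ rfl)
    · exact .inr (h1.1 ▸ rfl)
  · exact ((h.adj w t).1 hwt).resolve_right h1

lemma ncard_neighborSet [Finite V] (h : Subdivides H G i x p q r) (w : W) :
    (H.neighborSet w).ncard = (G.neighborSet (i w)).ncard := by
  have hpq := h.hpq.ne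
  rw [← Set.ncard_image_of_injective _ (h.lift_injective w)]
  congr 1
  ext v
  constructor
  · rintro ⟨t, ht, rfl⟩
    exact h.adj_lift ht
  · intro hv
    by_cases hvx : v = x
    · subst hvx
      rcases (h.adj_new _).1 (SimpleGraph.Adj.symm hv) with hw | hw
      · obtain rfl := h.inj hw
        exact ⟨q, h.hpq, if_pos (.inl ⟨rfl, rfl⟩)⟩
      · obtain rfl := h.inj hw
        exact ⟨p, h.hpq.symm, if_pos (.inr ⟨rfl, rfl⟩)⟩
    · obtain ⟨t, rfl⟩ := h.surj v hvx
      refine ⟨t, h.of_adj hv, if_neg ?_⟩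
      rintro (⟨rfl, rfl⟩ | ⟨rfl, rfl⟩)
      · exact h.nadj hv
      · exact h.nadj (SimpleGraph.Adj.symm hv)

lemma rich [Finite V] (h : Subdivides H G i x p q r) {a b : W} {X : Set W} {Y : Set V}
    (hX : Rich H a b X) (hXY : i '' X ⊆ Y) (hx : p ∈ X ∨ q ∈ X → x ∈ Y) :
    Rich G (i a) (i b) Y := by
  have key : ∀ a, 2 ≤ (H.neighborSet a ∩ X).ncard → 2 ≤ (G.neighborSet (i a) ∩ Y).ncard := by
    intro a ha
    rw [← Set.ncard_image_of_injective _ (h.lift_injective a)] at ha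
    refine ha.trans (Set.ncard_le_ncard ?_)
    rintro _ ⟨t, ⟨ht, htX⟩, rfl⟩
    refine ⟨h.adj_lift ht, ?_⟩
    unfold lift
    split_ifs with h1
    · rcases h1 with ⟨-, rfl⟩ | ⟨-, rfl⟩
      · exact hx (.inr htX)
      · exact hx (.inl htX)
    · exact hXY ⟨t, htX, rfl⟩
  refine ⟨?_, hX.2.imp ?_ (Or.imp (key a) (key b))⟩
  · have := hX.1
    rw [← Set.ncard_image_of_injective _ h.inj] at this
    exact this.trans (Set.ncard_le_ncard hXY)
  · rintro ⟨v, hv, hd⟩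
    exact ⟨i v, hXY ⟨v, hv, rfl⟩, h.ncard_neighborSet v ▸ hd⟩

lemma separates (h : Subdivides H G i x p q r) {a b : W} {X Y : Set W} (hs : Separates H a b X Y)
    (hp : p ∉ Y) (hq : q ∉ Y) : Separates G (i a) (i b) (insert x (i '' X)) (i '' Y) := by
  refine ⟨h.inj.ne hs.ne, fun hab => hs.nadj (h.of_adj hab), ?_, ?_, ?_, ?_, ?_, ?_, ?_⟩
  · intro v
    by_cases hv : v = x
    · exact .inl (.inl hv)
    · obtain ⟨w, rfl⟩ := h.surj v hv
      simp only [Set.mem_insert_iff, h.inj.mem_set_image, h.inj.eq_iff]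
      have := hs.cover w
      tauto
  · rw [Set.disjoint_left]
    rintro _ (rfl | ⟨w, hw, rfl⟩) ⟨t, ht, htw⟩
    · exact h.ne t htw
    · exact Set.disjoint_left.1 hs.disj hw (h.inj htw ▸ ht)
  · simpa [h.ne, h.inj.mem_set_image] using hs.aX
  · simpa [h.inj.mem_set_image] using hs.aY
  · simpa [h.ne, h.inj.mem_set_image] using hs.bX
  · simpa [h.inj.mem_set_image] using hs.bY
  · rintro _ (rfl | ⟨w, hw, rfl⟩) _ ⟨t, ht, rfl⟩ hadj
    · rcases (h.adj_new _).1 hadj with h' | h'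
      · exact hp (h.inj h' ▸ ht)
      · exact hq (h.inj h' ▸ ht)
    · exact hs.sep w hw t ht (h.of_adj hadj)

lemma cut2 [Finite V] (h : Subdivides H G i x p q r) (hG : Indecomposable G) {a b : W}
    {X Y : Set W} (hs : Separates H a b X Y) (hX : Rich H a b X) (hY : Rich H a b Y) : False := by
  have key : ∀ {X Y : Set W}, Separates H a b X Y → Rich H a b X → Rich H a b Y → p ∉ Y → q ∉ Y →
      False := fun hs hX hY hp hq =>
    hG.cut2 _ _ _ _ (h.separates hs hp hq)
      (h.rich hX (Set.subset_insert _ _) fun _ => Set.mem_insert _ _)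
      (h.rich hY subset_rfl fun h => h.elim (absurd · hp) (absurd · hq))
  by_cases hp : p ∈ Y
  · exact key hs.symm hY hX (fun h' => Set.disjoint_left.1 hs.disj h' hp)
      fun h' => hs.sep q h' p hp h.hpq.symm
  by_cases hq : q ∈ Y
  · exact key hs.symm hY hX (fun h' => hs.sep p h' q hq h.hpq)
      fun h' => Set.disjoint_left.1 hs.disj h' hq
  exact key hs hX hY hp hq

lemma cut1 (h : Subdivides H G i x p q r) (hH : Has1Cutset H) : Has1Cutset G := by
  obtain ⟨v, X, Y, hX, hY, hd, hvX, hvY, hcov, hsep⟩ := hH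
  have key : ∀ {X Y : Set W}, X.Nonempty → Y.Nonempty → Disjoint X Y → v ∉ X → v ∉ Y →
      (∀ w, w ∈ X ∨ w ∈ Y ∨ w = v) → (∀ x ∈ X, ∀ y ∈ Y, ¬ H.Adj x y) → p ∉ Y → q ∉ Y →
      Has1Cutset G := by
    intro X Y hX hY hd hvX hvY hcov hsep hp hq
    refine ⟨i v, insert x (i '' X), i '' Y, Set.insert_nonempty _ _, hY.image i, ?_, ?_, ?_, ?_, ?_⟩
    · rw [Set.disjoint_left]
      rintro _ (rfl | ⟨w, hw, rfl⟩) ⟨t, ht, htw⟩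
      · exact h.ne t htw
      · exact Set.disjoint_left.1 hd hw (h.inj htw ▸ ht)
    · simpa [h.ne, h.inj.mem_set_image] using hvX
    · simpa [h.inj.mem_set_image] using hvY
    · intro u
      by_cases hu : u = x
      · exact .inl (.inl hu)
      · obtain ⟨w, rfl⟩ := h.surj u hu
        simp only [Set.mem_insert_iff, h.inj.mem_set_image, h.inj.eq_iff]
        have := hcov w
        tauto
    · rintro _ (rfl | ⟨w, hw, rfl⟩) _ ⟨t, ht, rfl⟩ hadj
      · rcases (h.adj_new _).1 hadj with h' | h'
        · exact hp (h.inj h' ▸ ht)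
        · exact hq (h.inj h' ▸ ht)
      · exact hsep w hw t ht (h.of_adj hadj)
  have hsep' : ∀ y ∈ Y, ∀ x ∈ X, ¬ H.Adj y x := fun y hy x hx hxy => hsep x hx y hy hxy.symm
  have hcov' : ∀ w, w ∈ Y ∨ w ∈ X ∨ w = v := fun w => by have := hcov w; tauto
  by_cases hp : p ∈ Y
  · exact key hY hX hd.symm hvY hvX hcov' hsep' (fun h' => Set.disjoint_left.1 hd h' hp)
      fun h' => hsep q h' p hp h.hpq.symm
  by_cases hq : q ∈ Y
  · exact key hY hX hd.symm hvY hvX hcov' hsep' (fun h' => hsep p h' q hq h.hpq)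
      fun h' => Set.disjoint_left.1 hd h' hq
  exact key hX hY hd hvX hvY hcov hsep hp hq

/-- The set of vertices of `G` corresponding to `I`; it contains the new vertex if `q` lies in
`I`. -/
def liftSet (i : W → V) (x : V) (q : W) (I : Set W) : Set V :=
  {v | (∃ w ∈ I, i w = v) ∨ (q ∈ I ∧ v = x)}

lemma mem_liftSet (h : Subdivides H G i x p q r) {w : W} {I : Set W} :
    i w ∈ liftSet i x q I ↔ w ∈ I := by
  constructor
  · rintro (⟨t, ht, htw⟩ | ⟨-, hw⟩)
    · exact h.inj htw ▸ ht
    · exact absurd hw (h.ne w)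
  · exact fun hw => .inl ⟨w, hw, rfl⟩

lemma new_mem_liftSet (h : Subdivides H G i x p q r) {I : Set W} :
    x ∈ liftSet i x q I ↔ q ∈ I := by
  constructor
  · rintro (⟨t, ht, htw⟩ | ⟨hq, -⟩)
    · exact absurd htw (h.ne t)
    · exact hq
  · exact fun hq => .inr ⟨hq, rfl⟩

lemma conn (h : Subdivides H G i x p q r) {I : Set W} (hI : Conn H I) :
    Conn G (liftSet i x q I) := by
  have hxp : G.Adj x (i p) := (h.adj_new _).2 (.inl rfl)
  have hxq : G.Adj x (i q) := (h.adj_new _).2 (.inr rfl)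
  refine ⟨hI.1.elim fun w hw => ⟨i w, h.mem_liftSet.2 hw⟩, fun A hA hne hA' => ?_⟩
  set B : Set W := {w | i w ∈ A} with hB
  have hBI : B ⊆ I := fun w hw => h.mem_liftSet.1 (hA hw)
  by_cases hBe : B.Nonempty
  · by_cases hBeq : B = I
    · have hxI : q ∈ I ∧ x ∉ A := by
        by_contra hcon
        refine hA' (subset_antisymm hA ?_)
        rintro _ (⟨w, hw, rfl⟩ | ⟨hq, rfl⟩)
        · exact hBeq.symm.subset hw
        · by_contra hxA
          exact hcon ⟨hq, hxA⟩
      exact ⟨i q, hBeq.symm.subset hxI.1, x, ⟨h.new_mem_liftSet.2 hxI.1, hxI.2⟩, hxq.symm⟩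
    · obtain ⟨a, ha, b, ⟨hbI, hbB⟩, hab⟩ := hI.2 B hBI hBe hBeq
      have hbA : i b ∈ liftSet i x q I \ A := ⟨h.mem_liftSet.2 hbI, hbB⟩
      by_cases hG : G.Adj (i a) (i b)
      · exact ⟨i a, ha, i b, hbA, hG⟩
      have hpq := ((h.adj a b).1 hab).resolve_left hG
      have hq : q ∈ I := by
        rcases hpq with ⟨-, rfl⟩ | ⟨rfl, -⟩
        · exact hbI
        · exact hBI ha
      have hxa : G.Adj x (i a) := by
        rcases hpq with ⟨rfl, -⟩ | ⟨rfl, -⟩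
        · exact hxp
        · exact hxq
      have hxb : G.Adj x (i b) := by
        rcases hpq with ⟨-, rfl⟩ | ⟨-, rfl⟩
        · exact hxq
        · exact hxp
      by_cases hxA : x ∈ A
      · exact ⟨x, hxA, i b, hbA, hxb⟩
      · exact ⟨i a, ha, x, ⟨h.new_mem_liftSet.2 hq, hxA⟩, hxa.symm⟩
  · obtain ⟨v, hv⟩ := hne
    rcases hA hv with ⟨w, -, rfl⟩ | ⟨hq, rfl⟩
    · exact absurd ⟨w, hv⟩ hBe
    · exact ⟨v, hv, i q, ⟨h.mem_liftSet.2 hq, fun h' => hBe ⟨q, h'⟩⟩, hxq⟩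

lemma touch (h : Subdivides H G i x p q r) {u : W} {I : Set W} (hu : u ≠ q)
    (ht : Touch H {u} I) : Touch G {i u} (liftSet i x q I) := by
  obtain ⟨_, rfl, t, htI, hut⟩ := ht
  rcases (h.adj _ t).1 hut with hG | ⟨rfl, rfl⟩ | ⟨rfl, -⟩
  · exact ⟨_, rfl, i t, h.mem_liftSet.2 htI, hG⟩
  · exact ⟨_, rfl, x, h.new_mem_liftSet.2 htI, ((h.adj_new _).2 (.inl rfl)).symm⟩
  · exact absurd rfl hu

lemma touch_of_liftSet (h : Subdivides H G i x p q r) {I J : Set W} (hd : Disjoint I J)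
    (ht : Touch G (liftSet i x q I) (liftSet i x q J)) : Touch H I J := by
  rw [Set.disjoint_left] at hd
  have key : ∀ {I J : Set W} {b : W}, q ∈ I → b ∈ J → q ∉ J → G.Adj x (i b) → Touch H I J := by
    intro I J b hq hb hqJ hxb
    rcases (h.adj_new _).1 hxb with h' | h'
    · exact ⟨q, hq, b, hb, h.inj h' ▸ h.hpq.symm⟩
    · exact absurd (h.inj h' ▸ hb) hqJ
  obtain ⟨_, ⟨a, ha, rfl⟩ | ⟨hq, rfl⟩, _, ⟨b, hb, rfl⟩ | ⟨hq', rfl⟩, hab⟩ := ht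
  · exact ⟨a, ha, b, hb, h.of_adj hab⟩
  · exact (key hq' ha (fun h' => hd h' hq') hab.symm).symm
  · exact key hq hb (hd hq) hab
  · exact absurd hq' (hd hq)

lemma bypassTouch (h : Subdivides H G i x p q r) (hG : BypassTouch G) : BypassTouch H := by
  intro u v I J hb
  have key : ∀ {u v}, Bypass H u v I J → u ≠ q := by
    rintro u v hb rfl
    obtain ⟨_, rfl, s, hs, hus⟩ := hb.tuI
    obtain ⟨_, rfl, t, ht, hut⟩ := hb.tuJ
    have h1 := (h.adj_q s).1 hus
    have h2 := (h.adj_q t).1 hut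
    have h3 := (h.adj_q v).1 hb.adj
    have h4 : s ≠ t := fun h' => Set.disjoint_left.1 hb.disj hs (h' ▸ ht)
    have h5 : v ≠ s := fun h' => hb.vI (h' ▸ hs)
    have h6 : v ≠ t := fun h' => hb.vJ (h' ▸ ht)
    grind
  have hu := key hb
  have hv := key (u := v) (v := u) ⟨hb.adj.symm, hb.connI, hb.connJ, hb.disj, hb.vI, hb.uI, hb.vJ,
    hb.uJ, hb.tvI, hb.tuI, hb.tvJ, hb.tuJ⟩
  refine h.touch_of_liftSet hb.disj (hG (i u) (i v) _ _ ⟨h.adj_of_ne hb.adj hu hv, h.conn hb.connI,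
    h.conn hb.connJ, ?_, mt h.mem_liftSet.1 hb.uI, mt h.mem_liftSet.1 hb.vI,
    mt h.mem_liftSet.1 hb.uJ, mt h.mem_liftSet.1 hb.vJ, h.touch hu hb.tuI, h.touch hv hb.tvI,
    h.touch hu hb.tuJ, h.touch hv hb.tvJ⟩)
  have hd := Set.disjoint_left.1 hb.disj
  rw [Set.disjoint_left]
  rintro _ (⟨w, hw, rfl⟩ | ⟨hq, rfl⟩) h'
  · exact hd hw (h.mem_liftSet.1 h')
  · exact hd hq (h.new_mem_liftSet.1 h')

lemma no_common (h : Subdivides H G i x p q r) (hG : Indecomposable G) : ¬ H.Adj p r := by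
  intro hpr
  exact hG.sq (i p) (i q) x (i r) (h.inj.ne h.hpq.ne) (h.ne r).symm
    ((h.adj_new _).2 (.inl rfl)).symm (h.adj_of_ne hpr h.hpq.ne h.hrq.ne)
    ((h.adj_new _).2 (.inr rfl)).symm
    (((h.adj r q).1 h.hrq).resolve_right (by have := h.ne'; have := h.hpq.ne; tauto)).symm

lemma no_square [Finite V] (h : Subdivides H G i x p q r) (hG : Indecomposable G) {z : W}
    (hz : z ≠ q) (hpz : H.Adj p z) (hrz : H.Adj r z) : False := by
  have hqr : G.Adj (i q) (i r) :=
    (((h.adj r q).1 h.hrq).resolve_right (by have := h.ne'; have := h.hpq.ne; tauto)).symm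
  refine hG.no_pentagon (x := x) (y := i q) (x' := i p) (y' := i r) (z := i z) h.adj_new ?_
    (h.inj.ne h.ne') (h.ne z) (h.inj.ne hz) (h.adj_of_ne hpz h.hpq.ne hz)
    (h.adj_of_ne hrz h.hrq.ne hz)
  intro v
  constructor
  · intro hv
    by_cases hvx : v = x
    · exact .inl hvx
    · obtain ⟨t, rfl⟩ := h.surj v hvx
      rcases (h.adj_q t).1 (h.of_adj hv) with rfl | rfl
      · exact absurd hv.symm h.nadj
      · exact .inr rfl
  · rintro (rfl | rfl)
    · exact ((h.adj_new _).2 (.inr rfl)).symm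
    · exact hqr

lemma indecomposable [Finite V] (h : Subdivides H G i x p q r) (hG : Indecomposable G) :
    Indecomposable H := by
  refine ⟨h.bypassTouch hG.bypass, ?_, ?_, fun h1 => hG.cut1 (h.cut1 h1),
    fun a b X Y hs hX hY => h.cut2 hG hs hX hY, ?_⟩
  · intro a b c hab hac hbc
    have key : ∀ {s t}, H.Adj q s → H.Adj q t → ¬ H.Adj s t := by
      intro s t hs ht hst
      rcases (h.adj_q s).1 hs with rfl | rfl <;> rcases (h.adj_q t).1 ht with rfl | rfl
      · exact hst.ne rfl
      · exact h.no_common hG hst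
      · exact h.no_common hG hst.symm
      · exact hst.ne rfl
    by_cases ha : a = q
    · subst ha; exact key hab hac hbc
    by_cases hb : b = q
    · subst hb; exact key hab.symm hbc hac
    by_cases hc : c = q
    · subst hc; exact key hac.symm hbc.symm hab
    exact hG.tri _ _ _ (h.adj_of_ne hab ha hb) (h.adj_of_ne hac ha hc) (h.adj_of_ne hbc hb hc)
  · intro a b c d hab hcd hac had hbc hbd
    have key : ∀ {s t z}, s ≠ t → z ≠ q → H.Adj q s → H.Adj q t →
        H.Adj z s → H.Adj z t → False := by
      intro s t z hst hz hs ht hzs hzt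
      rcases (h.adj_q s).1 hs with rfl | rfl <;> rcases (h.adj_q t).1 ht with rfl | rfl
      · exact hst rfl
      · exact h.no_square hG hz hzs.symm hzt.symm
      · exact h.no_square hG hz hzt.symm hzs.symm
      · exact hst rfl
    by_cases ha : a = q
    · subst ha; exact key hcd hab.symm hac had hbc hbd
    by_cases hb : b = q
    · subst hb; exact key hcd hab hbc hbd hac had
    by_cases hc : c = q
    · subst hc; exact key hab hcd.symm hac.symm hbc.symm had.symm hbd.symm
    by_cases hd : d = q
    · subst hd; exact key hab hcd had.symm hbd.symm hac.symm hbc.symm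
    exact hG.sq _ _ _ _ (h.inj.ne hab) (h.inj.ne hcd) (h.adj_of_ne hac ha hc)
      (h.adj_of_ne had ha hd) (h.adj_of_ne hbc hb hc) (h.adj_of_ne hbd hb hd)
  · obtain ⟨u, v, huv, hu, hv⟩ := hG.branch
    have hx : (G.neighborSet x).ncard ≤ 2 := by
      rw [show G.neighborSet x = {i p, i q} from Set.ext h.adj_new]
      exact ncard_pair_le _ _
    obtain ⟨a, rfl⟩ := h.surj u (by rintro rfl; omega)
    obtain ⟨b, rfl⟩ := h.surj v (by rintro rfl; omega)
    exact ⟨a, b, h.of_adj huv, by rwa [h.ncard_neighborSet], by rwa [h.ncard_neighborSet]⟩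

end Subdivides

lemma exists_subdivides [Finite V] (htri : ∀ a b c, G.Adj a b → G.Adj a c → ¬ G.Adj b c) {x y : V}
    (hxy : G.Adj x y) (hx : (G.neighborSet x).ncard = 2) (hy : (G.neighborSet y).ncard = 2) :
    ∃ (H : SimpleGraph {v // v ≠ x}) (p q r : {v // v ≠ x}),
      Subdivides H G Subtype.val x p q r := by
  have other : ∀ {s t : V}, G.Adj s t → (G.neighborSet s).ncard = 2 →
      ∃ w, w ≠ t ∧ ∀ v, G.Adj s v ↔ v = w ∨ v = t := by
    intro s t hst hs
    obtain ⟨a, b, hab, he⟩ := Set.ncard_eq_two.1 hs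
    have he' : ∀ v, G.Adj s v ↔ v = a ∨ v = b := fun v => by
      rw [← SimpleGraph.mem_neighborSet, he, Set.mem_insert_iff, Set.mem_singleton_iff]
    rcases (he' t).1 hst with rfl | rfl
    · exact ⟨b, hab.symm, fun v => by rw [he', or_comm]⟩
    · exact ⟨a, hab, he'⟩
  obtain ⟨p, hpy, hp⟩ := other hxy hx
  obtain ⟨r, hrx, hr⟩ := other hxy.symm hy
  have hxp : G.Adj x p := (hp p).2 (.inl rfl)
  have hyr : G.Adj y r := (hr r).2 (.inl rfl)
  have hnadj : ¬ G.Adj p y := htri x p y hxp hxy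
  refine ⟨⟨fun a b => G.Adj a b ∨ (a.1 = p ∧ b.1 = y) ∨ (a.1 = y ∧ b.1 = p), ?_, ?_⟩,
    ⟨p, hxp.ne'⟩, ⟨y, hxy.ne'⟩, ⟨r, hrx⟩, Subtype.val_injective, fun w => w.2,
    fun v hv => ⟨⟨v, hv⟩, rfl⟩, ?_, hnadj, hp, ?_, ?_⟩
  · refine ⟨?_⟩
    rintro a b (h | h | h)
    · exact .inl h.symm
    · exact .inr (.inr h.symm)
    · exact .inr (.inl h.symm)
  · refine ⟨fun a h => ?_⟩
    rcases h with h | ⟨h1, h2⟩ | ⟨h1, h2⟩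
    · exact h.ne rfl
    · exact hpy (h1.symm.trans h2)
    · exact hpy (h2.symm.trans h1)
  · intro a b
    simp only [Subtype.ext_iff]
  · rintro ⟨t, ht⟩
    simp only [Subtype.ext_iff, hr, ht, hpy.symm, false_and, true_and, false_or, or_false]
    tauto
  · intro h
    have : p = r := congrArg Subtype.val h
    exact hnadj (this ▸ hyr.symm)

/-- The theorem for graphs without decompositions, by contracting edges between vertices of
degree 2. -/
theorem Indecomposable.isTwoExtensionOf (n : ℕ) : ∀ {V : Type} [Finite V] {G : SimpleGraph V},
    Nat.card V = n → Indecomposable G →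
      IsTwoExtensionOf petersen G ∨ IsTwoExtensionOf heawood G := by
  induction n using Nat.strong_induction_on with
  | _ n ih =>
    intro V _ G hn hG
    by_cases hred : ∀ x y, G.Adj x y → (G.neighborSet x).ncard = 2 → (G.neighborSet y).ncard ≠ 2
    · obtain ⟨u, v, huv, hu, hv⟩ := hG.branch
      exact (hG.core hred).isTwoExtensionOf hu hv huv
    · push Not at hred
      obtain ⟨x, y, hxy, hx, hy⟩ := hred
      obtain ⟨H, p, q, r, h⟩ := exists_subdivides hG.tri hxy hx hy
      have hlt : Nat.card {v // v ≠ x} < n := hn ▸ Finite.card_subtype_lt (x := x) (by simp)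
      exact (ih _ hlt rfl (h.indecomposable hG)).imp
        (fun ⟨S, hS⟩ => ⟨S, h.isSubdivisionOf hS⟩) fun ⟨S, hS⟩ => ⟨S, h.isSubdivisionOf hS⟩

end UF

namespace UF

variable {V : Type} {G : SimpleGraph V}

lemma Conn.exists_walk {T : Set V} (hT : Conn G T) {a b : V} (ha : a ∈ T) (hb : b ∈ T) :
    ∃ p : G.Walk a b, ∀ v ∈ p.support, v ∈ T := by
  set A : Set V := {v | ∃ p : G.Walk a v, ∀ w ∈ p.support, w ∈ T} with hA
  have hAT : A ⊆ T := fun v ⟨p, hp⟩ => hp v p.end_mem_support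
  by_cases hne : A = T
  · exact hne.symm.subset hb
  obtain ⟨u, ⟨p, hp⟩, v, ⟨hvT, hvA⟩, huv⟩ := hT.2 A hAT ⟨a, .nil, by simpa using ha⟩ hne
  refine absurd ⟨p.concat huv, fun w hw => ?_⟩ hvA
  rw [Walk.support_concat, List.mem_append, List.mem_singleton] at hw
  exact hw.elim (hp w) fun h => h ▸ hvT

lemma Separates.touch [Finite V] (h1 : ¬ Has1Cutset G) {a b : V} {X Y S : Set V}
    (h : Separates G a b X Y) (hS : S.Nonempty) (hSX : S ⊆ X)
    (hcomp : ∀ y ∈ X, y ∉ S → ∀ s ∈ S, ¬ G.Adj s y) : Touch G {a} S := by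
  by_contra ht
  refine h1 (has1Cutset_of_component hS (fun h' => h.aX (hSX h')) h.ne (fun h' => h.bX (hSX h'))
    hcomp fun y hy hyb => ?_)
  rcases h.cover y with h' | h' | rfl | rfl
  · exact absurd h' hy
  · rintro ⟨_, rfl, s, hs, hys⟩
    exact h.sep s (hSX hs) _ h' hys.symm
  · exact ht
  · exact absurd rfl hyb

lemma Separates.swap {a b : V} {X Y : Set V} (h : Separates G a b X Y) : Separates G b a X Y :=
  ⟨h.ne.symm, fun h' => h.nadj h'.symm, fun v => by have := h.cover v; tauto, h.disj, h.bX, h.bY,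
    h.aX, h.aY, h.sep⟩

lemma Separates.containsPathBetween [Finite V] (h1 : ¬ Has1Cutset G) {a b : V} {X Y : Set V}
    (h : Separates G a b X Y) (hX : X.Nonempty) : ContainsPathBetween G (X ∪ {a, b}) a b := by
  classical
  obtain ⟨x, hx⟩ := hX
  obtain ⟨S, -, hSX, hS, hcomp⟩ := exists_component (G := G) hx
  obtain ⟨_, rfl, s, hs, has⟩ := h.touch h1 hS.1 hSX hcomp
  obtain ⟨_, rfl, t, ht, hbt⟩ := h.swap.touch h1 hS.1 hSX hcomp
  obtain ⟨p, hp⟩ := ((hS.insert_adj ht hbt).insert_adj (.inr hs) has).exists_walk (.inl rfl)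
    (.inr (.inl rfl))
  refine ⟨p.bypass, p.bypass_isPath, fun v hv => ?_⟩
  rcases hp v (p.support_bypass_subset_support hv) with h' | h' | h'
  · exact .inr (.inl h')
  · exact .inr (.inr h')
  · exact .inl (hSX h')

lemma Separates.not_inducedIsPathGraph [Finite V] {a b : V} {X Y : Set V}
    (h : Separates G a b X Y) (hX : Rich G a b X) :
    ¬ InducedIsPathGraph G (X ∪ {a, b}) a b := by
  rintro ⟨p, hp, hsupp, hind⟩
  have hsub : ∀ v ∈ X ∪ {a, b}, G.neighborSet v ∩ (X ∪ {a, b}) ⊆ p.toSubgraph.neighborSet v :=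
    fun v hv w hw => Walk.adj_toSubgraph_iff_mem_edges.2 (hind v w hv hw.2 hw.1)
  have hnil : ¬ p.Nil := fun hn => h.ne hn.eq
  rcases hX.2 with ⟨v, hv, hd⟩ | hd | hd
  · obtain ⟨i, hi, hil⟩ := Walk.mem_support_iff_exists_getVert.1 ((hsupp v).1 (.inl hv))
    have hi0 : i ≠ 0 := by
      rintro rfl
      exact h.aX (by rwa [← hi, Walk.getVert_zero] at hv)
    have hil' : i ≠ p.length := by
      rintro rfl
      exact h.bX (by rwa [← hi, Walk.getVert_length] at hv)
    have hN : G.neighborSet v ⊆ X ∪ {a, b} := by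
      intro w hw
      rcases h.cover w with h' | h' | h' | h'
      · exact .inl h'
      · exact absurd hw (h.sep v hv w h')
      · exact .inr (.inl h')
      · exact .inr (.inr h')
    have h2 := hp.ncard_neighborSet_toSubgraph_internal_eq_two hi0 (by omega)
    have h3 := Set.ncard_le_ncard (hsub v (.inl hv))
    rw [Set.inter_eq_left.2 hN, ← hi, h2, hi] at h3
    omega
  · have h3 := Set.ncard_le_ncard ((Set.inter_subset_inter_right _ Set.subset_union_left).trans
      (hsub a (.inr (.inl rfl))))
    rw [hp.neighborSet_toSubgraph_startpoint hnil, Set.ncard_singleton] at h3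
    omega
  · have h3 := Set.ncard_le_ncard ((Set.inter_subset_inter_right _ Set.subset_union_left).trans
      (hsub b (.inr (.inr rfl))))
    rw [hp.neighborSet_toSubgraph_endpoint hnil, Set.ncard_singleton] at h3
    omega

lemma Separates.hasProper2Cutset [Finite V] (h1 : ¬ Has1Cutset G) {a b : V} {X Y : Set V}
    (h : Separates G a b X Y) (hX : Rich G a b X) (hY : Rich G a b Y) : HasProper2Cutset G :=
  ⟨a, b, X, Y, h.ne, h.nadj, h.cover, h.disj, h.aX, h.aY, h.bX, h.bY, hX.1, hY.1, h.sep,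
    h.containsPathBetween h1 (Set.nonempty_of_ncard_ne_zero (by have := hX.1; omega)),
    h.not_inducedIsPathGraph hX,
    h.symm.containsPathBetween h1 (Set.nonempty_of_ncard_ne_zero (by have := hY.1; omega)),
    h.symm.not_inducedIsPathGraph hY⟩

end UF

/-- Decomposition theorem for connected unichord-free graphs. -/
theorem stmt9 {V : Type} [Fintype V] (G : SimpleGraph V) (hc : G.Connected)
    (huf : UnichordFree G) :
    G = ⊤ ∨ Sparse G ∨ IsTwoExtensionOf petersen G ∨ IsTwoExtensionOf heawood G ∨
      Has1Cutset G ∨ HasProper2Cutset G ∨ HasProper1Join G := by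
  by_contra! hcon
  obtain ⟨htop, hsp, hpet, hhea, h1, h2, hj⟩ := hcon
  have htri : ∀ a b c, G.Adj a b → G.Adj a c → ¬ G.Adj b c := fun a b c hab hac hbc =>
    htop (UF.eq_top_of_triangle huf h1 hab hac hbc)
  have hG : UF.Indecomposable G := by
    refine ⟨huf.bypassTouch, htri, fun a b c d hab hcd hac had hbc hbd => hj
      (UF.hasProper1Join_of_square huf htri hac hbc.symm hbd had.symm hab hcd), h1,
      fun a b X Y hs hX hY => h2 (hs.hasProper2Cutset h1 hX hY), ?_⟩
    unfold Sparse at hsp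
    push Not at hsp
    exact hsp
  exact (hG.isTwoExtensionOf _ rfl).elim hpet hhea
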